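/- Let V be a finite-dimensional real vector space of dimension n and A ≤ Aff(V) a Zariski-closed subgroup acting transitively on V. Then the deformation space D_c(ℤ^n, A) is homeomorphic to a semi-algebraic set, i.e., to a finite union of subsets of some ℝ^N each defined by finitely many polynomial equations and finitely many strict polynomial inequalities; in particular D_c(ℤ^n, A) is a Hausdorff space. -/

import Mathlib

noncomputable section

/-- The orbit equivalence relation on `V` induced by a subgroup `G` of affine
transformations of `V`. -/
def affOrbitSetoid {V : Type*} [NormedAddCommGroup V] [NormedSpace ℝ V]
    (G : Subgroup (V ≃ᵃ[ℝ] V)) : Setoid V where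
  r x y := ∃ g ∈ G, g x = y
  iseqv := by
    refine ⟨fun x => ⟨1, G.one_mem, rfl⟩, ?_, ?_⟩
    · rintro x y ⟨g, hg, rfl⟩
      exact ⟨g⁻¹, G.inv_mem hg, g.symm_apply_apply x⟩
    · rintro x y z ⟨g, hg, rfl⟩ ⟨k, hk, rfl⟩
      exact ⟨k * g, G.mul_mem hk hg, rfl⟩

/-- A subgroup `G ≤ Aff(V)` is properly discontinuous if for every compact `K ⊆ V`
the set of `g ∈ G` with `gK ∩ K ≠ ∅` is finite. -/
def ProperlyDiscontinuousAff {V : Type*} [NormedAddCommGroup V] [NormedSpace ℝ V]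
    (G : Subgroup (V ≃ᵃ[ℝ] V)) : Prop :=
  ∀ K : Set V, IsCompact K → {g : V ≃ᵃ[ℝ] V | g ∈ G ∧ ((g '' K) ∩ K).Nonempty}.Finite

/-- A subgroup `G ≤ Aff(V)` is an affine crystallographic group if it acts properly
discontinuously on `V` and the orbit space `G \ V` is compact. -/
def IsCrystallographic {V : Type*} [NormedAddCommGroup V] [NormedSpace ℝ V]
    (G : Subgroup (V ≃ᵃ[ℝ] V)) : Prop :=
  ProperlyDiscontinuousAff G ∧ CompactSpace (Quotient (affOrbitSetoid G))

/-- The image of an affine transformation `g : v ↦ Av + b` of `V` in `GL(V ⊕ ℝ)`,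
as the linear endomorphism `(v, t) ↦ (Av + t • b, t)` of `V × ℝ`, corresponding to the
block matrix `(A b; 0 1)`. -/
def affToLin {V : Type*} [NormedAddCommGroup V] [NormedSpace ℝ V]
    (g : V ≃ᵃ[ℝ] V) : Module.End ℝ (V × ℝ) :=
  LinearMap.prod
    (((g.linear : V →ₗ[ℝ] V).comp (LinearMap.fst ℝ V ℝ)) +
      ((LinearMap.toSpanSingleton ℝ V (g 0)).comp (LinearMap.snd ℝ V ℝ)))
    (LinearMap.snd ℝ V ℝ)

/-- The matrix of the image of an affine transformation in `GL(V ⊕ ℝ)`, with respect to a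
fixed basis of `V × ℝ`. -/
def affEntry {V : Type*} [NormedAddCommGroup V] [NormedSpace ℝ V] [FiniteDimensional ℝ V]
    (g : V ≃ᵃ[ℝ] V) :
    Matrix (Fin (Module.finrank ℝ (V × ℝ))) (Fin (Module.finrank ℝ (V × ℝ))) ℝ :=
  LinearMap.toMatrix (Module.finBasis ℝ (V × ℝ)) (Module.finBasis ℝ (V × ℝ)) (affToLin g)

/-- A set of affine transformations is Zariski-closed if it is the intersection of
`Aff(V)` with the common zero set of a family of real polynomial functions of the matrix
entries in `GL(V ⊕ ℝ)`. -/
def IsZariskiClosedAff {V : Type*} [NormedAddCommGroup V] [NormedSpace ℝ V]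
    [FiniteDimensional ℝ V] (Z : Set (V ≃ᵃ[ℝ] V)) : Prop :=
  ∃ (ι : Type) (p : ι → MvPolynomial
      (Fin (Module.finrank ℝ (V × ℝ)) × Fin (Module.finrank ℝ (V × ℝ))) ℝ),
    ∀ g : V ≃ᵃ[ℝ] V,
      g ∈ Z ↔ ∀ i, MvPolynomial.eval (fun jk => affEntry g jk.1 jk.2) (p i) = 0

/-- `Aff(V)` carries the topology of pointwise convergence on `V`. -/
instance affTopology {V : Type*} [NormedAddCommGroup V] [NormedSpace ℝ V] :
    TopologicalSpace (V ≃ᵃ[ℝ] V) :=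
  TopologicalSpace.induced (fun g => (g : V → V)) Pi.topologicalSpace

/-- `Hom(Γ, Aff(V))` carries the topology of pointwise convergence. -/
instance homTopology {V : Type*} [NormedAddCommGroup V] [NormedSpace ℝ V]
    {Γ : Type*} [Group Γ] : TopologicalSpace (Γ →* (V ≃ᵃ[ℝ] V)) :=
  TopologicalSpace.induced (fun ρ => (ρ : Γ → (V ≃ᵃ[ℝ] V))) Pi.topologicalSpace

/-- The set of crystallographic homomorphisms of `Γ` with image in the subgroup
`A ≤ Aff(V)`. -/
def homC {V : Type*} [NormedAddCommGroup V] [NormedSpace ℝ V]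
    (A : Subgroup (V ≃ᵃ[ℝ] V)) (Γ : Type*) [Group Γ] : Set (Γ →* (V ≃ᵃ[ℝ] V)) :=
  {ρ | Function.Injective ρ ∧ (∀ γ : Γ, ρ γ ∈ A) ∧ IsCrystallographic ρ.range}

/-- The equivalence relation on `Hom_c(Γ, A)` given by conjugation by elements of `A`. -/
def conjSetoid {V : Type*} [NormedAddCommGroup V] [NormedSpace ℝ V]
    (A : Subgroup (V ≃ᵃ[ℝ] V)) (Γ : Type*) [Group Γ] : Setoid ↥(homC A Γ) where
  r ρ ρ' := ∃ a ∈ A,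
    ∀ γ : Γ, (ρ' : Γ →* (V ≃ᵃ[ℝ] V)) γ = a * (ρ : Γ →* (V ≃ᵃ[ℝ] V)) γ * a⁻¹
  iseqv := by
    refine ⟨fun ρ => ⟨1, A.one_mem, fun γ => by group⟩, ?_, ?_⟩
    · rintro ρ ρ' ⟨a, ha, h⟩
      exact ⟨a⁻¹, A.inv_mem ha, fun γ => by rw [h γ]; group⟩
    · rintro ρ ρ' ρ'' ⟨a, ha, h⟩ ⟨b, hb, h'⟩
      exact ⟨b * a, A.mul_mem hb ha, fun γ => by rw [h' γ, h γ]; group⟩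


/-- A basic semi-algebraic subset of `ℝ^N`: defined by finitely many polynomial equations
and finitely many strict polynomial inequalities. -/
def IsBasicSemialgebraic {N : ℕ} (S : Set (Fin N → ℝ)) : Prop :=
  ∃ (k l : ℕ) (p : Fin k → MvPolynomial (Fin N) ℝ) (q : Fin l → MvPolynomial (Fin N) ℝ),
    S = {x | (∀ i, MvPolynomial.eval x (p i) = 0) ∧ ∀ j, 0 < MvPolynomial.eval x (q j)}

/-- A semi-algebraic subset of `ℝ^N`: a finite union of basic semi-algebraic sets. -/
def IsSemialgebraicSet {N : ℕ} (S : Set (Fin N → ℝ)) : Prop :=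
  ∃ (m : ℕ) (T : Fin m → Set (Fin N → ℝ)),
    (∀ i, IsBasicSemialgebraic (T i)) ∧ S = ⋃ i, T i

section
open Polynomial

/-- trailing value of a polynomial at a point -/
noncomputable def trailVal (P : ℝ[X]) (x : ℝ) : ℝ :=
  (P /ₘ (X - C x) ^ (P.rootMultiplicity x)).eval x

lemma trail_spec {P : ℝ[X]} (hP : P ≠ 0) (x : ℝ) :
    ∃ G : ℝ[X], P = (X - C x) ^ (P.rootMultiplicity x) * G ∧ G.eval x = trailVal P x ∧
      trailVal P x ≠ 0 :=
  ⟨_, (pow_mul_divByMonic_rootMultiplicity_eq P x).symm, rfl,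
    eval_divByMonic_pow_rootMultiplicity_ne_zero x hP⟩

lemma trail_eq {P G : ℝ[X]} {x : ℝ} {m : ℕ} (h : P = (X - C x) ^ m * G) (hG : G.eval x ≠ 0) :
    P.rootMultiplicity x = m ∧ trailVal P x = G.eval x := by
  have hG0 : G ≠ 0 := by rintro rfl; simp at hG
  have hX : (X - C x) ^ m ≠ 0 := pow_ne_zero _ (X_sub_C_ne_zero x)
  have h1 : P.rootMultiplicity x = m := by
    rw [h, rootMultiplicity_mul (mul_ne_zero hX hG0), rootMultiplicity_X_sub_C_pow,
      rootMultiplicity_eq_zero hG, add_zero]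
  refine ⟨h1, ?_⟩
  unfold trailVal
  rw [h1, h, mul_divByMonic_cancel_left _ ((monic_X_sub_C x).pow m)]

lemma trail_mul {P Q : ℝ[X]} (hP : P ≠ 0) (hQ : Q ≠ 0) (x : ℝ) :
    (P * Q).rootMultiplicity x = P.rootMultiplicity x + Q.rootMultiplicity x ∧
    trailVal (P * Q) x = trailVal P x * trailVal Q x := by
  obtain ⟨G, h1, h2, h3⟩ := trail_spec hP x
  obtain ⟨G', h1', h2', h3'⟩ := trail_spec hQ x
  have := trail_eq (P := P * Q) (G := G * G') (x := x)
    (m := P.rootMultiplicity x + Q.rootMultiplicity x) (by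
      nth_rewrite 1 [h1, h1']; ring) (by rw [eval_mul, h2, h2']; exact mul_ne_zero h3 h3')
  rwa [eval_mul, h2, h2'] at this

/-- no roots to the right: sign is that of the leading coefficient -/
lemma sign_right {G : ℝ[X]} (x : ℝ) (h : ∀ z, x ≤ z → G.eval z ≠ 0) :
    SignType.sign (G.eval x) = SignType.sign G.leadingCoeff := by
  wlog hpos : 0 ≤ G.leadingCoeff generalizing G
  · have := this (G := -G) (fun z hz => by simpa using h z hz) (by simp; linarith)
    simpa [Left.sign_neg] using this
  have hG0 : G ≠ 0 := by rintro rfl; simpa using h x le_rfl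
  have hlc : 0 < G.leadingCoeff := lt_of_le_of_ne hpos (Ne.symm (leadingCoeff_ne_zero.2 hG0))
  rw [sign_pos hlc]
  rcases le_or_gt G.degree 0 with hd | hd
  · have hc := eq_C_of_degree_le_zero hd
    rw [hc] at hlc ⊢
    simp at hlc ⊢
    exact sign_pos hlc
  · have ht := tendsto_atTop_of_leadingCoeff_nonneg G hd hpos
    obtain ⟨z, hz1, hz2⟩ := ((ht.eventually_gt_atTop 0).and (Filter.eventually_ge_atTop x)).exists
    rw [sign_eq_one_iff]
    by_contra hneg
    push Not at hneg
    obtain ⟨c, hc1, hc2⟩ := intermediate_value_Icc hz2 (G.continuous.continuousOn)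
      (show (0:ℝ) ∈ Set.Icc _ _ from ⟨hneg, hz1.le⟩)
    exact h c hc1.1 hc2

lemma sign_left {G : ℝ[X]} (x : ℝ) (h : ∀ z, z ≤ x → G.eval z ≠ 0) :
    (SignType.sign (G.eval x) : ℤ) = SignType.sign G.leadingCoeff * (-1) ^ G.natDegree := by
  have := sign_right (G := G.comp (-X)) (-x) (fun z hz => by
    simpa using h (-z) (by linarith))
  rw [eval_comp] at this
  have h2 : (G.comp (-X)).leadingCoeff = G.leadingCoeff * (-1) ^ G.natDegree := by
    rw [leadingCoeff_comp] <;> simp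
  rw [h2] at this
  simp only [eval_neg, eval_X, neg_neg] at this
  rw [this, sign_mul, sign_pow]
  simp

/-- local jump -/
noncomputable def jumpAt (F : ℝ[X]) (x : ℝ) : ℤ :=
  if Odd (F.rootMultiplicity x) then SignType.sign (trailVal F x) else 0

lemma jump_sum : ∀ (k : ℕ) (F : ℝ[X]), F ≠ 0 → F.roots.toFinset.card = k →
    2 * ∑ x ∈ F.roots.toFinset, jumpAt F x =
      SignType.sign F.leadingCoeff * (1 - (-1) ^ F.natDegree) := by
  intro k
  induction k with
  | zero =>
    intro F hF hk
    have he : F.roots.toFinset = ∅ := Finset.card_eq_zero.1 hk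
    have hr : ∀ z, F.eval z ≠ 0 := by
      intro z hz
      have : z ∈ F.roots.toFinset := by simp [hF, hz]
      simp [he] at this
    have h1 := sign_right (G := F) 0 (fun z _ => hr z)
    have h2 := sign_left (G := F) 0 (fun z _ => hr z)
    rw [h1] at h2
    rw [he]
    simp only [Finset.sum_empty, mul_zero]
    linear_combination -h2
  | succ k ih =>
    intro F hF hk
    have hne : F.roots.toFinset.Nonempty := Finset.card_pos.1 (by omega)
    set x := F.roots.toFinset.max' hne with hx
    have hxm : x ∈ F.roots.toFinset := Finset.max'_mem _ _
    obtain ⟨G, h1, h2, h3⟩ := trail_spec hF x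
    set m := F.rootMultiplicity x with hm
    have hG0 : G ≠ 0 := by rintro rfl; simp at h2; exact h3 h2.symm
    have hX : (X - C x) ^ m ≠ 0 := pow_ne_zero _ (X_sub_C_ne_zero x)
    have hmpos : 0 < m := by
      rw [hm, rootMultiplicity_pos hF]; simpa [hF] using hxm
    have hroots : G.roots.toFinset = F.roots.toFinset.erase x := by
      ext z
      simp only [Multiset.mem_toFinset, mem_roots hG0, Finset.mem_erase, mem_roots hF, IsRoot.def]
      constructor
      · intro hz
        refine ⟨?_, ?_⟩
        · rintro rfl; rw [h2] at hz; exact h3 hz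
        · rw [h1, eval_mul, hz, mul_zero]
      · rintro ⟨hz1, hz2⟩
        rw [h1, eval_mul] at hz2
        rcases mul_eq_zero.1 hz2 with h | h
        · simp at h; exact absurd (sub_eq_zero.1 h.1) hz1
        · exact h
    have hlc : F.leadingCoeff = G.leadingCoeff := by
      rw [h1, leadingCoeff_mul, ((monic_X_sub_C x).pow m).leadingCoeff, one_mul]
    have hdeg : F.natDegree = m + G.natDegree := by
      conv_lhs => rw [h1]
      rw [natDegree_mul hX hG0, natDegree_pow, natDegree_X_sub_C, mul_one]
    have ih' := ih G hG0 (by rw [hroots, Finset.card_erase_of_mem hxm, hk]; rfl)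
    rw [hroots] at ih'
    rw [← Finset.add_sum_erase _ _ hxm]
    have hjx : jumpAt F x = if Odd m then (SignType.sign G.leadingCoeff : ℤ) else 0 := by
      unfold jumpAt
      rw [← hm, ← h2, sign_right (G := G) x]
      intro z hz hz0
      have : z ∈ G.roots.toFinset := by simp [hG0, hz0]
      rw [hroots, Finset.mem_erase] at this
      have h4 := Finset.le_max' _ _ this.2
      exact this.1 (le_antisymm h4 hz)
    have hjz : ∀ z ∈ F.roots.toFinset.erase x, jumpAt F z = (-1) ^ m * jumpAt G z := by
      intro z hz
      rw [Finset.mem_erase] at hz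
      have hlt : z < x := lt_of_le_of_ne (Finset.le_max' _ _ hz.2) hz.1
      have h5 : ((X - C x) ^ m : ℝ[X]).eval z ≠ 0 := by
        simp only [eval_pow, eval_sub, eval_X, eval_C]
        exact pow_ne_zero _ (by linarith)
      have h6 := trail_eq (P := (X - C x) ^ m) (G := (X - C x) ^ m) (x := z) (m := 0)
        (by simp) h5
      have h7 := trail_mul hX hG0 z
      rw [← h1, h6.1, h6.2, zero_add] at h7
      unfold jumpAt
      rw [h7.1, h7.2]
      split_ifs
      · rw [sign_mul]
        simp only [eval_pow, eval_sub, eval_X, eval_C, sign_pow]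
        rw [sign_neg (by linarith : z - x < 0)]
        push_cast
        simp
      · simp
    rw [Finset.sum_congr rfl hjz, ← Finset.mul_sum, hjx, hlc, hdeg, pow_add]
    rcases Nat.even_or_odd m with he | ho
    · rw [if_neg (by simpa using he), he.neg_one_pow]
      linear_combination ih'
    · rw [if_pos ho, ho.neg_one_pow]
      linear_combination -ih'

/-- local Cauchy index of `R / P` -/
noncomputable def indAt (R P : ℝ[X]) (x : ℝ) : ℤ :=
  if R ≠ 0 ∧ R.rootMultiplicity x < P.rootMultiplicity x then jumpAt (R * P) x else 0

/-- Cauchy index of `R / P` -/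
noncomputable def cauchyInd (R P : ℝ[X]) : ℤ := ∑ x ∈ P.roots.toFinset, indAt R P x

lemma cauchy_recip {R P : ℝ[X]} (hR : R ≠ 0) (hP : P ≠ 0) :
    2 * (cauchyInd R P + cauchyInd P R) =
      SignType.sign (R.leadingCoeff * P.leadingCoeff) * (1 - (-1) ^ (R.natDegree + P.natDegree)) := by
  have h := jump_sum _ (R * P) (mul_ne_zero hR hP) rfl
  rw [leadingCoeff_mul, natDegree_mul hR hP] at h
  rw [← h]
  congr 1
  have hu : (R * P).roots.toFinset = R.roots.toFinset ∪ P.roots.toFinset := by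
    rw [roots_mul (mul_ne_zero hR hP), Multiset.toFinset_add]
  have key : ∀ A B : ℝ[X], A ≠ 0 → B ≠ 0 → ∀ s : Finset ℝ, B.roots.toFinset ⊆ s →
      cauchyInd A B = ∑ x ∈ s, indAt A B x := by
    intro A B hA hB s hs
    refine Finset.sum_subset hs fun x _ hx => ?_
    unfold indAt
    rw [if_neg]
    rintro ⟨-, h2⟩
    apply hx
    have h3 : 0 < B.rootMultiplicity x := by omega
    rw [rootMultiplicity_pos hB] at h3
    simpa [hB] using h3
  rw [key R P hR hP (R * P).roots.toFinset (by rw [hu]; exact Finset.subset_union_right),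
    key P R hP hR (R * P).roots.toFinset (by rw [hu]; exact Finset.subset_union_left),
    ← Finset.sum_add_distrib]
  refine Finset.sum_congr rfl fun x _ => ?_
  unfold indAt
  have hm := trail_mul hR hP x
  rcases lt_trichotomy (R.rootMultiplicity x) (P.rootMultiplicity x) with h1 | h1 | h1
  · rw [if_pos ⟨hR, h1⟩, if_neg (by rintro ⟨-, h2⟩; omega), add_zero]
  · rw [if_neg (by rintro ⟨-, h2⟩; omega), if_neg (by rintro ⟨-, h2⟩; omega)]
    unfold jumpAt
    rw [if_neg]
    · rfl
    · rw [hm.1, h1, Nat.not_odd_iff_even]; exact ⟨_, rfl⟩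
  · rw [if_neg (by rintro ⟨-, h2⟩; omega), if_pos ⟨hP, h1⟩, zero_add, mul_comm]

/-- `R / P` only matters modulo `P`, up to positive constants -/
lemma cauchy_mod {R R' S P : ℝ[X]} {c : ℝ} (hc : 0 < c) (h : C c * R = P * S + R') :
    cauchyInd R P = cauchyInd R' P := by
  by_cases hP : P = 0
  · simp [cauchyInd, hP]
  refine Finset.sum_congr rfl fun x _ => ?_
  have hcc : (C c : ℝ[X]) ≠ 0 := by simpa using hc.ne'
  have hCt := trail_eq (P := C c) (G := C c) (x := x) (m := 0) (by simp) (by simpa using hc.ne')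
  rw [eval_C] at hCt
  -- first compare R and C c * R
  have h1 : indAt R P x = indAt (C c * R) P x := by
    by_cases hR : R = 0
    · simp [hR]
    have hm := trail_mul hcc hR x
    have hm1 := trail_mul hR hP x
    have hm2 := trail_mul (mul_ne_zero hcc hR) hP x
    unfold indAt jumpAt
    rw [hm1.1, hm1.2, hm2.1, hm2.2, hm.1, hm.2, hCt.1, hCt.2, zero_add]
    simp only [ne_eq, hR, not_false_eq_true, true_and, mul_eq_zero, hcc, or_self, sign_mul,
      sign_pos hc, one_mul]
  rw [h1]
  -- then a lemma: adding multiples of P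
  have key : ∀ A S : ℝ[X], A ≠ 0 → A.rootMultiplicity x < P.rootMultiplicity x →
      (A + P * S ≠ 0 ∧ (A + P * S).rootMultiplicity x = A.rootMultiplicity x ∧
        trailVal (A + P * S) x = trailVal A x) := by
    intro A S hA hlt
    obtain ⟨G, g1, g2, g3⟩ := trail_spec hA x
    obtain ⟨G', g1', g2', g3'⟩ := trail_spec hP x
    obtain ⟨k, hk⟩ := Nat.exists_eq_add_of_lt hlt
    have hsum : A + P * S = (X - C x) ^ (A.rootMultiplicity x) *
        (G + (X - C x) ^ (k + 1) * G' * S) := by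
      conv_lhs => rw [g1, g1', hk]
      ring
    have hev : (G + (X - C x) ^ (k + 1) * G' * S).eval x = trailVal A x := by
      simp [g2]
    have := trail_eq hsum (by rw [hev]; exact g3)
    refine ⟨?_, this.1, this.2.trans hev⟩
    intro h0
    rw [h0] at hsum
    rcases mul_eq_zero.1 hsum.symm with h | h
    · exact pow_ne_zero _ (X_sub_C_ne_zero x) h
    · rw [h] at hev; simp at hev; exact g3 hev.symm
  have key2 : ∀ A B S : ℝ[X], B = A + P * S → A ≠ 0 →
      A.rootMultiplicity x < P.rootMultiplicity x → indAt A P x = indAt B P x := by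
    intro A B S hB hA hlt
    obtain ⟨k1, k2, k3⟩ := key A S hA hlt
    rw [← hB] at k1 k2 k3
    have hm1 := trail_mul hA hP x
    have hm2 := trail_mul k1 hP x
    unfold indAt jumpAt
    rw [hm1.1, hm1.2, hm2.1, hm2.2, k2, k3]
    simp [hA, k1]
  by_cases hA : C c * R ≠ 0 ∧ (C c * R).rootMultiplicity x < P.rootMultiplicity x
  · exact key2 _ _ (-S) (by rw [h]; ring) hA.1 hA.2
  by_cases hB : R' ≠ 0 ∧ R'.rootMultiplicity x < P.rootMultiplicity x
  · exact (key2 _ _ S (by rw [h]; ring) hB.1 hB.2).symm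
  unfold indAt
  rw [if_neg hA, if_neg hB]

/-- Tarski query as a Cauchy index -/
lemma tarski_query (P Q : ℝ[X]) :
    ∑ x ∈ P.roots.toFinset, (SignType.sign (Q.eval x) : ℤ) = cauchyInd (derivative P * Q) P := by
  by_cases hP : P = 0
  · simp [cauchyInd, hP]
  refine Finset.sum_congr rfl fun x hx => ?_
  have hroot : P.IsRoot x := by simpa [hP] using hx
  obtain ⟨G, g1, g2, g3⟩ := trail_spec hP x
  have hpos : 0 < P.rootMultiplicity x := by rwa [rootMultiplicity_pos hP]
  obtain ⟨k, hk⟩ := Nat.exists_eq_succ_of_ne_zero hpos.ne'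
  rw [hk] at g1
  set D : ℝ[X] := C ((k:ℝ) + 1) * G + (X - C x) * derivative G with hD
  have hder : derivative P = (X - C x) ^ k * D := by
    rw [hD]
    conv_lhs => rw [g1]
    rw [derivative_mul, derivative_X_sub_C_pow]
    simp
    ring
  have hDe : D.eval x = (k + 1) * trailVal P x := by simp [hD, g2]
  have hDne : D.eval x ≠ 0 := by rw [hDe]; exact mul_ne_zero (by positivity) g3
  have ht := trail_eq hder hDne
  have hd0 : derivative P ≠ 0 := by
    intro h0
    rw [h0] at hder
    rcases mul_eq_zero.1 hder.symm with h | h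
    · exact pow_ne_zero _ (X_sub_C_ne_zero x) h
    · rw [h] at hDne; simp at hDne
  by_cases hQ : Q = 0
  · simp [hQ, indAt]
  have hm := trail_mul hd0 hQ x
  have hm2 := trail_mul (mul_ne_zero hd0 hQ) hP x
  unfold indAt
  by_cases hQx : Q.eval x = 0
  · have hqp : 0 < Q.rootMultiplicity x := by rw [rootMultiplicity_pos hQ]; exact hQx
    rw [if_neg, hQx]
    · simp
    · rintro ⟨-, h2⟩
      rw [hm.1, ht.1, hk] at h2
      omega
  · have hq := trail_eq (P := Q) (G := Q) (x := x) (m := 0) (by simp) hQx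
    rw [if_pos]
    · unfold jumpAt
      rw [hm2.1, hm2.2, hm.1, hm.2, ht.1, ht.2, hq.1, hq.2, hk, if_pos, hDe]
      · have : ((k:ℝ) + 1) * trailVal P x * Q.eval x * trailVal P x =
          (((k:ℝ) + 1) * (trailVal P x * trailVal P x)) * Q.eval x := by ring
        have h0 : 0 < trailVal P x * trailVal P x := mul_self_pos.2 g3
        have h1 : 0 < ((k:ℝ) + 1) * (trailVal P x * trailVal P x) := by positivity
        rw [this, sign_mul, sign_pos h1, one_mul]
      · exact ⟨k, by simp; ring⟩
    · refine ⟨mul_ne_zero hd0 hQ, ?_⟩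
      rw [hm.1, ht.1, hq.1, hk]
      omega

end

section
open Polynomial

/-- A function on `X` is tame if it depends only on the signs of finitely many elements of `𝓐`
(evaluated at the points of `X`). -/
def Tame {X 𝓐 β : Type*} [CommRing 𝓐] (ev : X → 𝓐 →+* ℝ) (h : X → β) : Prop :=
  ∃ s : Finset 𝓐, ∀ x y, (∀ c ∈ s, SignType.sign (ev x c) = SignType.sign (ev y c)) → h x = h y

section TameBasic
variable {X 𝓐 β γ δ : Type*} [CommRing 𝓐] {ev : X → 𝓐 →+* ℝ}

lemma Tame.const (b : β) : Tame ev (fun _ : X => b) := ⟨∅, fun _ _ _ => rfl⟩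

lemma Tame.sgn (c : 𝓐) : Tame ev (fun x => SignType.sign (ev x c)) :=
  ⟨{c}, fun _ _ h => h c (by simp)⟩

lemma Tame.map {h : X → β} (hh : Tame ev h) (f : β → γ) : Tame ev (fun x => f (h x)) := by
  obtain ⟨s, hs⟩ := hh
  exact ⟨s, fun x y hxy => congrArg f (hs x y hxy)⟩

lemma Tame.map₂ {h : X → β} {k : X → γ} (hh : Tame ev h) (hk : Tame ev k) (f : β → γ → δ) :
    Tame ev (fun x => f (h x) (k x)) := by
  classical
  obtain ⟨s, hs⟩ := hh
  obtain ⟨t, ht⟩ := hk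
  refine ⟨s ∪ t, fun x y hxy => ?_⟩
  exact congrArg₂ f (hs x y fun c hc => hxy c (Finset.mem_union_left _ hc))
    (ht x y fun c hc => hxy c (Finset.mem_union_right _ hc))

lemma Tame.finset {ι : Type*} (s : Finset ι) {h : ι → X → β} (hh : ∀ i, Tame ev (h i)) :
    Tame ev (fun x (i : s) => h i x) := by
  classical
  choose t ht using hh
  refine ⟨s.biUnion t, fun x y hxy => ?_⟩
  funext i
  exact ht i x y fun c hc => hxy c (Finset.mem_biUnion.2 ⟨i, i.2, hc⟩)

lemma Tame.fintype {ι : Type*} [Finite ι] {h : ι → X → β} (hh : ∀ i, Tame ev (h i)) :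
    Tame ev (fun x i => h i x) := by
  haveI := Fintype.ofFinite ι
  have := (Tame.finset (Finset.univ : Finset ι) hh).map (fun f i => f ⟨i, Finset.mem_univ i⟩)
  exact this

lemma Tame.sum {ι : Type*} (s : Finset ι) {h : ι → X → ℤ} (hh : ∀ i, Tame ev (h i)) :
    Tame ev (fun x => ∑ i ∈ s, h i x) := by
  have := (Tame.finset s hh).map (fun f => ∑ i : s, f i)
  convert this using 2 with x
  exact (Finset.sum_coe_sort s (fun i => h i x)).symm

open Classical in
lemma Tame.cases {p : X → Prop} {h h1 h2 : X → β} (hp : Tame ev p) (t1 : Tame ev h1)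
    (t2 : Tame ev h2) (e1 : ∀ x, p x → h x = h1 x) (e2 : ∀ x, ¬ p x → h x = h2 x) :
    Tame ev h := by
  have := (hp.map₂ (t1.map₂ t2 Prod.mk)) (fun P q => if P then q.1 else q.2)
  convert this using 2 with x
  by_cases hx : p x
  · simp [hx, e1 x hx]
  · simp [hx, e2 x hx]

lemma Tame.zero (c : 𝓐) : Tame ev (fun x => ev x c = 0) := by
  have := (Tame.sgn (ev := ev) c).map (fun s => s = 0)
  simpa only [sign_eq_zero_iff] using this

lemma Tame.map_zero (P : 𝓐[X]) : Tame ev (fun x => P.map (ev x) = 0) := by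
  have := (Tame.finset (ev := ev) P.support (fun i => Tame.zero (P.coeff i))).map
    (fun f => ∀ i, f i)
  convert this using 2 with x
  constructor
  · intro h i
    have := congrArg (fun q => coeff q i) h
    simpa using this
  · intro h
    ext i
    rw [coeff_map, coeff_zero]
    by_cases hi : i ∈ P.support
    · exact h ⟨i, hi⟩
    · rw [notMem_support_iff.1 hi, _root_.map_zero]

end TameBasic

lemma pseudo_div {𝓐 : Type*} [CommRing 𝓐] (P : 𝓐[X]) (hP : P ≠ 0) : ∀ (m : ℕ) (Q : 𝓐[X]),
    Q.degree < m → ∃ (k : ℕ) (S R : 𝓐[X]),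
      C (P.leadingCoeff ^ (2 * k)) * Q = P * S + R ∧ R.degree < P.natDegree := by
  intro m
  induction m with
  | zero =>
    intro Q hQ
    exact ⟨0, 0, Q, by simp, hQ.trans_le (by simp)⟩
  | succ m ih =>
    intro Q hQ
    rcases Nat.lt_or_ge m P.natDegree with hlt | hge
    · exact ⟨0, 0, Q, by simp, hQ.trans_le (by exact_mod_cast hlt)⟩
    · set a := P.leadingCoeff with ha
      set T : 𝓐[X] := C (a * Q.coeff m) * X ^ (m - P.natDegree) with hT
      obtain ⟨k, S, R, h1, h2⟩ := ih (C (a ^ 2) * Q - T * P) (by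
        rw [degree_lt_iff_coeff_zero]
        intro i hi
        rw [coeff_sub, coeff_C_mul, hT, mul_assoc, coeff_C_mul, coeff_X_pow_mul']
        rcases hi.eq_or_lt with rfl | hi
        · rw [if_pos (by omega)]
          have : m - (m - P.natDegree) = P.natDegree := by omega
          rw [this, coeff_natDegree, ← ha]
          ring
        · rw [(degree_lt_iff_coeff_zero _ _).1 hQ i (by omega)]
          rw [if_pos (by omega), coeff_eq_zero_of_natDegree_lt (p := P) (by omega)]
          ring)
      refine ⟨k + 1, S + C (a ^ (2 * k)) * T, R, ?_, h2⟩
      have : C (a ^ (2 * (k + 1))) * Q = C (a ^ (2 * k)) * (C (a ^ 2) * Q - T * P) +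
          C (a ^ (2 * k)) * T * P := by
        have : C (a ^ (2 * (k + 1))) = C (a ^ (2 * k)) * C (a ^ 2) := by
          rw [← C_mul]; ring_nf
        rw [this]; ring
      rw [this, h1]
      ring

section TS
variable {X 𝓐 : Type*} [CommRing 𝓐] {ev : X → 𝓐 →+* ℝ}

lemma map_eraseLead_eq {P : 𝓐[X]} {f : 𝓐 →+* ℝ} (h : f P.leadingCoeff = 0) :
    P.map f = P.eraseLead.map f := by
  have h2 := congrArg (Polynomial.map f) (eraseLead_add_C_mul_X_pow P)
  rw [Polynomial.map_add, Polynomial.map_mul, map_C, h, C_0, zero_mul, add_zero] at h2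
  exact h2.symm

lemma cauchy_tame_aux : ∀ (m p r : ℕ), p + r = m → ∀ (P R : 𝓐[X]), P.degree < p → R.degree < r →
    Tame ev (fun x => cauchyInd (R.map (ev x)) (P.map (ev x))) := by
  intro m
  induction m using Nat.strong_induction_on with
  | _ m ih =>
  intro p r hpr P R hP hR
  by_cases hP0 : P = 0
  · simp only [hP0, Polynomial.map_zero, cauchyInd, roots_zero, Multiset.toFinset_zero,
      Finset.sum_empty]
    exact Tame.const 0
  by_cases hR0 : R = 0
  · simp only [hR0, Polynomial.map_zero, cauchyInd, indAt]
    simp only [ne_eq, not_true_eq_false, false_and, if_false, Finset.sum_const_zero]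
    exact Tame.const 0
  have hp : P.natDegree < p := by rwa [degree_eq_natDegree hP0, Nat.cast_lt] at hP
  have hr : R.natDegree < r := by rwa [degree_eq_natDegree hR0, Nat.cast_lt] at hR
  have heP : P.eraseLead.degree < P.natDegree := by
    rw [← degree_eq_natDegree hP0]; exact degree_eraseLead_lt hP0
  have heR : R.eraseLead.degree < R.natDegree := by
    rw [← degree_eq_natDegree hR0]; exact degree_eraseLead_lt hR0
  have hdP : P.degree < (P.natDegree + 1 : ℕ) := by
    rw [degree_eq_natDegree hP0, Nat.cast_lt]; omega
  have hdR : R.degree < (R.natDegree + 1 : ℕ) := by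
    rw [degree_eq_natDegree hR0, Nat.cast_lt]; omega
  refine Tame.cases (Tame.zero P.leadingCoeff)
    (ih (P.natDegree + r) (by omega) _ _ rfl P.eraseLead R heP hR)
    (h2 := fun x => if ev x P.leadingCoeff = 0 then 0 else
      cauchyInd (R.map (ev x)) (P.map (ev x))) ?_ ?_ ?_
  rotate_left
  · intro x hx
    rw [map_eraseLead_eq hx]
  · intro x hx
    rw [if_neg hx]
  refine Tame.cases (Tame.zero P.leadingCoeff) (Tame.const 0) (h2 := fun x =>
    if ev x P.leadingCoeff = 0 then 0 else
      cauchyInd (R.map (ev x)) (P.map (ev x))) ?_ (fun x hx => by rw [if_pos hx]) (fun x hx => rfl)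
  refine Tame.cases (Tame.zero R.leadingCoeff)
    (h1 := fun x => if ev x P.leadingCoeff = 0 then 0 else
      cauchyInd (R.eraseLead.map (ev x)) (P.map (ev x)))
    (h2 := fun x => if ev x P.leadingCoeff = 0 ∨ ev x R.leadingCoeff = 0 then 0 else
      cauchyInd (R.map (ev x)) (P.map (ev x))) ?_ ?_ ?_ ?_
  · exact Tame.cases (Tame.zero P.leadingCoeff) (Tame.const 0)
      (ih (p + R.natDegree) (by omega) _ _ rfl P R.eraseLead hP heR)
      (fun x hx => by rw [if_pos hx]) (fun x hx => by rw [if_neg hx])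
  rotate_left
  · intro x hx
    simp only [map_eraseLead_eq hx]
  · intro x hx
    simp [hx]
  have tt : Tame ev (fun x => ev x P.leadingCoeff = 0 ∨ ev x R.leadingCoeff = 0) :=
    (Tame.zero P.leadingCoeff).map₂ (Tame.zero R.leadingCoeff) Or
  rcases Nat.lt_or_ge R.natDegree P.natDegree with hlt | hge
  · -- reciprocity and division of P by R
    obtain ⟨k, S, P', h1, h2⟩ := pseudo_div R hR0 p P hP
    have t1 := ih (R.natDegree + 1 + P.natDegree) (by omega) _ _ rfl R P' hdR
      (h2.trans (by exact_mod_cast hlt))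
    have t2 := (((Tame.sgn (ev := ev) (R.leadingCoeff * P.leadingCoeff)).map
      (fun s => (s : ℤ) * (1 - (-1) ^ (R.natDegree + P.natDegree)))).map₂ t1
        (fun a b => (a - 2 * b) / 2))
    refine Tame.cases tt (Tame.const 0) t2 (fun x hx => by rw [if_pos hx]) ?_
    intro x hx
    rw [if_neg hx]
    push Not at hx
    have hlP : (P.map (ev x)).leadingCoeff = ev x P.leadingCoeff :=
      leadingCoeff_map_of_leadingCoeff_ne_zero _ hx.1
    have hlR : (R.map (ev x)).leadingCoeff = ev x R.leadingCoeff :=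
      leadingCoeff_map_of_leadingCoeff_ne_zero _ hx.2
    have hnP : (P.map (ev x)).natDegree = P.natDegree :=
      natDegree_map_of_leadingCoeff_ne_zero _ hx.1
    have hnR : (R.map (ev x)).natDegree = R.natDegree :=
      natDegree_map_of_leadingCoeff_ne_zero _ hx.2
    have hPx : P.map (ev x) ≠ 0 := by
      rw [← leadingCoeff_ne_zero, hlP]; exact hx.1
    have hRx : R.map (ev x) ≠ 0 := by
      rw [← leadingCoeff_ne_zero, hlR]; exact hx.2
    have h3 := congrArg (Polynomial.map (ev x)) h1
    simp only [Polynomial.map_mul, Polynomial.map_add, map_C, map_pow] at h3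
    have h4 := cauchy_mod (c := (ev x R.leadingCoeff) ^ (2 * k)) (by
      rw [pow_mul]; exact pow_pos (sq_pos_of_ne_zero hx.2) k) (by simpa using h3)
    have h5 := cauchy_recip hRx hPx
    rw [hlP, hlR, hnP, hnR, h4, ← map_mul] at h5
    rw [← h5]
    omega
  · obtain ⟨k, S, R', h1, h2⟩ := pseudo_div P hP0 r R hR
    have t1 := ih (P.natDegree + 1 + R.natDegree) (by omega) _ _ rfl P R' hdP
      (h2.trans_le (by exact_mod_cast hge))
    refine Tame.cases tt (Tame.const 0) t1 (fun x hx => by rw [if_pos hx]) ?_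
    intro x hx
    rw [if_neg hx]
    push Not at hx
    have h3 := congrArg (Polynomial.map (ev x)) h1
    simp only [Polynomial.map_mul, Polynomial.map_add, map_C, map_pow] at h3
    exact cauchy_mod (c := (ev x P.leadingCoeff) ^ (2 * k)) (by
      rw [pow_mul]; exact pow_pos (sq_pos_of_ne_zero hx.1) k) (by simpa using h3)

lemma cauchy_tame (P R : 𝓐[X]) :
    Tame ev (fun x => cauchyInd (R.map (ev x)) (P.map (ev x))) :=
  cauchy_tame_aux _ (P.natDegree + 1) (R.natDegree + 1) rfl P R
    (by exact_mod_cast degree_lt_iff_coeff_zero P _ |>.2 fun m hm =>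
      coeff_eq_zero_of_natDegree_lt (by omega))
    (by exact_mod_cast degree_lt_iff_coeff_zero R _ |>.2 fun m hm =>
      coeff_eq_zero_of_natDegree_lt (by omega))

lemma query_tame (P Q : 𝓐[X]) :
    Tame ev (fun x => ∑ t ∈ (P.map (ev x)).roots.toFinset,
      (SignType.sign ((Q.map (ev x)).eval t) : ℤ)) := by
  have := cauchy_tame (ev := ev) P (derivative P * Q)
  simpa only [tarski_query, Polynomial.map_mul, derivative_map] using this

lemma exists_root_tame {ι : Type*} [Fintype ι] (P : 𝓐[X]) (Q : ι → 𝓐[X]) :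
    Tame ev (fun x => ∃ t ∈ (P.map (ev x)).roots.toFinset, ∀ j, 0 < ((Q j).map (ev x)).eval t) := by
  classical
  have h1 := Tame.sum (ev := ev) (Finset.univ : Finset ι).powerset (h := fun T x =>
    ∑ t ∈ (P.map (ev x)).roots.toFinset,
      (SignType.sign ((((∏ j ∈ T, Q j) * ∏ j ∈ Finset.univ \ T, Q j ^ 2).map (ev x)).eval t) : ℤ))
    (fun T => query_tame P _)
  refine (h1.map (fun z => z ≠ 0)).map id |> fun h => ?_
  convert h using 2 with x
  simp only [id]
  rw [Finset.sum_comm]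
  have hpt : ∀ t : ℝ, ∑ T ∈ (Finset.univ : Finset ι).powerset,
      (SignType.sign ((((∏ j ∈ T, Q j) * ∏ j ∈ Finset.univ \ T, Q j ^ 2).map (ev x)).eval t) : ℤ)
      = ∏ j, ((SignType.sign (((Q j).map (ev x)).eval t) : ℤ) +
          (SignType.sign (((Q j).map (ev x)).eval t) : ℤ) ^ 2) := by
    intro t
    rw [Finset.prod_add]
    refine Finset.sum_congr rfl fun T _ => ?_
    have hs : ∀ a : ℝ, (SignType.sign a : ℤ) = SignType.castHom (signHom a) := fun a => rfl
    simp only [Polynomial.map_mul, Polynomial.map_prod, Polynomial.map_pow, eval_mul, eval_prod,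
      eval_pow, hs, map_mul, map_prod, map_pow]
  rw [Finset.sum_congr rfl fun t _ => hpt t]
  have hnn : ∀ s : SignType, (0:ℤ) ≤ (s : ℤ) + (s:ℤ) ^ 2 := by decide
  have hpos : ∀ s : SignType, (s : ℤ) + (s:ℤ) ^ 2 ≠ 0 ↔ s = 1 := by decide
  rw [Ne, Finset.sum_eq_zero_iff_of_nonneg
    (fun t _ => Finset.prod_nonneg fun j _ => hnn _)]
  push Not
  refine exists_congr fun t => and_congr Iff.rfl ?_
  rw [Finset.prod_ne_zero_iff]
  simp only [Finset.mem_univ, true_implies, hpos, sign_eq_one_iff]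

end TS

/-- critical point trick -/
lemma crit_point {ι : Type*} [Fintype ι] (Q : ι → ℝ[X]) (k : ℕ) (hk : (∏ j, Q j).natDegree < k)
    {t0 : ℝ} (ht0 : ∀ j, 0 < (Q j).eval t0) :
    ∃ z, (derivative (∏ j, Q j) * (1 + X ^ 2) - (2 * k : ℝ[X]) * X * ∏ j, Q j).eval z = 0 ∧
      ∀ j, 0 < (Q j).eval z := by
  set F := ∏ j, Q j with hF
  have hFev : ∀ t, F.eval t = ∏ j, (Q j).eval t := fun t => by rw [hF, eval_prod]
  have hpos : ∀ t : ℝ, 0 < (1 + t ^ 2) ^ k := fun t => by positivity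
  set f : ℝ → ℝ := fun t => F.eval t / (1 + t ^ 2) ^ k with hf
  have hcont : Continuous f := by
    refine F.continuous.div (by fun_prop) (fun t => (hpos t).ne')
  have hF0 : 0 < F.eval t0 := by rw [hFev]; exact Finset.prod_pos fun j _ => ht0 j
  have hdeg : ∀ G : ℝ[X], G.natDegree ≤ F.natDegree →
      Filter.Tendsto (fun t : ℝ => G.eval t / (1 + t ^ 2) ^ k) Filter.atTop (nhds 0) := by
    intro G hG
    have h1 : ((1 + X ^ 2) ^ k : ℝ[X]).natDegree = 2 * k := by
      rw [natDegree_pow, add_comm, ← C_1, natDegree_X_pow_add_C, mul_comm]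
    have h2 := div_tendsto_atTop_zero_of_degree_lt G ((1 + X ^ 2) ^ k) (by
      rcases eq_or_ne G 0 with rfl | h0
      · rw [degree_zero, bot_lt_iff_ne_bot, Ne, degree_eq_bot]
        intro h; rw [h] at h1; simp at h1; omega
      · apply degree_lt_degree; rw [h1]; omega)
    simpa using h2
  have hlim : Filter.Tendsto f (Filter.cocompact ℝ) (nhds 0) := by
    rw [cocompact_eq_atBot_atTop]
    refine Filter.Tendsto.sup ?_ (hdeg F le_rfl)
    have := (hdeg (F.comp (-X)) (by rw [natDegree_comp]; simp)).comp Filter.tendsto_neg_atBot_atTop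
    refine this.congr fun t => ?_
    simp [hf, eval_comp]
  have hclosed : IsClosed {t : ℝ | ∀ j, 0 ≤ (Q j).eval t} := by
    simp only [Set.setOf_forall]
    exact isClosed_iInter fun j => isClosed_le continuous_const (Q j).continuous
  obtain ⟨z, hz, hmax⟩ := hcont.continuousOn.exists_isMaxOn' hclosed (x₀ := t0)
    (fun j => (ht0 j).le) (by
      refine Filter.Eventually.filter_mono inf_le_left ?_
      have h0 : 0 < f t0 := div_pos hF0 (hpos _)
      exact (hlim.eventually_lt_const h0).mono fun t ht => ht.le)
  have hfz : 0 < f z := lt_of_lt_of_le (div_pos hF0 (hpos _)) (hmax (fun j => (ht0 j).le))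
  have hFz : 0 < F.eval z := by
    have := mul_pos hfz (hpos z)
    rwa [hf, div_mul_cancel₀ _ (hpos z).ne'] at this
  have hQz : ∀ j, 0 < (Q j).eval z := by
    intro j
    refine lt_of_le_of_ne (hz j) fun h => ?_
    rw [hFev, Finset.prod_eq_zero (Finset.mem_univ j) h.symm] at hFz
    exact lt_irrefl _ hFz
  refine ⟨z, ?_, hQz⟩
  have hev : ∀ᶠ t in nhds z, ∀ j, 0 < (Q j).eval t := by
    rw [Filter.eventually_all]
    exact fun j => (Q j).continuous.continuousAt.eventually_const_lt (hQz j)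
  set g : ℝ[X] := F - C (f z) * (1 + X ^ 2) ^ k with hg
  have hlm : IsLocalMax (fun t => g.eval t) z := by
    refine hev.mono fun t ht => ?_
    have h1 : f t ≤ f z := hmax (fun j => (ht j).le)
    have h2 : F.eval t = f t * (1 + t ^ 2) ^ k := by
      rw [hf, div_mul_cancel₀ _ (hpos t).ne']
    have h3 : F.eval z = f z * (1 + z ^ 2) ^ k := by
      rw [hf, div_mul_cancel₀ _ (hpos z).ne']
    simp only [hg, eval_sub, eval_mul, eval_C, eval_pow, eval_add, eval_one, eval_X]
    rw [h2, h3, sub_self, sub_nonpos]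
    exact mul_le_mul_of_nonneg_right h1 (hpos t).le
  have h0 := hlm.hasDerivAt_eq_zero (g.hasDerivAt z)
  have h3 : F.eval z = f z * (1 + z ^ 2) ^ k := by
    rw [hf, div_mul_cancel₀ _ (hpos z).ne']
  obtain ⟨k', rfl⟩ : ∃ k', k = k' + 1 := ⟨k - 1, by omega⟩
  rw [hg] at h0
  simp only [derivative_sub, derivative_mul, derivative_C, zero_mul, zero_add, derivative_pow,
    derivative_add, derivative_one, derivative_X, eval_sub, eval_mul, eval_C,
    eval_pow, eval_add, eval_one, eval_X] at h0
  simp only [eval_sub, eval_mul, eval_add, eval_one, eval_pow, eval_X]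
  rw [h3]
  simp at h0 ⊢
  rw [pow_succ]
  linear_combination (1 + z ^ 2) * h0

lemma crit_ne_zero {F : ℝ[X]} (hF : F ≠ 0) (k : ℕ) (hk : F.natDegree < k) :
    derivative F * (1 + X ^ 2) - (2 * k : ℝ[X]) * X * F ≠ 0 := by
  intro h
  have h1 := congrArg (fun p => coeff p (F.natDegree + 1)) h
  have e1 : derivative F * (1 + X ^ 2) - (2 * k : ℝ[X]) * X * F =
      derivative F + (X * derivative F) * X - C (2 * (k:ℝ)) * (F * X) := by
    rw [C_mul, show (C (2:ℝ) : ℝ[X]) = 2 from rfl, map_natCast]; ring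
  have e2 : (X * derivative F).coeff F.natDegree = F.natDegree * F.leadingCoeff := by
    rcases hd : F.natDegree with _ | d
    · simp
    · rw [coeff_X_mul, coeff_derivative, ← hd, coeff_natDegree, hd]
      push_cast; ring
  simp only [e1] at h1
  rw [coeff_sub, coeff_add, coeff_mul_X, coeff_C_mul, coeff_mul_X, e2, coeff_natDegree,
    coeff_eq_zero_of_natDegree_lt (p := derivative F)
      (by have := natDegree_derivative_le F; omega), coeff_zero] at h1
  have h2 : F.leadingCoeff * ((F.natDegree : ℝ) - 2 * k) = 0 := by linear_combination h1
  rcases mul_eq_zero.1 h2 with h3 | h3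
  · exact hF (leadingCoeff_eq_zero.1 h3)
  · have : (F.natDegree : ℝ) < k := by exact_mod_cast hk
    have : (0:ℝ) ≤ k := by positivity
    linarith

section TS2
variable {Y 𝓐 : Type*} [CommRing 𝓐] {ev : Y → 𝓐 →+* ℝ}

lemma exists_sys_tame {ι : Type*} [Fintype ι] (P : 𝓐[X]) (Q : ι → 𝓐[X]) :
    Tame ev (fun x => ∃ t, (P.map (ev x)).eval t = 0 ∧ ∀ j, 0 < ((Q j).map (ev x)).eval t) := by
  set F := ∏ j, Q j with hF
  set k := F.natDegree + 1 with hk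
  set G : 𝓐[X] := derivative F * (1 + X ^ 2) - (2 * k : 𝓐[X]) * X * F with hG
  have hFm : ∀ x, F.map (ev x) = ∏ j, (Q j).map (ev x) := fun x => by
    rw [hF, Polynomial.map_prod]
  have hGm : ∀ x, G.map (ev x) = derivative (∏ j, (Q j).map (ev x)) * (1 + X ^ 2) -
      (2 * k : ℝ[X]) * X * ∏ j, (Q j).map (ev x) := fun x => by
    rw [hG, ← hFm]; simp
  refine Tame.cases (Tame.map_zero P)
    (h1 := fun x => ∃ t, ∀ j, 0 < ((Q j).map (ev x)).eval t) ?_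
    (exists_root_tame P Q) ?_ ?_
  · refine Tame.cases (Tame.map_zero F) (Tame.const False) (exists_root_tame G Q) ?_ ?_
    · intro x hx
      rw [eq_iff_iff, iff_false]
      rintro ⟨t, ht⟩
      have h1 : 0 < (F.map (ev x)).eval t := by
        rw [hFm, eval_prod]; exact Finset.prod_pos fun j _ => ht j
      rw [hx] at h1; simp at h1
    · intro x hx
      rw [eq_iff_iff]
      have hdeg : (∏ j, (Q j).map (ev x)).natDegree < k := by
        rw [← hFm]; exact Nat.lt_succ_of_le (natDegree_map_le)
      constructor
      · rintro ⟨t, ht⟩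
        obtain ⟨z, hz1, hz2⟩ := crit_point (fun j => (Q j).map (ev x)) k hdeg ht
        refine ⟨z, ?_, hz2⟩
        rw [Multiset.mem_toFinset, mem_roots, IsRoot.def, hGm]
        · exact hz1
        · rw [hGm]; exact crit_ne_zero (by rw [← hFm]; exact hx) k hdeg
      · rintro ⟨t, -, ht⟩
        exact ⟨t, ht⟩
  · intro x hx
    simp [hx]
  · intro x hx
    simp [hx]

/-- Tarski–Seidenberg for one variable, abstract form -/
theorem tarski_seidenberg_core (F : Finset 𝓐[X]) (S : Y → ℝ → Prop)
    (hS : ∀ x t x' t', (∀ p ∈ F, SignType.sign ((p.map (ev x)).eval t) =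
      SignType.sign ((p.map (ev x')).eval t')) → S x t → S x' t') :
    Tame ev (fun x => ∃ t, S x t) := by
  classical
  have h1 : ∀ σ : F → SignType, Tame ev (fun x => ∃ t, ∀ p : F,
      SignType.sign (((p : 𝓐[X]).map (ev x)).eval t) = σ p) := by
    intro σ
    have := exists_sys_tame (ev := ev) (∑ p : F, if σ p = 0 then (p : 𝓐[X]) ^ 2 else 0)
      (fun p : F => if σ p = 0 then 1 else ((σ p : ℤ) : 𝓐[X]) * (p : 𝓐[X]))
    convert this using 4 with x t
    rw [Polynomial.map_sum, eval_finset_sum, Finset.sum_eq_zero_iff_of_nonneg, ← forall_and]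
    · refine forall_congr' fun p => ?_
      rcases h : σ p with _ | _ | _
      · simp
      · simp [show (SignType.neg : SignType) = -1 from rfl, sign_eq_neg_one_iff]
      · simp [show (SignType.pos : SignType) = 1 from rfl, sign_eq_one_iff]
    · intro p _
      split_ifs
      · simp; positivity
      · simp
  have h2 := Tame.fintype h1
  refine (h2.map (fun E => E)).imp fun s hs x y hxy => ?_
  have h3 := hs x y hxy
  have key : ∀ x y, ((fun σ : F → SignType => ∃ t, ∀ p : F,
      SignType.sign (((p : 𝓐[X]).map (ev x)).eval t) = σ p) = fun σ : F → SignType => ∃ t, ∀ p : F,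
      SignType.sign (((p : 𝓐[X]).map (ev y)).eval t) = σ p) → (∃ t, S x t) → ∃ t, S y t := by
    rintro x y h ⟨t, ht⟩
    have h4 := congrFun h (fun p => SignType.sign (((p : 𝓐[X]).map (ev x)).eval t))
    obtain ⟨t', ht'⟩ := h4.mp ⟨t, fun p => rfl⟩
    exact ⟨t', hS x t y t' (fun p hp => (ht' ⟨p, hp⟩).symm) ht⟩
  exact propext ⟨key x y h3, key y x h3.symm⟩

end TS2

end

section

/-- polynomial functions on a vector space -/
def PolyFun (E : Type*) [AddCommGroup E] [Module ℝ E] : Subalgebra ℝ (E → ℝ) :=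
  Algebra.adjoin ℝ (Set.range (fun φ : E →ₗ[ℝ] ℝ => (φ : E → ℝ)))

/-- evaluation of polynomial functions -/
noncomputable def evP {E : Type*} [AddCommGroup E] [Module ℝ E] (x : E) : PolyFun E →+* ℝ :=
  (Pi.evalRingHom (fun _ : E => ℝ) x).comp (PolyFun E).toSubring.subtype

/-- polynomial maps between vector spaces -/
@[fun_prop]
def PolyMap {E F : Type*} [AddCommGroup E] [Module ℝ E] [AddCommGroup F] [Module ℝ F]
    (g : E → F) : Prop := ∀ φ : F →ₗ[ℝ] ℝ, (fun x => φ (g x)) ∈ PolyFun E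

/-- semialgebraic predicates -/
def SA {E : Type*} [AddCommGroup E] [Module ℝ E] (P : E → Prop) : Prop :=
  Tame (evP (E := E)) P

section Poly
variable {E F G H : Type*} [AddCommGroup E] [Module ℝ E] [AddCommGroup F] [Module ℝ F]
  [AddCommGroup G] [Module ℝ G] [AddCommGroup H] [Module ℝ H]

lemma evP_apply (x : E) (f : PolyFun E) : evP x f = f.1 x := rfl

lemma linear_mem_polyFun (φ : E →ₗ[ℝ] ℝ) : (φ : E → ℝ) ∈ PolyFun E :=
  Algebra.subset_adjoin ⟨φ, rfl⟩

lemma polyMap_real {f : E → ℝ} : PolyMap f ↔ f ∈ PolyFun E := by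
  constructor
  · intro h; exact h LinearMap.id
  · intro h φ
    have : (fun x => φ (f x)) = φ 1 • f := by
      funext x
      have : f x = f x • (1:ℝ) := by simp
      conv_lhs => rw [this, map_smul]
      simp [mul_comm]
    rw [this]
    exact Subalgebra.smul_mem _ h _

lemma polyFun_comp {f : F → ℝ} (hf : f ∈ PolyFun F) {g : E → F} (hg : PolyMap g) :
    (fun x => f (g x)) ∈ PolyFun E := by
  induction hf using Algebra.adjoin_induction with
  | mem f hf => obtain ⟨φ, rfl⟩ := hf; exact hg φ
  | algebraMap r => exact (PolyFun E).algebraMap_mem r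
  | add a b _ _ ha hb => exact (PolyFun E).add_mem ha hb
  | mul a b _ _ ha hb => exact (PolyFun E).mul_mem ha hb

@[fun_prop]
lemma PolyMap.comp {f : F → G} (hf : PolyMap f) {g : E → F} (hg : PolyMap g) :
    PolyMap (fun x => f (g x)) := fun φ => polyFun_comp (hf φ) hg

@[fun_prop]
lemma polyMap_id : PolyMap (fun x : E => x) := fun φ => linear_mem_polyFun φ

@[fun_prop]
lemma polyMap_const (c : F) : PolyMap (fun _ : E => c) := fun φ => (PolyFun E).algebraMap_mem (φ c)

lemma LinearMap.polyMap (f : E →ₗ[ℝ] F) : PolyMap (fun x => f x) := fun φ =>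
  linear_mem_polyFun (φ.comp f)

@[fun_prop]
lemma PolyMap.linear (f : F →ₗ[ℝ] G) {g : E → F} (hg : PolyMap g) : PolyMap (fun x => f (g x)) :=
  (LinearMap.polyMap f).comp hg

@[fun_prop]
lemma PolyMap.add {f g : E → F} (hf : PolyMap f) (hg : PolyMap g) : PolyMap (fun x => f x + g x) :=
  fun φ => by simp only [map_add]; exact (PolyFun E).add_mem (hf φ) (hg φ)

@[fun_prop]
lemma PolyMap.neg {f : E → F} (hf : PolyMap f) : PolyMap (fun x => - f x) :=
  fun φ => by simp only [map_neg]; exact (PolyFun E).neg_mem (hf φ)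

@[fun_prop]
lemma PolyMap.sub {f g : E → F} (hf : PolyMap f) (hg : PolyMap g) : PolyMap (fun x => f x - g x) :=
  fun φ => by simp only [map_sub]; exact (PolyFun E).sub_mem (hf φ) (hg φ)

@[fun_prop]
lemma PolyMap.const_smul (c : ℝ) {f : E → F} (hf : PolyMap f) : PolyMap (fun x => c • f x) :=
  fun φ => by simp only [map_smul]; exact (PolyFun E).smul_mem (hf φ) c

@[fun_prop]
lemma PolyMap.smul {c : E → ℝ} {f : E → F} (hc : PolyMap c) (hf : PolyMap f) :
    PolyMap (fun x => c x • f x) :=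
  fun φ => by simp only [map_smul]; exact (PolyFun E).mul_mem (polyMap_real.1 hc) (hf φ)

@[fun_prop]
lemma PolyMap.sum {ι : Type*} (s : Finset ι) {f : ι → E → F} (hf : ∀ i, PolyMap (f i)) :
    PolyMap (fun x => ∑ i ∈ s, f i x) := fun φ => by
  simp only [map_sum]
  have := (PolyFun E).sum_mem (t := s) (f := fun i x => φ (f i x)) (fun i _ => hf i φ)
  convert this using 1
  funext x; simp

lemma PolyMap.bilin [FiniteDimensional ℝ F] (B : F →ₗ[ℝ] G →ₗ[ℝ] H)
    {f : E → F} {g : E → G} (hf : PolyMap f) (hg : PolyMap g) : PolyMap (fun x => B (f x) (g x)) := by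
  have : (fun x => B (f x) (g x)) = fun x => ∑ i,
      ((Module.finBasis ℝ F).coord i) (f x) • (B (Module.finBasis ℝ F i)) (g x) := by
    funext x
    conv_lhs => rw [← (Module.finBasis ℝ F).sum_repr (f x), map_sum, LinearMap.sum_apply]
    refine Finset.sum_congr rfl fun i _ => ?_
    rw [map_smul, LinearMap.smul_apply]
    rfl
  rw [this]
  refine PolyMap.sum _ fun i => PolyMap.smul ?_ ?_
  · exact PolyMap.linear _ hf
  · exact PolyMap.linear _ hg

@[fun_prop]
lemma PolyMap.mul {R : Type*} [Ring R] [Algebra ℝ R] [FiniteDimensional ℝ R] {f g : E → R}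
    (hf : PolyMap f) (hg : PolyMap g) : PolyMap (fun x => f x * g x) :=
  PolyMap.bilin (LinearMap.mul ℝ R) hf hg

@[fun_prop]
lemma PolyMap.pow {R : Type*} [Ring R] [Algebra ℝ R] [FiniteDimensional ℝ R] {f : E → R}
    (hf : PolyMap f) (k : ℕ) : PolyMap (fun x => f x ^ k) := by
  induction k with
  | zero => simp only [pow_zero]; fun_prop
  | succ k ih => simp only [pow_succ]; fun_prop

@[fun_prop]
lemma PolyMap.fst {f : E → F × G} (hf : PolyMap f) : PolyMap (fun x => (f x).1) :=
  PolyMap.linear (LinearMap.fst ℝ F G) hf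

@[fun_prop]
lemma PolyMap.snd {f : E → F × G} (hf : PolyMap f) : PolyMap (fun x => (f x).2) :=
  PolyMap.linear (LinearMap.snd ℝ F G) hf

@[fun_prop]
lemma PolyMap.prodMk {f : E → F} {g : E → G} (hf : PolyMap f) (hg : PolyMap g) :
    PolyMap (fun x => (f x, g x)) := fun φ => by
  have : (fun x => φ (f x, g x)) = fun x => (φ.comp (LinearMap.inl ℝ F G)) (f x) +
      (φ.comp (LinearMap.inr ℝ F G)) (g x) := by
    funext x
    simp [← map_add]
  rw [this]
  exact (PolyFun E).add_mem (hf _) (hg _)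

@[fun_prop]
lemma PolyMap.apply {ι : Type*} {F : ι → Type*} [∀ i, AddCommGroup (F i)] [∀ i, Module ℝ (F i)]
    (i : ι) : PolyMap (fun x : (∀ i, F i) => x i) :=
  LinearMap.polyMap (LinearMap.proj (R := ℝ) (φ := F) i)

@[fun_prop]
lemma PolyMap.pi {ι : Type*} [Finite ι] {F : ι → Type*} [∀ i, AddCommGroup (F i)]
    [∀ i, Module ℝ (F i)]
    {f : E → ∀ i, F i} (hf : ∀ i, PolyMap (fun x => f x i)) : PolyMap f := by
  classical
  haveI := Fintype.ofFinite ι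
  have : f = fun x => ∑ i, LinearMap.single ℝ F i (f x i) := by
    funext x
    exact (Finset.univ_sum_single (f x)).symm
  rw [this]
  exact PolyMap.sum _ fun i => PolyMap.linear _ (hf i)

end Poly

section SAbasic
variable {E F Y : Type*} [AddCommGroup E] [Module ℝ E] [AddCommGroup F] [Module ℝ F]
  [AddCommGroup Y] [Module ℝ Y]

lemma SA.and {P Q : E → Prop} (hP : SA P) (hQ : SA Q) : SA (fun x => P x ∧ Q x) :=
  Tame.map₂ hP hQ And
lemma SA.or {P Q : E → Prop} (hP : SA P) (hQ : SA Q) : SA (fun x => P x ∨ Q x) :=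
  Tame.map₂ hP hQ Or
lemma SA.imp {P Q : E → Prop} (hP : SA P) (hQ : SA Q) : SA (fun x => P x → Q x) :=
  Tame.map₂ hP hQ (fun a b => a → b)
lemma SA.not {P : E → Prop} (hP : SA P) : SA (fun x => ¬ P x) := Tame.map hP Not

lemma SA.all_fin {ι : Type*} [Finite ι] {P : ι → E → Prop} (hP : ∀ i, SA (P i)) :
    SA (fun x => ∀ i, P i x) :=
  (Tame.fintype hP).map (fun f => ∀ i, f i)

lemma SA.comp {P : F → Prop} (hP : SA P) {g : E → F} (hg : PolyMap g) : SA (fun x => P (g x)) := by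
  classical
  obtain ⟨s, hs⟩ := hP
  refine ⟨s.image (fun f => (⟨fun x => f.1 (g x), polyFun_comp (f := f.1) (g := g) f.2 hg⟩ : PolyFun E)), fun x y h => ?_⟩
  refine hs (g x) (g y) fun c hc => ?_
  exact h _ (Finset.mem_image_of_mem _ hc)

lemma SA.eq_zero {f : E → ℝ} (hf : PolyMap f) : SA (fun x => f x = 0) :=
  Tame.zero (ev := evP) (⟨f, polyMap_real.1 hf⟩ : PolyFun E)

lemma SA.eq_real {f g : E → ℝ} (hf : PolyMap f) (hg : PolyMap g) : SA (fun x => f x = g x) := by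
  simpa only [sub_eq_zero] using SA.eq_zero (hf.sub hg)

lemma SA.pos {f : E → ℝ} (hf : PolyMap f) : SA (fun x => 0 < f x) := by
  have := (Tame.sgn (ev := evP) (⟨f, polyMap_real.1 hf⟩ : PolyFun E)).map (fun s => s = 1)
  simp only [sign_eq_one_iff] at this
  exact this

lemma SA.lt {f g : E → ℝ} (hf : PolyMap f) (hg : PolyMap g) : SA (fun x => f x < g x) := by
  simpa only [sub_pos] using SA.pos (hg.sub hf)

lemma SA.le {f g : E → ℝ} (hf : PolyMap f) (hg : PolyMap g) : SA (fun x => f x ≤ g x) := by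
  simpa only [not_lt] using (SA.lt hg hf).not

lemma SA.eq [FiniteDimensional ℝ F] {f g : E → F} (hf : PolyMap f) (hg : PolyMap g) :
    SA (fun x => f x = g x) := by
  have := SA.all_fin (fun i => SA.eq_real
    (PolyMap.linear ((Module.finBasis ℝ F).coord i) hf)
    (PolyMap.linear ((Module.finBasis ℝ F).coord i) hg))
  convert this using 2 with x
  rw [Module.Basis.ext_elem_iff (Module.finBasis ℝ F)]
  rfl

open Polynomial in
lemma polyFun_prod_real {f : E × ℝ → ℝ} (hf : f ∈ PolyFun (E × ℝ)) :
    ∃ p : (PolyFun E)[X], ∀ x t, f (x, t) = (p.map (evP x)).eval t := by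
  induction hf using Algebra.adjoin_induction with
  | mem f hf =>
    obtain ⟨φ, rfl⟩ := hf
    refine ⟨C ⟨_, linear_mem_polyFun (φ.comp (LinearMap.inl ℝ E ℝ))⟩ +
      C (algebraMap ℝ (PolyFun E) (φ (0, 1))) * X, fun x t => ?_⟩
    have : (x, t) = (x, (0:ℝ)) + t • ((0:E), (1:ℝ)) := by simp
    simp only [Polynomial.map_add, Polynomial.map_mul, map_C, map_X, eval_add, eval_C, eval_mul,
      eval_X, evP_apply]
    rw [this, map_add, map_smul]
    simp [mul_comm]
  | algebraMap r =>
    refine ⟨C (algebraMap ℝ (PolyFun E) r), fun x t => ?_⟩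
    simp only [map_C, eval_C, evP_apply]
    rfl
  | add a b _ _ ha hb =>
    obtain ⟨p, hp⟩ := ha
    obtain ⟨q, hq⟩ := hb
    exact ⟨p + q, fun x t => by simp [hp, hq]⟩
  | mul a b _ _ ha hb =>
    obtain ⟨p, hp⟩ := ha
    obtain ⟨q, hq⟩ := hb
    exact ⟨p * q, fun x t => by simp [hp, hq]⟩

lemma SA.exists_real {P : E → ℝ → Prop} (hP : SA (fun z : E × ℝ => P z.1 z.2)) :
    SA (fun x => ∃ t, P x t) := by
  classical
  obtain ⟨s, hs⟩ := hP
  choose p hp using fun f : PolyFun (E × ℝ) => polyFun_prod_real f.2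
  refine tarski_seidenberg_core (ev := evP) (s.image p) P ?_
  intro x t x' t' h hPx
  refine (hs (x, t) (x', t') fun c hc => ?_).mp hPx
  rw [evP_apply, evP_apply, hp, hp]
  exact h _ (Finset.mem_image_of_mem _ hc)

lemma SA.exists_pi (k : ℕ) : ∀ {P : E → (Fin k → ℝ) → Prop},
    SA (fun z : E × (Fin k → ℝ) => P z.1 z.2) → SA (fun x => ∃ y, P x y) := by
  induction k with
  | zero =>
    intro P hP
    have := hP.comp (g := fun x : E => (x, (0 : Fin 0 → ℝ))) (by fun_prop)
    convert this using 2 with x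
    exact ⟨fun ⟨y, hy⟩ => by rwa [Subsingleton.elim y 0] at hy, fun h => ⟨_, h⟩⟩
  | succ k ih =>
    intro P hP
    have h1 := hP.comp (g := fun z : (E × (Fin k → ℝ)) × ℝ =>
      (z.1.1, (Fin.cons z.2 z.1.2 : Fin (k+1) → ℝ))) (by
        refine PolyMap.prodMk (by fun_prop) (PolyMap.pi fun i => ?_)
        refine Fin.cases ?_ (fun j => ?_) i
        · simp only [Fin.cons_zero]; fun_prop
        · simp only [Fin.cons_succ]; fun_prop)
    have h2 := ih (P := fun x y => ∃ t : ℝ, P x (Fin.cons t y : Fin (k+1) → ℝ)) (SA.exists_real (P := fun (z : E × (Fin k → ℝ)) (t : ℝ) =>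
      P z.1 (Fin.cons t z.2 : Fin (k+1) → ℝ)) h1)
    convert h2 using 2 with x
    constructor
    · rintro ⟨y, hy⟩
      exact ⟨Fin.tail y, y 0, by rwa [Fin.cons_self_tail]⟩
    · rintro ⟨y, t, h⟩
      exact ⟨_, h⟩

lemma SA.ex [FiniteDimensional ℝ Y] {P : E → Y → Prop} (hP : SA (fun z : E × Y => P z.1 z.2)) :
    SA (fun x => ∃ y, P x y) := by
  let e := (Module.finBasis ℝ Y).equivFun
  have h1 := SA.exists_pi _ (P := fun x y => P x (e.symm y))
    (hP.comp (g := fun z : E × (Fin _ → ℝ) => (z.1, e.symm.toLinearMap z.2)) (by fun_prop))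
  convert h1 using 2 with x
  exact ⟨fun ⟨y, hy⟩ => ⟨e y, by simpa using hy⟩, fun ⟨y, hy⟩ => ⟨_, hy⟩⟩

lemma SA.all [FiniteDimensional ℝ Y] {P : E → Y → Prop} (hP : SA (fun z : E × Y => P z.1 z.2)) :
    SA (fun x => ∀ y, P x y) := by
  have := (SA.ex (P := fun x y => ¬ P x y) hP.not).not
  simpa only [not_exists, not_not] using this

end SAbasic

lemma polyFun_mvPolynomial {ι : Type*} [Fintype ι] {f : (ι → ℝ) → ℝ} (hf : f ∈ PolyFun (ι → ℝ)) :
    ∃ p : MvPolynomial ι ℝ, ∀ x, f x = MvPolynomial.eval x p := by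
  classical
  induction hf using Algebra.adjoin_induction with
  | mem f hf =>
    obtain ⟨φ, rfl⟩ := hf
    refine ⟨∑ i, MvPolynomial.C (φ (Pi.single i 1)) * MvPolynomial.X i, fun x => ?_⟩
    simp only [map_sum, map_mul, MvPolynomial.eval_C, MvPolynomial.eval_X]
    rw [LinearMap.pi_apply_eq_sum_univ φ x]
    refine Finset.sum_congr rfl fun i _ => ?_
    rw [smul_eq_mul, mul_comm]
    congr 2
    funext j
    simp [Pi.single_apply, eq_comm]
  | algebraMap r => exact ⟨MvPolynomial.C r, fun x => by simp⟩
  | add a b _ _ ha hb =>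
    obtain ⟨p, hp⟩ := ha
    obtain ⟨q, hq⟩ := hb
    exact ⟨p + q, fun x => by simp [hp, hq]⟩
  | mul a b _ _ ha hb =>
    obtain ⟨p, hp⟩ := ha
    obtain ⟨q, hq⟩ := hb
    exact ⟨p * q, fun x => by simp [hp, hq]⟩

lemma mvPolynomial_polyMap {ι : Type*} (p : MvPolynomial ι ℝ) :
    PolyMap (fun x : ι → ℝ => MvPolynomial.eval x p) := by
  induction p using MvPolynomial.induction_on with
  | C a => simp only [MvPolynomial.eval_C]; fun_prop
  | add p q hp hq => simp only [map_add]; fun_prop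
  | mul_X p i hp => simp only [map_mul, MvPolynomial.eval_X]; fun_prop

end

section

lemma SA.isSemialgebraicSet {N : ℕ} {P : (Fin N → ℝ) → Prop} (hP : SA P) :
    IsSemialgebraicSet {x | P x} := by
  classical
  obtain ⟨s, hs⟩ := hP
  choose p hp using fun f : PolyFun (Fin N → ℝ) => polyFun_mvPolynomial f.2
  let I := {σ : s → SignType // ∃ x, P x ∧ ∀ c : s, SignType.sign (c.1.1 x) = σ c}
  obtain ⟨m, ⟨e⟩⟩ := Finite.exists_equiv_fin I
  let es := s.equivFin
  refine ⟨m, fun i => {x | ∀ c : s, SignType.sign (c.1.1 x) = (e.symm i).1 c}, ?_, ?_⟩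
  · intro i
    set σ := (e.symm i).1
    refine ⟨s.card, s.card, fun j => if σ (es.symm j) = 0 then p (es.symm j) else 0,
      fun j => if σ (es.symm j) = 0 then 1 else MvPolynomial.C ((σ (es.symm j) : ℤ) : ℝ) *
        p (es.symm j), ?_⟩
    ext x
    simp only [Set.mem_ofPred_eq, ← forall_and]
    rw [← es.symm.forall_congr_right]
    refine forall_congr' fun j => ?_
    rw [hp]
    change _ = σ (es.symm j) ↔ _
    rcases h : σ (es.symm j) with _ | _ | _
    · simp
    · simp [sign_eq_neg_one_iff]
    · simp [sign_eq_one_iff]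
  · ext x
    simp only [Set.mem_ofPred_eq, Set.mem_iUnion]
    constructor
    · intro hx
      refine ⟨e ⟨fun c => SignType.sign (c.1.1 x), x, hx, fun c => rfl⟩, fun c => ?_⟩
      simp
    · rintro ⟨i, hi⟩
      obtain ⟨y, hy, hy2⟩ := (e.symm i).2
      refine (hs y x fun c hc => ?_).mp hy
      exact (hy2 ⟨c, hc⟩).trans (hi ⟨c, hc⟩).symm

/-- transport of a semialgebraic subset of a vector space to `ℝ^N` -/
lemma SA.exists_homeo {Z : Type*} [AddCommGroup Z] [Module ℝ Z] [FiniteDimensional ℝ Z]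
    [TopologicalSpace Z] [IsTopologicalAddGroup Z] [ContinuousSMul ℝ Z] [T2Space Z]
    {P : Z → Prop} (hP : SA P) : ∃ (N : ℕ) (S : Set (Fin N → ℝ)), IsSemialgebraicSet S ∧
      Nonempty ({x | P x} ≃ₜ S) := by
  let e := (Module.finBasis ℝ Z).equivFun.toContinuousLinearEquiv
  refine ⟨_, {y | P (e.symm y)}, SA.isSemialgebraicSet
    (hP.comp (LinearMap.polyMap e.symm.toLinearEquiv.toLinearMap)), ⟨?_⟩⟩
  refine e.toHomeomorph.subtype fun x => ?_
  show P x ↔ P (e.symm (e x))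
  simp

end

section

section nexp
variable {R S : Type*} [Ring R] [Algebra ℝ R] [Ring S] [Algebra ℝ S]

/-- exponential of a nilpotent element of a real algebra -/
noncomputable def nexp (f : R) : R :=
  letI := Module.compHom R (algebraMap ℚ ℝ)
  IsNilpotent.exp f

lemma nexp_eq_sum {f : R} {k : ℕ} (h : f ^ k = 0) :
    nexp f = ∑ i ∈ Finset.range k, ((i.factorial : ℝ)⁻¹) • f ^ i := by
  letI := Module.compHom R (algebraMap ℚ ℝ)
  have := IsNilpotent.exp_eq_sum h
  unfold nexp
  rw [this]
  refine Finset.sum_congr rfl fun i _ => ?_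
  show (algebraMap ℚ ℝ (i.factorial : ℚ)⁻¹) • f ^ i = _
  simp

lemma nexp_add {a b : R} (h₁ : Commute a b) (h₂ : IsNilpotent a) (h₃ : IsNilpotent b) :
    nexp (a + b) = nexp a * nexp b := by
  letI := Module.compHom R (algebraMap ℚ ℝ)
  exact IsNilpotent.exp_add_of_commute h₁ h₂ h₃

lemma nexp_zero : nexp (0 : R) = 1 := by
  letI := Module.compHom R (algebraMap ℚ ℝ)
  exact IsNilpotent.exp_zero

lemma nexp_mul_neg {a : R} (h : IsNilpotent a) : nexp a * nexp (-a) = 1 := by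
  letI := Module.compHom R (algebraMap ℚ ℝ)
  exact IsNilpotent.exp_mul_exp_neg_self h

lemma map_nexp {a : R} (ha : IsNilpotent a) (f : R →ₐ[ℝ] S) : f (nexp a) = nexp (f a) := by
  obtain ⟨k, hk⟩ := ha
  have hk' : (f a) ^ k = 0 := by simp [← map_pow, hk]
  simp [nexp_eq_sum hk, nexp_eq_sum hk']

/-- the exponential of a nilpotent is one plus a multiple of it by a commuting unit -/
lemma nexp_sub_one {f : R} (h : IsNilpotent f) :
    ∃ u : R, nexp f = 1 + f * (1 + f * u) ∧ Commute f u := by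
  obtain ⟨k, hk⟩ := h
  have hk2 : f ^ (k + 2) = 0 := by rw [pow_add, hk, zero_mul]
  refine ⟨∑ i ∈ Finset.range k, (((i + 2).factorial : ℝ)⁻¹) • f ^ i, ?_, ?_⟩
  · rw [nexp_eq_sum hk2, Finset.sum_range_succ', Finset.sum_range_succ']
    simp only [Finset.mul_sum, mul_add, mul_one, mul_smul_comm, ← pow_succ']
    simp [add_comm, add_left_comm]
  · exact Commute.sum_right _ _ _ fun i _ => ((Commute.refl f).pow_right i).smul_right _

open Polynomial

lemma exists_logP (c : ℕ) : ∀ j : ℕ, ∃ (l r : ℝ[X]), X ∣ l ∧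
    nexp ((Ideal.Quotient.mkₐ ℝ (Ideal.span {(X : ℝ[X]) ^ c})) l) =
    (Ideal.Quotient.mkₐ ℝ (Ideal.span {(X : ℝ[X]) ^ c})) (1 + X + X ^ (j + 1) * r) := by
  set π := Ideal.Quotient.mkₐ ℝ (Ideal.span {(X : ℝ[X]) ^ c})
  have hX : π X ^ c = 0 := by
    rw [← map_pow]
    exact Ideal.Quotient.eq_zero_iff_mem.2 (Ideal.mem_span_singleton_self _)
  have hnil : ∀ p : ℝ[X], X ∣ p → IsNilpotent (π p) := by
    rintro _ ⟨q, rfl⟩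
    exact ⟨c, by rw [map_mul, mul_pow, hX, zero_mul]⟩
  intro j
  induction j with
  | zero => exact ⟨0, -1, dvd_zero _, by rw [map_zero, nexp_zero]; simp⟩
  | succ j ih =>
    obtain ⟨l, r, hl, he⟩ := ih
    obtain ⟨r', hr'⟩ : X ∣ r - C (r.coeff 0) := by
      rw [X_dvd_iff]; simp
    set m : ℝ[X] := - (X ^ (j + 1) * C (r.coeff 0)) with hm
    have hmX : X ∣ m := by
      rw [hm, pow_succ']; exact ⟨-(X ^ j * C (r.coeff 0)), by ring⟩
    obtain ⟨u, hu, -⟩ := nexp_sub_one (hnil m hmX)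
    obtain ⟨u, rfl⟩ := Ideal.Quotient.mkₐ_surjective ℝ _ u
    refine ⟨l + m, r' + (-C (r.coeff 0)) * (1 + X ^ j * r) +
      X ^ j * C (r.coeff 0) ^ 2 * u * (1 + X + X ^ (j + 1) * r),
      dvd_add hl hmX, ?_⟩
    rw [map_add, nexp_add (Commute.all _ _) (hnil l hl) (hnil m hmX), he, hu]
    change π _ * (1 + π m * (1 + π m * π u)) = _
    rw [← map_one π, ← map_mul, ← map_add, ← map_mul, ← map_add, ← map_mul]
    congr 1
    have : r = X * r' + C (r.coeff 0) := by rw [← hr']; ring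
    generalize r.coeff 0 = a at *
    rw [hm, this]
    ring

/-- truncated logarithm -/
noncomputable def logP (c : ℕ) : ℝ[X] := (exists_logP c c).choose

lemma X_dvd_logP (c : ℕ) : X ∣ logP c := (exists_logP c c).choose_spec.choose_spec.1

lemma nexp_logP {c : ℕ} {f : R} (hf : f ^ c = 0) : nexp (aeval f (logP c)) = 1 + f := by
  obtain ⟨r, -, h⟩ := (exists_logP c c).choose_spec
  set π := Ideal.Quotient.mkₐ ℝ (Ideal.span {(X : ℝ[X]) ^ c})
  have hker : ∀ a ∈ Ideal.span {(X : ℝ[X]) ^ c}, aeval f a = 0 := by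
    intro a ha
    obtain ⟨q, rfl⟩ := Ideal.mem_span_singleton.1 ha
    simp [hf]
  let g := Ideal.Quotient.liftₐ (Ideal.span {(X : ℝ[X]) ^ c}) (aeval f) hker
  have hg : ∀ p, g (π p) = aeval f p := fun p => rfl
  have hX : π X ^ c = 0 := by
    rw [← map_pow]
    exact Ideal.Quotient.eq_zero_iff_mem.2 (Ideal.mem_span_singleton_self _)
  have h2 := congrArg g h
  rw [map_nexp] at h2
  · change nexp (aeval f (logP c)) = aeval f _ at h2
    rw [h2]
    simp [pow_succ, hf]
  · obtain ⟨q, hq⟩ := X_dvd_logP c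
    change IsNilpotent (π (logP c))
    exact ⟨c, by rw [hq, map_mul, mul_pow, hX, zero_mul]⟩

lemma logP_nil {c : ℕ} {f : R} (hf : f ^ c = 0) : (aeval f (logP c)) ^ c = 0 := by
  obtain ⟨q, hq⟩ := X_dvd_logP c
  have hc : Commute f (aeval f q) := by
    have := Commute.map (Commute.all X q) (aeval f)
    simpa using this
  rw [hq, map_mul, aeval_X, hc.mul_pow, hf, zero_mul]

end nexp

end

section
open Polynomial

lemma nilp_pow_finrank {M : Type*} [AddCommGroup M] [Module ℝ M] [FiniteDimensional ℝ M]
    {f : Module.End ℝ M} (hf : IsNilpotent f) : f ^ Module.finrank ℝ M = 0 := by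
  have h := LinearMap.aeval_self_charpoly f
  rw [hf.charpoly_eq_X_pow_finrank] at h
  simpa using h

lemma nilp_pow_card {K : Type*} [Fintype K] [DecidableEq K] {f : Matrix K K ℝ}
    (hf : IsNilpotent f) : f ^ Fintype.card K = 0 := by
  have h := nilp_pow_finrank (hf.map (Matrix.toLinAlgEquiv' (R := ℝ) (n := K)))
  rw [Module.finrank_fintype_fun_eq_card, ← map_pow] at h
  exact (map_eq_zero_iff _ (Matrix.toLinAlgEquiv' (R := ℝ) (n := K)).injective).1 h

lemma zn_hom_ext {n : ℕ} {M : Type*} [Monoid M] {f g : Multiplicative (Fin n → ℤ) →* M}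
    (h : ∀ i, f (Multiplicative.ofAdd (Pi.single i 1)) = g (Multiplicative.ofAdd (Pi.single i 1))) :
    f = g := by
  ext m
  have hm : m = ∏ i, (Multiplicative.ofAdd (Pi.single i (1:ℤ) : Fin n → ℤ)) ^
      (Multiplicative.toAdd m i) := by
    apply Multiplicative.toAdd.injective
    rw [toAdd_prod]
    simp only [toAdd_zpow, toAdd_ofAdd]
    funext j
    simp [Finset.sum_apply, Pi.single_apply]
  have : m ∈ f.eqLocus g := by
    rw [hm]
    exact Subgroup.prod_mem _ fun i _ => Subgroup.zpow_mem _ (h i) _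
  exact this

section comb
variable {n : ℕ} {R : Type*} [Ring R] [Algebra ℝ R] {N : Fin n → R}

/-- linear combination of a family -/
def comb (N : Fin n → R) (t : Fin n → ℝ) : R := ∑ i, t i • N i

lemma comb_add (s t : Fin n → ℝ) : comb N (s + t) = comb N s + comb N t := by
  simp [comb, add_smul, Finset.sum_add_distrib]

lemma comb_smul (c : ℝ) (t : Fin n → ℝ) : comb N (c • t) = c • comb N t := by
  simp [comb, mul_smul, Finset.smul_sum]

lemma comb_zero : comb N 0 = 0 := by simp [comb]

lemma comb_single (i : Fin n) : comb N (Pi.single i 1) = N i := by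
  simp [comb, Pi.single_apply]

lemma comb_comm_left {a : R} (h : ∀ i, Commute a (N i)) (t : Fin n → ℝ) : Commute a (comb N t) :=
  Commute.sum_right _ _ _ fun i _ => (h i).smul_right _

lemma comb_comm (h : ∀ i j, Commute (N i) (N j)) (s t : Fin n → ℝ) :
    Commute (comb N s) (comb N t) :=
  comb_comm_left (fun i => (comb_comm_left (fun j => h i j) s).symm) t

lemma comb_nil (h : ∀ i j, Commute (N i) (N j)) (hn : ∀ i, IsNilpotent (N i)) (t : Fin n → ℝ) :
    IsNilpotent (comb N t) :=
  Commute.isNilpotent_sum (fun i _ => (hn i).smul _)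
    (fun i j _ _ => ((h i j).smul_left _).smul_right _)

lemma nexp_comb_add (h : ∀ i j, Commute (N i) (N j)) (hn : ∀ i, IsNilpotent (N i))
    (s t : Fin n → ℝ) : nexp (comb N (s + t)) = nexp (comb N s) * nexp (comb N t) := by
  rw [comb_add, nexp_add (comb_comm h s t) (comb_nil h hn s) (comb_nil h hn t)]

/-- the exponential representation of `ℤ^n` -/
noncomputable def expHom (N : Fin n → R) (h : ∀ i j, Commute (N i) (N j))
    (hn : ∀ i, IsNilpotent (N i)) : Multiplicative (Fin n → ℤ) →* R where
  toFun m := nexp (comb N (fun i => ((Multiplicative.toAdd m i : ℤ) : ℝ)))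
  map_one' := by
    have : (fun i : Fin n => ((Multiplicative.toAdd (1 : Multiplicative (Fin n → ℤ)) i : ℤ) : ℝ))
      = 0 := by funext i; simp
    rw [this, comb_zero, nexp_zero]
  map_mul' a b := by
    rw [← nexp_comb_add h hn]
    congr 2
    funext i
    simp

lemma expHom_apply (h : ∀ i j, Commute (N i) (N j)) (hn : ∀ i, IsNilpotent (N i))
    (m : Multiplicative (Fin n → ℤ)) : expHom N h hn m =
      nexp (comb N (fun i => ((Multiplicative.toAdd m i : ℤ) : ℝ))) := rfl

lemma hom_eq_nexp (h : ∀ i j, Commute (N i) (N j)) (hn : ∀ i, IsNilpotent (N i))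
    (φ : Multiplicative (Fin n → ℤ) →* R)
    (hφ : ∀ i, φ (Multiplicative.ofAdd (Pi.single i 1)) = nexp (N i))
    (m : Multiplicative (Fin n → ℤ)) :
    φ m = nexp (comb N (fun i => ((Multiplicative.toAdd m i : ℤ) : ℝ))) := by
  have : φ = expHom N h hn := by
    apply zn_hom_ext
    intro i
    rw [hφ, expHom_apply]
    congr 1
    rw [← comb_single (N := N) i]
    congr 1
    funext j
    simp [Pi.single_apply]
  rw [this]; rfl

lemma aeval_commute {a b : R} (h : Commute a b) (p : ℝ[X]) : Commute a (aeval b p) := by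
  induction p using Polynomial.induction_on' with
  | add p q hp hq => rw [map_add]; exact hp.add_right hq
  | monomial k c =>
    rw [aeval_monomial]
    exact (show Commute a _ from (Algebra.commutes c a).symm).mul_right (h.pow_right k)

end comb

section lemmaP
variable {n : ℕ} {M : Type*} [NormedAddCommGroup M] [NormedSpace ℝ M] [FiniteDimensional ℝ M]

lemma continuous_comb_pow_apply (N : Fin n → Module.End ℝ M) (w : M) (k : ℕ) :
    Continuous (fun t : Fin n → ℝ => (comb N t ^ k) w) := by
  induction k with
  | zero => simp only [pow_zero]; exact continuous_const
  | succ k ih =>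
    simp only [pow_succ', Module.End.mul_apply]
    have : (fun t : Fin n → ℝ => (comb N t) ((comb N t ^ k) w)) =
        fun t => ∑ i, t i • N i ((comb N t ^ k) w) := by
      funext t
      show (∑ i, t i • N i) _ = _
      rw [LinearMap.sum_apply]
      rfl
    rw [this]
    refine continuous_finsetSum _ fun i _ => (continuous_apply i).smul ?_
    exact (LinearMap.continuous_of_finiteDimensional (N i)).comp ih

lemma continuous_nexp_comb {N : Fin n → Module.End ℝ M} (h : ∀ i j, Commute (N i) (N j))
    (hn : ∀ i, IsNilpotent (N i)) (w : M) :
    Continuous (fun t : Fin n → ℝ => nexp (comb N t) w) := by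
  have : (fun t : Fin n → ℝ => nexp (comb N t) w) = fun t => ∑ i ∈ Finset.range
      (Module.finrank ℝ M), ((i.factorial : ℝ)⁻¹) • (comb N t ^ i) w := by
    funext t
    rw [nexp_eq_sum (nilp_pow_finrank (comb_nil h hn t))]
    simp [LinearMap.sum_apply]
  rw [this]
  exact continuous_finsetSum _ fun i _ => (continuous_comb_pow_apply N w i).const_smul _

lemma lemmaP_aux {N : Fin n → Module.End ℝ M} (h : ∀ i j, Commute (N i) (N j))
    (hn : ∀ i, IsNilpotent (N i)) (w : M)
    (hfin : ∀ K : Set M, IsCompact K →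
      {m : Fin n → ℤ | nexp (comb N (fun i => ((m i : ℤ) : ℝ))) w ∈ K}.Finite)
    (t : Fin n → ℝ) (ht : comb N t w = 0) : t = 0 := by
  by_contra hne
  obtain ⟨i, hi⟩ := Function.ne_iff.1 hne
  have hfix : ∀ s : ℝ, nexp (comb N (s • t)) w = w := by
    intro s
    obtain ⟨u, hu, hc⟩ := nexp_sub_one (comb_nil h hn (s • t))
    have h0 : comb N (s • t) w = 0 := by rw [comb_smul, LinearMap.smul_apply, ht, smul_zero]
    have hc2 : Commute (comb N (s • t)) (1 + comb N (s • t) * u) :=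
      (Commute.one_right _).add_right ((Commute.refl _).mul_right hc)
    rw [hu, hc2.eq]
    simp [h0]
  have hK : IsCompact ((fun u : Fin n → ℝ => nexp (comb N u) w) '' Set.Icc (-1) 0) :=
    isCompact_Icc.image (continuous_nexp_comb h hn w)
  have hf := hfin _ hK
  have hmem : ∀ s : ℕ, (fun i => ⌊(s:ℝ) * t i⌋) ∈ {m : Fin n → ℤ |
      nexp (comb N (fun i => ((m i : ℤ) : ℝ))) w ∈
        ((fun u : Fin n → ℝ => nexp (comb N u) w) '' Set.Icc (-1) 0)} := by
    intro s
    refine ⟨fun i => (⌊(s:ℝ) * t i⌋ : ℝ) - s * t i, ⟨fun j => ?_, fun j => ?_⟩, ?_⟩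
    · have := Int.lt_floor_add_one ((s:ℝ) * t j)
      simp only [Pi.neg_apply, Pi.one_apply]; linarith
    · have := Int.floor_le ((s:ℝ) * t j)
      simp only [Pi.zero_apply]; linarith
    · have : (fun i => ((⌊(s:ℝ) * t i⌋ : ℤ) : ℝ)) =
          (fun i => (⌊(s:ℝ) * t i⌋ : ℝ) - s * t i) + (s:ℝ) • t := by
        funext j; simp
      show _ = nexp (comb N (fun i => ((⌊(s:ℝ) * t i⌋ : ℤ) : ℝ))) w
      rw [this, nexp_comb_add h hn, Module.End.mul_apply, hfix]
  have hbd := (hf.image (fun m => |((m i : ℤ) : ℝ)|)).bddAbove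
  obtain ⟨C, hC⟩ := hbd
  obtain ⟨s, hs⟩ := exists_nat_gt ((C + 1) / |t i|)
  have h1 := hC ⟨_, hmem s, rfl⟩
  have hpos : 0 < |t i| := abs_pos.2 hi
  rw [div_lt_iff₀ hpos] at hs
  have h2 : |(s:ℝ) * t i| = s * |t i| := by rw [abs_mul, Nat.abs_cast]
  have h3 := Int.lt_floor_add_one ((s:ℝ) * t i)
  have h4 := Int.floor_le ((s:ℝ) * t i)
  simp only at h1
  have h5 : |(s:ℝ) * t i| ≤ |(⌊(s:ℝ) * t i⌋ : ℝ)| + 1 := by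
    have := abs_sub_abs_le_abs_sub ((s:ℝ) * t i) (⌊(s:ℝ) * t i⌋ : ℝ)
    have h6 : |(s:ℝ) * t i - (⌊(s:ℝ) * t i⌋ : ℝ)| ≤ 1 := by
      rw [abs_le]; constructor <;> linarith
    linarith
  linarith

lemma lemmaP (φ : Multiplicative (Fin n → ℤ) →* Module.End ℝ M) (d : ℕ)
    (hd : ∀ i, (φ (Multiplicative.ofAdd (Pi.single i 1)) - 1) ^ d = 0) (w : M)
    (hfin : ∀ K : Set M, IsCompact K → {m | φ m w ∈ K}.Finite)
    (t : Fin n → ℝ)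
    (ht : comb (fun i => aeval (φ (Multiplicative.ofAdd (Pi.single i 1)) - 1) (logP d)) t w = 0) :
    t = 0 := by
  set N := (fun i => aeval (φ (Multiplicative.ofAdd (Pi.single i 1)) - 1) (logP d))
  have hc : ∀ a b, Commute (φ a) (φ b) := fun a b => (Commute.all a b).map φ
  have h : ∀ i j, Commute (N i) (N j) := by
    intro i j
    refine aeval_commute (Commute.sub_right (aeval_commute (Commute.sub_right (hc _ _) ?_) _).symm
      (Commute.one_right _)) _
    exact Commute.one_right _
  have hn : ∀ i, IsNilpotent (N i) := fun i => ⟨d, logP_nil (hd i)⟩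
  have hφ : ∀ i, φ (Multiplicative.ofAdd (Pi.single i 1)) = nexp (N i) := fun i => by
    rw [nexp_logP (hd i)]; abel
  refine lemmaP_aux h hn w (fun K hK => ?_) t ht
  refine ((hfin K hK).preimage (f := Multiplicative.ofAdd)
    Multiplicative.ofAdd.injective.injOn).subset fun m hm => ?_
  show φ _ w ∈ K
  rw [hom_eq_nexp h hn φ hφ]
  exact hm

end lemmaP

end

section
open Polynomial

section I1
variable {V : Type*} [NormedAddCommGroup V] [NormedSpace ℝ V] 

lemma affToLin_apply (g : V ≃ᵃ[ℝ] V) (v : V) (t : ℝ) :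
    affToLin g (v, t) = (g.linear v + t • g 0, t) := rfl

lemma aff_eq (g : V ≃ᵃ[ℝ] V) (v : V) : g v = g.linear v + g 0 := by
  have := g.map_vadd 0 v
  simpa using this

lemma affToLin_one_apply (g : V ≃ᵃ[ℝ] V) (v : V) : affToLin g (v, 1) = (g v, 1) := by
  rw [affToLin_apply, one_smul, ← aff_eq]

/-- `affToLin` as a homomorphism -/
def affToLinHom : (V ≃ᵃ[ℝ] V) →* Module.End ℝ (V × ℝ) where
  toFun := affToLin
  map_one' := by
    apply LinearMap.ext
    rintro ⟨v, t⟩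
    rw [affToLin_apply]
    simp
    rfl
  map_mul' a b := by
    apply LinearMap.ext
    rintro ⟨v, t⟩
    rw [Module.End.mul_apply, affToLin_apply, affToLin_apply, affToLin_apply]
    have h1 : (a * b) 0 = a (b 0) := rfl
    have h2 : (a * b).linear v = a.linear (b.linear v) := rfl
    rw [h1, h2, aff_eq a (b 0)]
    simp [add_assoc]

lemma affToLin_inj {a b : V ≃ᵃ[ℝ] V} (h : affToLin a = affToLin b) : a = b := by
  ext v
  have := LinearMap.congr_fun h (v, 1)
  rw [affToLin_one_apply, affToLin_one_apply] at this
  exact (Prod.ext_iff.1 this).1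

lemma snd_aeval {f : Module.End ℝ (V × ℝ)} (hf : ∀ x, (f x).2 = 0) (p : ℝ[X]) (x : V × ℝ) :
    (aeval f p x).2 = p.coeff 0 * x.2 := by
  have h := congrArg (fun q => (aeval f q x).2) (X_mul_divX_add p)
  simp only [map_add, map_mul, aeval_X, aeval_C, LinearMap.add_apply, Module.End.mul_apply,
    Prod.snd_add, hf, zero_add, Module.algebraMap_end_apply, Prod.smul_snd, smul_eq_mul] at h
  exact h.symm

lemma exists_gen_fixed [FiniteDimensional ℝ V] {n : ℕ} (f : Fin n → Module.End ℝ (V × ℝ))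
    (hf : ∀ i x, (f i x).2 = 0) (hc : ∀ i j, Commute (f i) (f j)) (s : Finset (Fin n)) :
    ∃ v : V, ∀ i ∈ s, (f i ^ Module.finrank ℝ (V × ℝ)) (v, 1) = 0 := by
  induction s using Finset.induction with
  | empty => exact ⟨0, by simp⟩
  | insert i s his ih =>
    obtain ⟨v, hv⟩ := ih
    set χ := LinearMap.charpoly (f i) with hχ
    have hχ0 : χ ≠ 0 := (LinearMap.charpoly_monic (f i)).ne_zero
    obtain ⟨q, hq, hnd⟩ := exists_eq_pow_rootMultiplicity_mul_and_not_dvd χ hχ0 0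
    set a := χ.rootMultiplicity 0
    rw [C_0, sub_zero] at hq hnd
    have ha : a ≤ Module.finrank ℝ (V × ℝ) := by
      rw [← LinearMap.charpoly_natDegree (f i), ← hχ]
      have hq0 : q ≠ 0 := by rintro rfl; simp at hnd
      rw [hq, natDegree_mul (pow_ne_zero _ X_ne_zero) hq0]
      simp
    have hq0 : q.coeff 0 ≠ 0 := fun h => hnd (X_dvd_iff.2 h)
    have hCH := LinearMap.aeval_self_charpoly (f i)
    rw [← hχ, hq, map_mul, map_pow, aeval_X] at hCH
    have hsnd := snd_aeval (hf i) q (v, 1)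
    refine ⟨(q.coeff 0)⁻¹ • (aeval (f i) q (v, 1)).1, fun j hj => ?_⟩
    have he : ((q.coeff 0)⁻¹ • (aeval (f i) q (v, 1)).1, (1:ℝ)) =
        (q.coeff 0)⁻¹ • (aeval (f i) q (v, 1)) := by
      ext
      · rfl
      · simp [hsnd, hq0]
    rw [he, map_smul, ← Module.End.mul_apply]
    rcases Finset.mem_insert.1 hj with rfl | hj
    · have : f j ^ Module.finrank ℝ (V × ℝ) * aeval (f j) q = 0 := by
        obtain ⟨k, hk⟩ := Nat.exists_eq_add_of_le ha
        rw [hk, add_comm, pow_add, mul_assoc, hCH, mul_zero]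
      rw [this]; simp
    · rw [(aeval_commute ((hc j i).pow_left _) q).eq, Module.End.mul_apply, hv j hj]
      simp

lemma finite_return {n : ℕ} {ρ : Multiplicative (Fin n → ℤ) →* (V ≃ᵃ[ℝ] V)}
    (hinj : Function.Injective ρ) (hpd : ProperlyDiscontinuousAff ρ.range) (v : V)
    {K : Set (V × ℝ)} (hK : IsCompact K) : {m | affToLinHom (ρ m) (v, 1) ∈ K}.Finite := by
  have h1 := hpd ((Prod.fst '' K) ∪ {v}) ((hK.image continuous_fst).union isCompact_singleton)
  refine (h1.preimage (f := ρ) hinj.injOn).subset fun m hm => ?_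
  refine ⟨⟨m, rfl⟩, ρ m v, ⟨v, Or.inr rfl, rfl⟩, Or.inl ?_⟩
  refine ⟨_, hm, ?_⟩
  show (affToLin _ _).1 = _
  rw [affToLin_one_apply]

theorem homC_unipotent [FiniteDimensional ℝ V] {n : ℕ} (hn : Module.finrank ℝ V = n)
    (ρ : Multiplicative (Fin n → ℤ) →* (V ≃ᵃ[ℝ] V))
    (hinj : Function.Injective ρ) (hpd : ProperlyDiscontinuousAff ρ.range) :
    (∀ i, (affToLin (ρ (Multiplicative.ofAdd (Pi.single i 1))) - 1) ^ (n + 1) = 0) ∧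
    ∀ t, comb (fun i => aeval (affToLin (ρ (Multiplicative.ofAdd (Pi.single i 1))) - 1)
      (logP (n + 1))) t (0, 1) = 0 → t = 0 := by
  set φ : Multiplicative (Fin n → ℤ) →* Module.End ℝ (V × ℝ) := affToLinHom.comp ρ with hφ
  have hfr : Module.finrank ℝ (V × ℝ) = n + 1 := by simp [hn]
  have hc : ∀ a b, Commute (φ a) (φ b) := fun a b => (Commute.all a b).map φ
  set f : Fin n → Module.End ℝ (V × ℝ) :=
    fun i => φ (Multiplicative.ofAdd (Pi.single i 1)) - 1 with hf
  have hfc : ∀ a i, Commute (φ a) (f i) := fun a i => (hc _ _).sub_right (Commute.one_right _)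
  have hff : ∀ i j, Commute (f i) (f j) := fun i j =>
    (hfc _ _).sub_left (Commute.one_left _)
  have hf2 : ∀ i x, (f i x).2 = 0 := fun i x => by
    show (affToLin _ x - x).2 = 0
    obtain ⟨v, t⟩ := x
    rw [affToLin_apply]; simp
  obtain ⟨v, hv⟩ := exists_gen_fixed f hf2 hff Finset.univ
  rw [hfr] at hv
  let W : Submodule ℝ (V × ℝ) := ⨅ i, LinearMap.ker (f i ^ (n + 1))
  have hW : ∀ x, x ∈ W ↔ ∀ i, (f i ^ (n + 1)) x = 0 := fun x => by
    simp [W, Submodule.mem_iInf, LinearMap.mem_ker]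
  have hinv : ∀ a : Module.End ℝ (V × ℝ), (∀ i, Commute a (f i)) → ∀ x ∈ W, a x ∈ W := by
    intro a ha x hx
    rw [hW] at hx ⊢
    intro i
    rw [← Module.End.mul_apply, ← ((ha i).pow_right _).eq, Module.End.mul_apply, hx, map_zero]
  let φ1 : Multiplicative (Fin n → ℤ) →* Module.End ℝ W :=
    { toFun := fun m => (φ m).restrict (hinv (φ m) (hfc m))
      map_one' := by ext x <;> simp
      map_mul' := fun a b => by ext x <;> simp }
  have hφ1 : ∀ m (x : W), ((φ1 m x : W) : V × ℝ) = φ m x := fun m x => rfl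
  have hpow : ∀ i k (x : W), ((((φ1 (Multiplicative.ofAdd (Pi.single i 1)) - 1) ^ k) x : W) :
      V × ℝ) = (f i ^ k) x := by
    intro i k x
    induction k with
    | zero => simp
    | succ k ih =>
      rw [pow_succ', pow_succ', Module.End.mul_apply, Module.End.mul_apply, ← ih]
      rfl
  have hd1 : ∀ i, (φ1 (Multiplicative.ofAdd (Pi.single i 1)) - 1) ^ (n + 1) = 0 := by
    intro i
    ext1 x
    apply Subtype.ext
    rw [hpow]
    exact (hW _).1 x.2 i
  let w : W := ⟨(v, 1), (hW _).2 fun i => hv i (Finset.mem_univ i)⟩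
  have hP := lemmaP φ1 (n + 1) hd1 w (fun K hK => by
    have := finite_return hinj hpd v (hK.image continuous_subtype_val)
    refine this.subset fun m hm => ?_
    exact ⟨_, hm, rfl⟩)
  set N1 := fun i => aeval (φ1 (Multiplicative.ofAdd (Pi.single i 1)) - 1) (logP (n + 1)) with hN1
  have hsnd : ∀ t x, ((comb N1 t x : W) : V × ℝ).2 = 0 := by
    intro t x
    have h1 : ∀ i x, ((N1 i x : W) : V × ℝ).2 = 0 := by
      intro i x
      obtain ⟨q, hq⟩ := X_dvd_logP (n + 1)
      simp only [hN1, hq, map_mul, aeval_X]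
      exact hf2 i _
    rw [comb, LinearMap.sum_apply, AddSubmonoidClass.coe_finsetSum, Prod.snd_sum]
    refine Finset.sum_eq_zero fun i _ => ?_
    rw [LinearMap.smul_apply, Submodule.coe_smul, Prod.smul_snd, h1, smul_zero]
  let Θ : ((Fin n → ℝ) × ℝ) →ₗ[ℝ] W :=
    { toFun := fun p => comb N1 p.1 w + p.2 • w
      map_add' := fun p q => by
        simp only [Prod.fst_add, Prod.snd_add, comb_add, LinearMap.add_apply, add_smul]; abel
      map_smul' := fun c p => by
        simp only [Prod.smul_fst, Prod.smul_snd, comb_smul, LinearMap.smul_apply, smul_add,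
          smul_eq_mul, mul_smul, RingHom.id_apply] }
  have hΘ : Function.Injective Θ := by
    rw [← LinearMap.ker_eq_bot, LinearMap.ker_eq_bot']
    rintro ⟨t, c⟩ h
    change comb N1 t w + c • w = 0 at h
    have h2 := congrArg (fun y : W => (y : V × ℝ).2) h
    simp only [Submodule.coe_add, Prod.snd_add, hsnd, Submodule.coe_smul, Prod.smul_snd] at h2
    have hc0 : c = 0 := by simpa [w] using h2
    rw [hc0, zero_smul, add_zero] at h
    rw [hP t h, hc0]; rfl
  have hWtop : W = ⊤ := by
    apply Submodule.eq_top_of_finrank_eq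
    apply le_antisymm (Submodule.finrank_le W)
    have := LinearMap.finrank_le_finrank_of_injective hΘ
    rw [hfr]
    simpa using this
  have hfn : ∀ i, f i ^ (n + 1) = 0 := by
    intro i
    refine LinearMap.ext fun x => ?_
    exact (hW x).1 (by rw [hWtop]; trivial) i
  exact ⟨hfn, lemmaP φ (n + 1) hfn (0, 1) (fun K hK => finite_return hinj hpd 0 hK)⟩

end I1

end

section
open Matrix

lemma PolyFun.continuous' {E : Type*} [AddCommGroup E] [Module ℝ E] [FiniteDimensional ℝ E]
    [TopologicalSpace E] [IsTopologicalAddGroup E] [ContinuousSMul ℝ E] [T2Space E]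
    {f : E → ℝ} (hf : f ∈ PolyFun E) : Continuous f := by
  induction hf using Algebra.adjoin_induction with
  | mem x hx =>
    obtain ⟨φ, rfl⟩ := hx
    exact LinearMap.continuous_of_finiteDimensional φ
  | algebraMap r => exact continuous_const
  | add x y _ _ hx hy => exact hx.add hy
  | mul x y _ _ hx hy => exact hx.mul hy

lemma PolyMap.continuous' {E F : Type*} [AddCommGroup E] [Module ℝ E] [FiniteDimensional ℝ E]
    [TopologicalSpace E] [IsTopologicalAddGroup E] [ContinuousSMul ℝ E] [T2Space E]
    [AddCommGroup F] [Module ℝ F] [FiniteDimensional ℝ F]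
    [TopologicalSpace F] [IsTopologicalAddGroup F] [ContinuousSMul ℝ F] [T2Space F]
    {f : E → F} (hf : PolyMap f) : Continuous f := by
  let e := (Module.finBasis ℝ F).equivFun.toContinuousLinearEquiv
  have h : Continuous (fun x => e (f x)) := continuous_pi fun i =>
    PolyFun.continuous' (hf ((Module.finBasis ℝ F).coord i))
  have h2 := e.symm.continuous.comp h
  convert h2 using 1
  funext x
  simp

section R
variable {n : ℕ}

lemma exists_rep0 {q : Matrix (Fin n) (Fin n) ℝ → ℝ} (hq : q ∈ PolyFun (Matrix (Fin n) (Fin n) ℝ)) :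
    ∃ (J : Type) (_ : Fintype J) (_ : DecidableEq J) (ν : Matrix (Fin n) (Fin n) ℝ → J → ℝ)
      (T : Matrix (Fin n) (Fin n) ℝ → Matrix J J ℝ) (w : J → ℝ),
      PolyMap ν ∧ Continuous T ∧ T 1 = 1 ∧ (∀ x g, ν (x * g) = T g *ᵥ ν x) ∧
      ∀ x, q x = w ⬝ᵥ ν x := by
  induction hq using Algebra.adjoin_induction with
  | mem x hx =>
    obtain ⟨φ, rfl⟩ := hx
    refine ⟨Fin n × Fin n, inferInstance, inferInstance, fun x p => x p.1 p.2,
      fun g => Matrix.of fun p r => if p.1 = r.1 then g r.2 p.2 else 0,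
      fun p => φ (Matrix.single p.1 p.2 1), ?_, ?_, ?_, ?_, ?_⟩
    · refine PolyMap.pi fun p => ?_
      exact LinearMap.polyMap (Matrix.entryLinearMap ℝ ℝ p.1 p.2)
    · refine continuous_matrix fun p r => ?_
      simp only [of_apply]
      split_ifs
      · exact continuous_id.matrix_elem _ _
      · exact continuous_const
    · ext ⟨a, b⟩ ⟨c, d⟩
      simp only [of_apply, Matrix.one_apply, Prod.mk.injEq]
      split_ifs <;> simp_all
    · intro x g
      funext ⟨a, b⟩
      simp [Matrix.mul_apply, mulVec, dotProduct, Fintype.sum_prod_type, mul_comm]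
    · intro x
      conv_lhs => rw [Matrix.matrix_eq_sum_single x]
      simp only [map_sum, dotProduct, Fintype.sum_prod_type]
      refine Finset.sum_congr rfl fun i _ => Finset.sum_congr rfl fun j _ => ?_
      have : Matrix.single i j (x i j) = x i j • Matrix.single i j (1:ℝ) := by simp
      rw [this, map_smul, smul_eq_mul, mul_comm]
  | algebraMap r =>
    refine ⟨Unit, inferInstance, inferInstance, fun _ _ => 1, fun _ => 1, fun _ => r,
      polyMap_const _, continuous_const, rfl, fun x g => by simp, fun x => by
        simp⟩
  | add f g _ _ hf hg =>
    obtain ⟨J, i1, i2, ν, T, w, h1, h2, h3, h4, h5⟩ := hf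
    obtain ⟨J', i1', i2', ν', T', w', h1', h2', h3', h4', h5'⟩ := hg
    refine ⟨J ⊕ J', inferInstance, inferInstance, fun x => Sum.elim (ν x) (ν' x),
      fun g => fromBlocks (T g) 0 0 (T' g), Sum.elim w w', ?_, ?_, ?_, ?_, ?_⟩
    · refine PolyMap.pi fun p => ?_
      rcases p with p | p
      · exact PolyMap.comp (PolyMap.apply (F := fun _ : J => ℝ) p) h1
      · exact PolyMap.comp (PolyMap.apply (F := fun _ : J' => ℝ) p) h1'
    · exact Continuous.matrix_fromBlocks h2 continuous_const continuous_const h2'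
    · beta_reduce
      rw [h3, h3', fromBlocks_one]
    · intro x g
      beta_reduce
      rw [fromBlocks_mulVec, h4, h4']
      simp
    · intro x
      rw [sumElim_dotProduct_sumElim, ← h5, ← h5']; rfl
  | mul f g _ _ hf hg =>
    obtain ⟨J, i1, i2, ν, T, w, h1, h2, h3, h4, h5⟩ := hf
    obtain ⟨J', i1', i2', ν', T', w', h1', h2', h3', h4', h5'⟩ := hg
    refine ⟨J × J', inferInstance, inferInstance, fun x p => ν x p.1 * ν' x p.2,
      fun g => kroneckerMap (· * ·) (T g) (T' g), fun p => w p.1 * w' p.2, ?_, ?_, ?_, ?_, ?_⟩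
    · refine PolyMap.pi fun p => ?_
      exact PolyMap.mul (PolyMap.comp (PolyMap.apply _) h1) (PolyMap.comp (PolyMap.apply _) h1')
    · refine continuous_matrix fun p r => ?_
      exact (h2.matrix_elem _ _).mul (h2'.matrix_elem _ _)
    · beta_reduce
      rw [h3, h3']
      exact Matrix.one_kronecker_one
    · intro x g
      funext ⟨a, b⟩
      beta_reduce
      rw [h4, h4']
      simp only [mulVec, dotProduct, kroneckerMap_apply, Fintype.sum_prod_type,
        Finset.sum_mul_sum]
      refine Finset.sum_congr rfl fun i _ => Finset.sum_congr rfl fun j _ => ?_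
      ring
    · intro x
      rw [Pi.mul_apply, h5, h5']
      simp only [dotProduct, Fintype.sum_prod_type, Finset.sum_mul_sum]
      refine Finset.sum_congr rfl fun i _ => Finset.sum_congr rfl fun j _ => ?_
      ring

lemma exists_rep {q : Matrix (Fin n) (Fin n) ℝ → ℝ} (hq : q ∈ PolyFun (Matrix (Fin n) (Fin n) ℝ)) :
    ∃ (J : Type) (_ : Fintype J) (ν : Matrix (Fin n) (Fin n) ℝ → EuclideanSpace ℝ J)
      (S : Matrix (Fin n) (Fin n) ℝ → EuclideanSpace ℝ J → EuclideanSpace ℝ J)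
      (w : EuclideanSpace ℝ J),
      PolyMap ν ∧ (∀ y, Continuous fun g => S g y) ∧ (∀ y, S 1 y = y) ∧
      (∀ x g y, inner ℝ y (ν (x * g)) = inner ℝ (S g y) (ν x)) ∧
      ∀ x, q x = inner ℝ w (ν x) := by
  obtain ⟨J, i1, i2, ν, T, w, h1, h2, h3, h4, h5⟩ := exists_rep0 hq
  have hin : ∀ a b : J → ℝ, inner ℝ (WithLp.toLp 2 a) (WithLp.toLp 2 b : EuclideanSpace ℝ J)
      = a ⬝ᵥ b := by
    intro a b
    simp [PiLp.inner_apply, dotProduct, mul_comm]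
  refine ⟨J, i1, fun x => WithLp.toLp 2 (ν x),
    fun g y => WithLp.toLp 2 ((T g)ᵀ *ᵥ (WithLp.ofLp y)), WithLp.toLp 2 w, ?_, ?_, ?_, ?_, ?_⟩
  · exact PolyMap.linear (WithLp.linearEquiv 2 ℝ (J → ℝ)).symm.toLinearMap h1
  · intro y
    refine (PiLp.continuous_toLp 2 _).comp ?_
    exact h2.matrix_transpose.matrix_mulVec continuous_const
  · intro y
    beta_reduce
    rw [h3]; simp
  · intro x g y
    beta_reduce
    rw [hin, h4, mulVec_transpose, hin, dotProduct_mulVec]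
  · intro x
    rw [hin, h5]
end R

end

section
open Filter Topology

lemma ultra_conv {X Y : Type*} [TopologicalSpace Y] (U : Ultrafilter X) {f : X → Y} {K : Set Y}
    (hK : IsCompact K) (h : ∀ᶠ x in (U : Filter X), f x ∈ K) : ∃ y, Tendsto f U (𝓝 y) := by
  obtain ⟨y, _, hy⟩ := hK.ultrafilter_le_nhds' (U.map f) h
  exact ⟨y, hy⟩

section units
variable {n : ℕ}

/-- squared Frobenius norm -/
def nsq (M : Matrix (Fin n) (Fin n) ℝ) : ℝ := ∑ i, ∑ j, M i j * M i j

/-- a proper function on the general linear group -/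
def psi (L : (Matrix (Fin n) (Fin n) ℝ)ˣ) : ℝ :=
  nsq (L : Matrix (Fin n) (Fin n) ℝ) + nsq (↑(L⁻¹) : Matrix (Fin n) (Fin n) ℝ)

lemma nsq_nonneg (M : Matrix (Fin n) (Fin n) ℝ) : 0 ≤ nsq M :=
  Finset.sum_nonneg fun _ _ => Finset.sum_nonneg fun _ _ => mul_self_nonneg _

lemma continuous_nsq : Continuous (nsq : Matrix (Fin n) (Fin n) ℝ → ℝ) := by
  refine continuous_finsetSum _ fun i _ => continuous_finsetSum _ fun j _ => ?_
  exact (continuous_id.matrix_elem i j).mul (continuous_id.matrix_elem i j)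

lemma polyMap_nsq : PolyMap (nsq : Matrix (Fin n) (Fin n) ℝ → ℝ) := by
  refine PolyMap.sum _ fun i => PolyMap.sum _ fun j => ?_
  exact (LinearMap.polyMap (Matrix.entryLinearMap ℝ ℝ i j)).mul
    (LinearMap.polyMap (Matrix.entryLinearMap ℝ ℝ i j))

lemma continuous_psi : Continuous (psi : (Matrix (Fin n) (Fin n) ℝ)ˣ → ℝ) :=
  (continuous_nsq.comp Units.continuous_val).add
    (continuous_nsq.comp (Units.continuous_val.comp continuous_inv))

lemma nsq_compact (C : ℝ) : IsCompact {M : Matrix (Fin n) (Fin n) ℝ | nsq M ≤ C} := by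
  have hK : IsCompact (Set.univ.pi fun _ : Fin n => Set.univ.pi fun _ : Fin n =>
      Set.Icc (-(C + 1)) (C + 1)) :=
    isCompact_univ_pi fun _ => isCompact_univ_pi fun _ => isCompact_Icc
  refine IsCompact.of_isClosed_subset hK (isClosed_le continuous_nsq continuous_const) ?_
  intro M hM i _ j _
  have h1 : M i j * M i j ≤ nsq M :=
    (Finset.single_le_sum (f := fun j => M i j * M i j) (fun _ _ => mul_self_nonneg _)
      (Finset.mem_univ j)).trans
    (Finset.single_le_sum (f := fun i => ∑ j, M i j * M i j)
      (fun _ _ => Finset.sum_nonneg fun _ _ => mul_self_nonneg _) (Finset.mem_univ i))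
  have h2 : M i j * M i j ≤ C := h1.trans hM
  constructor <;> nlinarith [mul_self_nonneg (M i j - 1), mul_self_nonneg (M i j + 1)]

lemma psi_compact (C : ℝ) : IsCompact {L : (Matrix (Fin n) (Fin n) ℝ)ˣ | psi L ≤ C} := by
  have hK := (Units.isClosedEmbedding_embedProduct (α := Matrix (Fin n) (Fin n) ℝ)).isCompact_preimage
    ((nsq_compact (n := n) C).prod
      ((nsq_compact (n := n) C).image MulOpposite.continuous_op))
  refine IsCompact.of_isClosed_subset hK (isClosed_le continuous_psi continuous_const) ?_
  intro L hL
  have hL' : nsq (L : Matrix (Fin n) (Fin n) ℝ) +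
    nsq (↑(L⁻¹) : Matrix (Fin n) (Fin n) ℝ) ≤ C := hL
  refine ⟨?_, ⟨_, ?_, rfl⟩⟩
  · show nsq (L : Matrix (Fin n) (Fin n) ℝ) ≤ C
    linarith [nsq_nonneg (↑(L⁻¹) : Matrix (Fin n) (Fin n) ℝ)]
  · show nsq _ ≤ C
    linarith [nsq_nonneg (L : Matrix (Fin n) (Fin n) ℝ)]

lemma exists_phi {H : Subgroup (Matrix (Fin n) (Fin n) ℝ)ˣ}
    (hH : IsClosed (H : Set (Matrix (Fin n) (Fin n) ℝ)ˣ)) :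
    ∃ φ : (Matrix (Fin n) (Fin n) ℝ)ˣ → ℝ, Continuous φ ∧ (∀ L, ∃ a ∈ H, psi (a * L) = φ L) ∧
      ∀ L, ∀ a ∈ H, φ L ≤ psi (a * L) := by
  have hmin : ∀ L : (Matrix (Fin n) (Fin n) ℝ)ˣ, ∃ a ∈ H, ∀ b ∈ H, psi (a * L) ≤ psi (b * L) := by
    intro L
    have hcl : IsClosed {x : (Matrix (Fin n) (Fin n) ℝ)ˣ | x * L⁻¹ ∈ H} :=
      hH.preimage (continuous_mul_const L⁻¹)
    have hc := (psi_compact (psi L)).inter_right hcl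
    obtain ⟨x, ⟨hx1, hx2⟩, hx⟩ := hc.exists_isMinOn ⟨L, le_refl (psi L), by simp⟩ continuous_psi.continuousOn
    refine ⟨x * L⁻¹, hx2, fun b hb => ?_⟩
    rw [inv_mul_cancel_right]
    rcases le_total (psi (b * L)) (psi L) with h | h
    · exact hx ⟨h, by simpa using hb⟩
    · exact le_trans hx1 h
  choose m hm1 hm2 using hmin
  refine ⟨fun L => psi (m L * L), ?_, fun L => ⟨_, hm1 L, rfl⟩, hm2⟩
  rw [continuous_iff_ultrafilter]
  intro L U hU
  have hid : Tendsto (fun x : (Matrix (Fin n) (Fin n) ℝ)ˣ => x) U (𝓝 L) := hU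
  have hbd : ∀ᶠ x in (U : Filter _), m x * x ∈ {y | psi y ≤ psi L + 1} := by
    have := ((continuous_psi.tendsto L).comp hid).eventually_lt_const
      (show psi L < psi L + 1 by linarith)
    filter_upwards [this] with x hx
    have h1 := hm2 x 1 H.one_mem
    rw [one_mul] at h1
    exact h1.trans hx.le
  obtain ⟨b, hb⟩ := ultra_conv U (psi_compact _) hbd
  have ha : Tendsto (fun x => m x) U (𝓝 (b * L⁻¹)) := by
    have := hb.mul hid.inv
    simpa using this
  have haH : b * L⁻¹ ∈ H := hH.mem_of_tendsto ha (Eventually.of_forall hm1)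
  have hlim : Tendsto (fun x => psi (m x * x)) U (𝓝 (psi b)) := (continuous_psi.tendsto b).comp hb
  have hle : psi b ≤ psi (m L * L) := by
    refine le_of_tendsto_of_tendsto' hlim
      ((continuous_psi.tendsto _).comp (tendsto_const_nhds.mul hid)) fun x => hm2 x _ (hm1 L)
  have hge : psi (m L * L) ≤ psi b := by
    have := hm2 L _ haH
    rwa [inv_mul_cancel_right] at this
  rw [le_antisymm hge hle]
  exact hlim

end units

lemma isQuotientMap_of_section {X S : Type*} [TopologicalSpace X] [TopologicalSpace S] {f : X → S}
    (hf : Continuous f) [T2Space S] (σ : S → X) (hσ : ∀ s, f (σ s) = s)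
    (h : ∀ (U : Ultrafilter S) (s : S), (U : Filter S) ≤ 𝓝 s → ∃ x, Tendsto σ U (𝓝 x)) :
    IsQuotientMap f := by
  rw [isQuotientMap_iff_isClosed]
  refine ⟨fun s => ⟨_, hσ s⟩, fun K => ⟨fun hK => hK.preimage hf, fun hK => ?_⟩⟩
  rw [isClosed_iff_ultrafilter]
  intro s U hU hKU
  obtain ⟨x, hx⟩ := h U s hU
  have hxK : x ∈ f ⁻¹' K := by
    refine hK.mem_of_tendsto hx ?_
    filter_upwards [hKU] with u hu
    show f (σ u) ∈ K
    rwa [hσ]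
  have h1 : Tendsto (fun u => f (σ u)) U (𝓝 (f x)) := (hf.tendsto x).comp hx
  simp only [hσ] at h1
  have : f x = s := tendsto_nhds_unique h1 hU
  rw [← this]
  exact hxK

end

section
open Filter Topology

section F
variable {n : ℕ}

/-- the subspace attached to `L` -/
def Wsub {J : Type} [Fintype J] (ν : Matrix (Fin n) (Fin n) ℝ → EuclideanSpace ℝ J)
    (H : Subgroup (Matrix (Fin n) (Fin n) ℝ)ˣ) (L : (Matrix (Fin n) (Fin n) ℝ)ˣ) :
    Submodule ℝ (EuclideanSpace ℝ J) where
  carrier := {y | ∀ a ∈ H, inner ℝ y (ν (a * L)) = 0}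
  add_mem' := fun {x y} hx hy a ha => by rw [inner_add_left, hx a ha, hy a ha, add_zero]
  zero_mem' := fun a _ => inner_zero_left _
  smul_mem' := fun c x hx a ha => by rw [inner_smul_left, hx a ha, mul_zero]

/-- characterisation of the orthogonal projection onto a subspace -/
def IsPr {J : Type} [Fintype J] (W : Set (EuclideanSpace ℝ J))
    (P : EuclideanSpace ℝ J →L[ℝ] EuclideanSpace ℝ J) : Prop :=
  ∀ v, P v ∈ W ∧ ∀ u ∈ W, inner ℝ (v - P v) u = 0

lemma isPr_star {J : Type} [Fintype J] (W : Submodule ℝ (EuclideanSpace ℝ J)) :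
    IsPr (W : Set _) W.starProjection := fun v =>
  ⟨W.starProjection_apply_mem v, fun u hu => by
    rw [real_inner_comm]
    exact W.sub_starProjection_mem_orthogonal v u hu⟩

lemma isPr_unique {J : Type} [Fintype J] {W : Submodule ℝ (EuclideanSpace ℝ J)}
    {P : EuclideanSpace ℝ J →L[ℝ] EuclideanSpace ℝ J} (hP : IsPr (W : Set _) P) :
    P = W.starProjection := by
  ext1 v
  have h1 := hP v
  have h2 := isPr_star W v
  have hm : P v - W.starProjection v ∈ W := W.sub_mem h1.1 h2.1
  have h3 := h1.2 _ hm
  have h4 := h2.2 _ hm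
  rw [← sub_eq_zero, ← inner_self_eq_zero (𝕜 := ℝ)]
  have h5 : P v - W.starProjection v = (v - W.starProjection v) - (v - P v) := by abel
  conv_lhs => rw [h5]
  rw [inner_sub_left, ← h5, h3, h4, sub_zero]

lemma exists_F {q : Matrix (Fin n) (Fin n) ℝ → ℝ} (hq : q ∈ PolyFun (Matrix (Fin n) (Fin n) ℝ))
    {H : Subgroup (Matrix (Fin n) (Fin n) ℝ)ˣ} (hH : ∀ a : (Matrix (Fin n) (Fin n) ℝ)ˣ, a ∈ H ↔ q a = 0) :
    ∃ (J : Type) (_ : Fintype J) (ν : Matrix (Fin n) (Fin n) ℝ → EuclideanSpace ℝ J), PolyMap ν ∧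
      Continuous (fun L => (Wsub ν H L).starProjection) ∧
      ∀ L L', (Wsub ν H L).starProjection = (Wsub ν H L').starProjection ↔ L' * L⁻¹ ∈ H := by
  obtain ⟨J, i1, ν, S, w, hν, hS, hS1, hST, hw⟩ := exists_rep hq
  refine ⟨J, i1, ν, hν, ?_, ?_⟩
  · rw [continuous_iff_ultrafilter]
    intro L U hU
    have hid : Tendsto (fun x : (Matrix (Fin n) (Fin n) ℝ)ˣ => x) U (𝓝 L) := hU
    obtain ⟨P, hP⟩ := ultra_conv U (f := fun L => (Wsub ν H L).starProjection)
      (isCompact_closedBall (0 : EuclideanSpace ℝ J →L[ℝ] EuclideanSpace ℝ J) 1)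
      (Eventually.of_forall fun x => by
        rw [mem_closedBall_zero_iff]; exact Submodule.starProjection_norm_le _)
    have hPr : IsPr (Wsub ν H L : Set _) P := by
      intro v
      have hPv : Tendsto (fun x => (Wsub ν H x).starProjection v) U (𝓝 (P v)) :=
        ((ContinuousLinearMap.apply ℝ (EuclideanSpace ℝ J) v).continuous.tendsto P).comp hP
      constructor
      · intro a ha
        have hl : Tendsto (fun x : (Matrix (Fin n) (Fin n) ℝ)ˣ =>
            inner ℝ ((Wsub ν H x).starProjection v) (ν (a * x))) U
            (𝓝 (inner ℝ (P v) (ν (a * L)))) := by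
          refine hPv.inner ?_
          refine (hν.continuous'.tendsto _).comp ?_
          exact tendsto_const_nhds.mul ((Units.continuous_val.tendsto L).comp hid)
        refine tendsto_nhds_unique hl ?_
        have : ∀ x : (Matrix (Fin n) (Fin n) ℝ)ˣ,
            inner ℝ ((Wsub ν H x).starProjection v) (ν (a * x)) = 0 := fun x =>
          (Wsub ν H x).starProjection_apply_mem v a ha
        simp only [this]
        exact tendsto_const_nhds
      · intro u hu
        have hmem : ∀ x : (Matrix (Fin n) (Fin n) ℝ)ˣ,
            S (↑(x⁻¹ * L) : Matrix (Fin n) (Fin n) ℝ) u ∈ Wsub ν H x := by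
          intro x a ha
          rw [← hST, mul_assoc, ← Units.val_mul, mul_inv_cancel_left]
          exact hu a ha
        have hl : Tendsto (fun x : (Matrix (Fin n) (Fin n) ℝ)ˣ =>
            inner ℝ (v - (Wsub ν H x).starProjection v)
              (S (↑(x⁻¹ * L) : Matrix (Fin n) (Fin n) ℝ) u)) U
            (𝓝 (inner ℝ (v - P v) u)) := by
          refine (tendsto_const_nhds.sub hPv).inner ?_
          have h1 : Tendsto (fun x : (Matrix (Fin n) (Fin n) ℝ)ˣ =>
              (↑(x⁻¹ * L) : Matrix (Fin n) (Fin n) ℝ)) U (𝓝 1) := by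
            have h2 := (Units.continuous_val.tendsto _).comp
              (hid.inv.mul (tendsto_const_nhds (x := L)))
            rw [inv_mul_cancel] at h2
            exact h2
          have h3 := ((hS u).tendsto 1).comp h1
          rw [hS1] at h3
          exact h3
        refine tendsto_nhds_unique hl ?_
        have : ∀ x : (Matrix (Fin n) (Fin n) ℝ)ˣ, inner ℝ (v - (Wsub ν H x).starProjection v)
              (S (↑(x⁻¹ * L) : Matrix (Fin n) (Fin n) ℝ) u) = 0 := fun x =>
          (isPr_star (Wsub ν H x) v).2 _ (hmem x)
        simp only [this]
        exact tendsto_const_nhds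
    rw [← isPr_unique hPr]
    exact hP
  · intro L L'
    constructor
    · intro h
      have hW : Wsub ν H L = Wsub ν H L' := by
        rw [← Submodule.range_starProjection (Wsub ν H L), h, Submodule.range_starProjection]
      have hm : S (↑(L⁻¹) : Matrix (Fin n) (Fin n) ℝ) w ∈ Wsub ν H L := by
        intro a ha
        rw [← hST, mul_assoc, Units.mul_inv, mul_one, ← hw]
        exact (hH a).1 ha
      rw [hW] at hm
      have h1 := hm 1 H.one_mem
      rw [← hST, ← hw] at h1
      rw [hH]
      simpa using h1
    · intro h
      have hW : Wsub ν H L = Wsub ν H L' := by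
        ext y
        constructor
        · intro hy a ha
          have := hy _ (H.mul_mem ha h)
          rw [← this]
          congr 2
          rw [← Units.val_mul, ← Units.val_mul]
          congr 1
          group
        · intro hy a ha
          have := hy _ (H.mul_mem ha (H.inv_mem h))
          rw [← this]
          congr 2
          rw [← Units.val_mul, ← Units.val_mul]
          congr 1
          group
      rw [hW]
end F

end

section
open Filter Topology

section Q
variable {n : ℕ}

@[fun_prop]
lemma polyMap_nsq_comp {E : Type*} [AddCommGroup E] [Module ℝ E]
    {f : E → Matrix (Fin n) (Fin n) ℝ} (hf : PolyMap f) : PolyMap (fun x => nsq (f x)) :=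
  PolyMap.comp polyMap_nsq hf

@[fun_prop]
lemma PolyMap.inner' {E : Type*} [AddCommGroup E] [Module ℝ E] {J : Type} [Fintype J]
    {f g : E → EuclideanSpace ℝ J} (hf : PolyMap f) (hg : PolyMap g) :
    PolyMap (fun x => (inner ℝ (f x) (g x) : ℝ)) :=
  PolyMap.bilin (innerₗ (EuclideanSpace ℝ J)) hf hg

@[fun_prop]
lemma PolyMap.clm_apply' {E : Type*} [AddCommGroup E] [Module ℝ E] {J : Type} [Fintype J]
    {f : E → EuclideanSpace ℝ J →L[ℝ] EuclideanSpace ℝ J} {g : E → EuclideanSpace ℝ J}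
    (hf : PolyMap f) (hg : PolyMap g) : PolyMap (fun x => f x (g x)) :=
  PolyMap.bilin (ContinuousLinearMap.coeLM ℝ) hf hg

variable {Wd : Type*} [AddCommGroup Wd] [Module ℝ Wd]

/-- algebraic description of the subgroup -/
def HH (q : Matrix (Fin n) (Fin n) ℝ → ℝ)
    (c : Matrix (Fin n) (Fin n) ℝ × Matrix (Fin n) (Fin n) ℝ) : Prop :=
  c.1 * c.2 = 1 ∧ c.2 * c.1 = 1 ∧ q c.1 = 0

/-- the first-order description of the image -/
def RangeP {J : Type} [Fintype J] (ν : Matrix (Fin n) (Fin n) ℝ → EuclideanSpace ℝ J)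
    (q : Matrix (Fin n) (Fin n) ℝ → ℝ)
    (P : Wd → Matrix (Fin n) (Fin n) ℝ → Matrix (Fin n) (Fin n) ℝ → Prop)
    (z : Wd × (EuclideanSpace ℝ J →L[ℝ] EuclideanSpace ℝ J) × ℝ) : Prop :=
  ∃ y : Matrix (Fin n) (Fin n) ℝ × Matrix (Fin n) (Fin n) ℝ,
    (y.1 * y.2 = 1 ∧ y.2 * y.1 = 1 ∧ P z.1 y.1 y.2) ∧
    (∀ v : EuclideanSpace ℝ J,
      (∀ c : Matrix (Fin n) (Fin n) ℝ × Matrix (Fin n) (Fin n) ℝ, HH q c →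
        inner ℝ (z.2.1 v) (ν (c.1 * y.1)) = 0) ∧
      ∀ u : EuclideanSpace ℝ J,
        (∀ c : Matrix (Fin n) (Fin n) ℝ × Matrix (Fin n) (Fin n) ℝ, HH q c →
          inner ℝ u (ν (c.1 * y.1)) = 0) → inner ℝ (v - z.2.1 v) u = 0) ∧
    (∃ c : Matrix (Fin n) (Fin n) ℝ × Matrix (Fin n) (Fin n) ℝ, HH q c ∧
      nsq (c.1 * y.1) + nsq (y.2 * c.2) = z.2.2) ∧
    ∀ c : Matrix (Fin n) (Fin n) ℝ × Matrix (Fin n) (Fin n) ℝ, HH q c →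
      z.2.2 ≤ nsq (c.1 * y.1) + nsq (y.2 * c.2)

lemma sa_HH {q : Matrix (Fin n) (Fin n) ℝ → ℝ} (hq : PolyMap q) : SA (HH q) := by
  refine SA.and (SA.eq ?_ ?_) (SA.and (SA.eq ?_ ?_) (SA.eq_zero ?_)) <;> fun_prop

lemma sa_rangeP {J : Type} [Fintype J] {ν : Matrix (Fin n) (Fin n) ℝ → EuclideanSpace ℝ J}
    (hν : PolyMap ν) {q : Matrix (Fin n) (Fin n) ℝ → ℝ} (hq : PolyMap q)
    {P : Wd → Matrix (Fin n) (Fin n) ℝ → Matrix (Fin n) (Fin n) ℝ → Prop}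
    (hP : SA (fun z : Wd × Matrix (Fin n) (Fin n) ℝ × Matrix (Fin n) (Fin n) ℝ =>
      P z.1 z.2.1 z.2.2)) : SA (RangeP ν q P) := by
  have hH := sa_HH hq
  unfold RangeP
  refine SA.ex (SA.and (SA.and (SA.eq ?_ ?_) (SA.and (SA.eq ?_ ?_) ?_)) (SA.and ?_ (SA.and ?_ ?_)))
  · fun_prop
  · fun_prop
  · fun_prop
  · fun_prop
  · exact SA.comp hP (g := fun z : (Wd × (EuclideanSpace ℝ J →L[ℝ] EuclideanSpace ℝ J) × ℝ) ×
      Matrix (Fin n) (Fin n) ℝ × Matrix (Fin n) (Fin n) ℝ => (z.1.1, z.2.1, z.2.2)) (by fun_prop)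
  · refine SA.all (SA.and (SA.all (SA.imp (hH.comp ?_) (SA.eq_real ?_ ?_)))
      (SA.all (SA.imp (SA.all (SA.imp (hH.comp ?_) (SA.eq_real ?_ ?_))) (SA.eq_real ?_ ?_)))) <;>
    fun_prop
  · refine SA.ex (SA.and (hH.comp ?_) (SA.eq_real ?_ ?_)) <;> fun_prop
  · refine SA.all (SA.imp (hH.comp ?_) (SA.le ?_ ?_)) <;> fun_prop

set_option maxHeartbeats 1000000 in
theorem quotient_model [FiniteDimensional ℝ Wd] [TopologicalSpace Wd]
    [IsTopologicalAddGroup Wd] [ContinuousSMul ℝ Wd] [T2Space Wd]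
    {q : Matrix (Fin n) (Fin n) ℝ → ℝ} (hq : PolyMap q)
    {H : Subgroup (Matrix (Fin n) (Fin n) ℝ)ˣ}
    (hH : ∀ a : (Matrix (Fin n) (Fin n) ℝ)ˣ, a ∈ H ↔ q a = 0)
    {P : Wd → Matrix (Fin n) (Fin n) ℝ → Matrix (Fin n) (Fin n) ℝ → Prop}
    (hP : SA (fun z : Wd × Matrix (Fin n) (Fin n) ℝ × Matrix (Fin n) (Fin n) ℝ =>
      P z.1 z.2.1 z.2.2))
    (hcl : IsClosed {z : Wd × (Matrix (Fin n) (Fin n) ℝ)ˣ | P z.1 z.2 (↑(z.2⁻¹))})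
    (hinv : ∀ g (L a : (Matrix (Fin n) (Fin n) ℝ)ˣ), a ∈ H → P g L (↑(L⁻¹)) →
      P g (↑(a * L)) (↑((a * L)⁻¹))) :
    ∃ (N : ℕ) (S : Set (Fin N → ℝ)), IsSemialgebraicSet S ∧
      ∃ Ψ : {z : Wd × (Matrix (Fin n) (Fin n) ℝ)ˣ | P z.1 z.2 (↑(z.2⁻¹))} → S,
        IsQuotientMap Ψ ∧ ∀ x y, Ψ x = Ψ y ↔ x.1.1 = y.1.1 ∧ y.1.2 * x.1.2⁻¹ ∈ H := by
  obtain ⟨J, i1, ν, hν, hF, hFH⟩ := exists_F (polyMap_real.1 hq) hH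
  have hHcl : IsClosed (H : Set (Matrix (Fin n) (Fin n) ℝ)ˣ) := by
    have : (H : Set (Matrix (Fin n) (Fin n) ℝ)ˣ) =
        (fun a : (Matrix (Fin n) (Fin n) ℝ)ˣ => q a) ⁻¹' {0} := by
      ext a; exact hH a
    rw [this]
    exact isClosed_singleton.preimage (hq.continuous'.comp Units.continuous_val)
  obtain ⟨φ, hφc, hφ1, hφ2⟩ := exists_phi hHcl
  have hφH : ∀ L a, a ∈ H → φ (a * L) = φ L := by
    intro L a ha
    obtain ⟨b, hb, hb2⟩ := hφ1 L
    obtain ⟨c, hc, hc2⟩ := hφ1 (a * L)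
    apply le_antisymm
    · have := hφ2 (a * L) (b * a⁻¹) (H.mul_mem hb (H.inv_mem ha))
      rwa [mul_assoc, inv_mul_cancel_left, hb2] at this
    · have := hφ2 L (c * a) (H.mul_mem hc ha)
      rwa [mul_assoc, hc2] at this
  have hHH : ∀ a ∈ H, HH q ((a : Matrix (Fin n) (Fin n) ℝ), (↑(a⁻¹) : Matrix (Fin n) (Fin n) ℝ)) :=
    fun a ha => ⟨a.mul_inv, a.inv_mul, (hH a).1 ha⟩
  have hHH2 : ∀ c, HH q c → ∃ a ∈ H, c = ((a : Matrix (Fin n) (Fin n) ℝ), ↑(a⁻¹)) := by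
    rintro ⟨a, a'⟩ ⟨h1, h2, h3⟩
    exact ⟨⟨a, a', h1, h2⟩, (hH _).2 h3, rfl⟩
  let Ψ0 : {z : Wd × (Matrix (Fin n) (Fin n) ℝ)ˣ | P z.1 z.2 (↑(z.2⁻¹))} →
      Wd × (EuclideanSpace ℝ J →L[ℝ] EuclideanSpace ℝ J) × ℝ :=
    fun z => (z.1.1, (Wsub ν H z.1.2).starProjection, φ z.1.2)
  have hpsi : ∀ a L : (Matrix (Fin n) (Fin n) ℝ)ˣ, psi (a * L) =
      nsq ((a : Matrix (Fin n) (Fin n) ℝ) * (L : Matrix (Fin n) (Fin n) ℝ)) +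
      nsq ((↑(L⁻¹) : Matrix (Fin n) (Fin n) ℝ) * (↑(a⁻¹) : Matrix (Fin n) (Fin n) ℝ)) := by
    intro a L
    rw [psi, mul_inv_rev, Units.val_mul, Units.val_mul]
  have hr1 : ∀ z, RangeP ν q P (Ψ0 z) := by
    rintro ⟨⟨g, L⟩, hz⟩
    refine ⟨(L, ↑(L⁻¹)), ⟨L.mul_inv, L.inv_mul, hz⟩, fun v => ⟨?_, ?_⟩, ?_, ?_⟩
    · intro c hc
      obtain ⟨a, ha, rfl⟩ := hHH2 c hc
      exact (isPr_star (Wsub ν H L) v).1 a ha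
    · intro u hu
      exact (isPr_star (Wsub ν H L) v).2 u fun a ha => hu _ (hHH a ha)
    · obtain ⟨a, ha, h⟩ := hφ1 L
      refine ⟨_, hHH a ha, ?_⟩
      rw [← hpsi, h]
    · intro c hc
      obtain ⟨a, ha, rfl⟩ := hHH2 c hc
      rw [← hpsi]
      exact hφ2 L a ha
  have hr2 : ∀ w, RangeP ν q P w → ∃ z, Ψ0 z = w ∧ psi z.1.2 = φ z.1.2 := by
    rintro ⟨g, F, r⟩ ⟨⟨l, l'⟩, ⟨h1, h2, h3⟩, h4, h5, h6⟩
    let L : (Matrix (Fin n) (Fin n) ℝ)ˣ := ⟨l, l', h1, h2⟩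
    have hFL : F = (Wsub ν H L).starProjection := by
      apply isPr_unique
      intro v
      refine ⟨fun a ha => (h4 v).1 _ (hHH a ha), fun u hu => (h4 v).2 u fun c hc => ?_⟩
      obtain ⟨a, ha, rfl⟩ := hHH2 c hc
      exact hu a ha
    have hr : r = φ L := by
      obtain ⟨c, hc, hcr⟩ := h5
      obtain ⟨a, ha, rfl⟩ := hHH2 c hc
      obtain ⟨b, hb, hb2⟩ := hφ1 L
      apply le_antisymm
      · have := h6 _ (hHH b hb)
        rw [← hb2, hpsi]
        exact this
      · have := hφ2 L a ha
        rw [hpsi] at this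
        exact this.trans hcr.le
    obtain ⟨a, ha, hamin⟩ := hφ1 L
    refine ⟨⟨(g, a * L), hinv g L a ha h3⟩, ?_, ?_⟩
    · show (g, (Wsub ν H (a * L)).starProjection, φ (a * L)) = (g, F, r)
      rw [hφH L a ha, hr, hFL]
      have := (hFH L (a * L)).2 (by rwa [mul_inv_cancel_right])
      rw [this]
    · show psi (a * L) = φ (a * L)
      rw [hφH L a ha, hamin]
  obtain ⟨N, S, hS, ⟨e⟩⟩ := SA.exists_homeo (sa_rangeP hν hq hP)
  refine ⟨N, S, hS, fun z => e ⟨Ψ0 z, hr1 z⟩, ?_, ?_⟩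
  · have hΨc : Continuous (fun z => (⟨Ψ0 z, hr1 z⟩ : {x | RangeP ν q P x})) := by
      refine Continuous.subtype_mk ?_ _
      refine (continuous_fst.comp continuous_subtype_val).prodMk (Continuous.prodMk ?_ ?_)
      · exact hF.comp (continuous_snd.comp continuous_subtype_val)
      · exact hφc.comp (continuous_snd.comp continuous_subtype_val)
    refine e.isQuotientMap.comp ?_
    choose σ hσ1 hσ2 using hr2
    refine isQuotientMap_of_section hΨc (fun w => σ w.1 w.2) (fun w => Subtype.ext (hσ1 _ _)) ?_
    intro U s hU
    have hg : Tendsto (fun w : {x | RangeP ν q P x} => (σ w.1 w.2).1.1) U (𝓝 s.1.1) := by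
      have h1 : ∀ w : {x | RangeP ν q P x}, (σ w.1 w.2).1.1 = w.1.1 := fun w =>
        congrArg Prod.fst (hσ1 w.1 w.2)
      simp only [h1]
      exact ((continuous_fst.comp continuous_subtype_val).tendsto s).mono_left hU
    have hψ : ∀ w : {x | RangeP ν q P x}, psi (σ w.1 w.2).1.2 = w.1.2.2 := fun w => by
      rw [hσ2]
      exact congrArg (fun x => x.2.2) (hσ1 w.1 w.2)
    have hbd : ∀ᶠ w : {x | RangeP ν q P x} in (U : Filter _), (σ w.1 w.2).1.2 ∈
        {L : (Matrix (Fin n) (Fin n) ℝ)ˣ | psi L ≤ s.1.2.2 + 1} := by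
      have h1 : Tendsto (fun w : {x | RangeP ν q P x} => w.1.2.2) U (𝓝 s.1.2.2) :=
        ((continuous_snd.comp (continuous_snd.comp continuous_subtype_val)).tendsto s).mono_left hU
      filter_upwards [h1.eventually_lt_const (show s.1.2.2 < s.1.2.2 + 1 by linarith)] with w hw
      show psi _ ≤ _
      rw [hψ]
      exact hw.le
    obtain ⟨L, hL⟩ := ultra_conv U (psi_compact _) hbd
    have hlim := hg.prodMk_nhds hL
    have hmem := hcl.mem_of_tendsto hlim (Eventually.of_forall fun w => (σ w.1 w.2).2)
    refine ⟨⟨_, hmem⟩, ?_⟩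
    rw [tendsto_subtype_rng]
    exact hlim
  · rintro ⟨⟨g, L⟩, hx⟩ ⟨⟨g', L'⟩, hy⟩
    rw [e.injective.eq_iff, Subtype.mk.injEq]
    show (g, (Wsub ν H L).starProjection, φ L) = (g', (Wsub ν H L').starProjection, φ L') ↔ _
    rw [Prod.mk.injEq, Prod.mk.injEq, hFH]
    constructor
    · rintro ⟨h1, h2, -⟩
      exact ⟨h1, h2⟩
    · rintro ⟨h1, h2⟩
      refine ⟨h1, h2, ?_⟩
      have := hφH L _ h2
      rw [inv_mul_cancel_right] at this
      exact this.symm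

end Q

end

section
open Matrix

section Mat
variable {n : ℕ}

/-- the last basis vector -/
def e0 (n : ℕ) : Fin n ⊕ Unit → ℝ := Pi.single (Sum.inr ()) 1

/-- the vector `(v,1)` -/
def hv (y : Fin n → ℝ) : Fin n ⊕ Unit → ℝ := Sum.elim y 1

/-- the block matrix `diag(L,1)` -/
def hm (L : Matrix (Fin n) (Fin n) ℝ) : Matrix (Fin n ⊕ Unit) (Fin n ⊕ Unit) ℝ :=
  fromBlocks L 0 0 1

lemma hm_mul (L M : Matrix (Fin n) (Fin n) ℝ) : hm (L * M) = hm L * hm M := by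
  simp [hm, fromBlocks_multiply]

lemma hm_one : hm (1 : Matrix (Fin n) (Fin n) ℝ) = 1 := fromBlocks_one

lemma hm_mulVec_hv (L : Matrix (Fin n) (Fin n) ℝ) (y : Fin n → ℝ) : hm L *ᵥ hv y = hv (L *ᵥ y) := by
  rw [hm, hv, fromBlocks_mulVec]
  simp [hv]

lemma e0_eq : e0 n = hv 0 := by
  funext k
  rcases k with k | k <;> simp [e0, hv]

lemma hm_mulVec_e0 (L : Matrix (Fin n) (Fin n) ℝ) : hm L *ᵥ e0 n = e0 n := by
  rw [e0_eq, hm_mulVec_hv]; simp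

lemma hm_mulVec_inl (L : Matrix (Fin n) (Fin n) ℝ) (y : Fin n → ℝ) :
    hm L *ᵥ (Sum.elim y 0) = Sum.elim (L *ᵥ y) 0 := by
  rw [hm, fromBlocks_mulVec]
  simp

lemma e0_vecMul_hm (L : Matrix (Fin n) (Fin n) ℝ) : e0 n ᵥ* hm L = e0 n := by
  have : e0 n = Sum.elim (0 : Fin n → ℝ) (1 : Unit → ℝ) := e0_eq
  rw [this, hm, vecMul_fromBlocks]
  simp

lemma hm_inj {L M : Matrix (Fin n) (Fin n) ℝ} (h : hm L = hm M) : L = M := by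
  have := congrArg toBlocks₁₁ h
  simpa [hm] using this

/-- linear part of `hm` -/
lemma polyMap_hm : PolyMap (hm : Matrix (Fin n) (Fin n) ℝ → _) := by
  have : (hm : Matrix (Fin n) (Fin n) ℝ → _) = fun L =>
      (LinearMap.mk (AddHom.mk (fun L : Matrix (Fin n) (Fin n) ℝ =>
        (fromBlocks L 0 0 0 : Matrix (Fin n ⊕ Unit) (Fin n ⊕ Unit) ℝ))
        (fun a b => by simp [fromBlocks_add])) (fun c a => by simp [fromBlocks_smul]) :
        Matrix (Fin n) (Fin n) ℝ →ₗ[ℝ] Matrix (Fin n ⊕ Unit) (Fin n ⊕ Unit) ℝ) L +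
        fromBlocks 0 0 0 1 := by
    funext L
    show _ = fromBlocks L 0 0 0 + fromBlocks 0 0 0 1
    simp [fromBlocks_add, hm]
  rw [this]
  exact PolyMap.add (LinearMap.polyMap _) (polyMap_const _)

@[fun_prop]
lemma polyMap_hm' {E : Type*} [AddCommGroup E] [Module ℝ E]
    {f : E → Matrix (Fin n) (Fin n) ℝ} (hf : PolyMap f) : PolyMap (fun x => hm (f x)) :=
  PolyMap.comp polyMap_hm hf

variable {V : Type*} [NormedAddCommGroup V] [NormedSpace ℝ V] (b : Module.Basis (Fin n) ℝ V)

/-- basis of `V × ℝ` -/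
noncomputable def BB : Module.Basis (Fin n ⊕ Unit) ℝ (V × ℝ) := b.prod (Module.Basis.singleton Unit ℝ)

lemma BB_repr (v : V) (t : ℝ) : (BB b).equivFun (v, t) = Sum.elim (b.equivFun v) (fun _ => t) := by
  funext k
  rcases k with k | k <;> simp [BB]

/-- matrix of an affine transformation -/
noncomputable def mat : (V ≃ᵃ[ℝ] V) →* Matrix (Fin n ⊕ Unit) (Fin n ⊕ Unit) ℝ :=
  (MonoidHomClass.toMonoidHom (LinearMap.toMatrixAlgEquiv (BB b))).comp affToLinHom

lemma mat_apply (g : V ≃ᵃ[ℝ] V) : mat b g = LinearMap.toMatrixAlgEquiv (BB b) (affToLin g) := rfl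

lemma mat_inj {g h : V ≃ᵃ[ℝ] V} (e : mat b g = mat b h) : g = h :=
  affToLin_inj ((LinearMap.toMatrixAlgEquiv (BB b)).injective e)

lemma mat_mulVec (g : V ≃ᵃ[ℝ] V) (x : V × ℝ) :
    mat b g *ᵥ (BB b).equivFun x = (BB b).equivFun (affToLin g x) :=
  LinearMap.toMatrix_mulVec_repr (BB b) (BB b) (affToLin g) x

lemma mat_hv (g : V ≃ᵃ[ℝ] V) (v : V) : mat b g *ᵥ hv (b.equivFun v) = hv (b.equivFun (g v)) := by
  have := mat_mulVec b g (v, 1)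
  rwa [affToLin_one_apply, BB_repr, BB_repr] at this

lemma mat_row (g : V ≃ᵃ[ℝ] V) : e0 n ᵥ* mat b g = e0 n := by
  funext k
  have h := mat_mulVec b g (BB b k)
  have h2 := congrFun h (Sum.inr ())
  have h3 : (BB b).equivFun (BB b k) = Pi.single k 1 := by
    funext j
    rw [Module.Basis.equivFun_self, Pi.single_apply]
    simp [eq_comm]
  have h4 : (BB b).equivFun (affToLin g (BB b k)) (Sum.inr ()) = (BB b k).2 := by
    have := BB_repr b (affToLin g (BB b k)).1 (affToLin g (BB b k)).2
    rw [Prod.mk.eta] at this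
    rw [this]; rfl
  rw [h3, h4] at h2
  rw [mulVec_single_one] at h2
  rw [e0, single_one_vecMul]
  refine h2.trans ?_
  rcases k with k | k <;> simp [BB]

lemma mat_ext_row {M M' : Matrix (Fin n ⊕ Unit) (Fin n ⊕ Unit) ℝ}
    (h : ∀ y, M *ᵥ hv y = M' *ᵥ hv y) : M = M' := by
  have h0 : M *ᵥ e0 n = M' *ᵥ e0 n := by rw [e0_eq]; exact h 0
  have h1 : ∀ i : Fin n, M *ᵥ (Pi.single (Sum.inl i) 1) = M' *ᵥ (Pi.single (Sum.inl i) 1) := by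
    intro i
    have : (Pi.single (Sum.inl i) 1 : Fin n ⊕ Unit → ℝ) = hv (Pi.single i 1) - e0 n := by
      funext k
      rcases k with k | k <;> simp [hv, e0, Pi.single_apply]
    rw [this, mulVec_sub, mulVec_sub, h, h0]
  ext j k
  rcases k with k | k
  · have := congrFun (h1 k) j
    simpa using this
  · have := congrFun h0 j
    simpa [e0] using this

/-- linear part embedding of `GL_n` in the affine group -/
noncomputable def glAff : (Matrix (Fin n) (Fin n) ℝ)ˣ →* (V ≃ᵃ[ℝ] V) where
  toFun a := (LinearEquiv.ofLinearMap (Matrix.toLin b b a)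
    (Matrix.toLin b b (↑(a⁻¹) : Matrix (Fin n) (Fin n) ℝ))
    (by rw [← Matrix.toLin_mul, a.mul_inv, Matrix.toLin_one])
    (by rw [← Matrix.toLin_mul, a.inv_mul, Matrix.toLin_one])).toAffineEquiv
  map_one' := by
    ext v
    show Matrix.toLin b b _ v = v
    rw [Units.val_one, Matrix.toLin_one]; rfl
  map_mul' x y := by
    ext v
    show Matrix.toLin b b _ v = Matrix.toLin b b _ (Matrix.toLin b b _ v)
    rw [Units.val_mul, Matrix.toLin_mul b b b]; rfl

lemma glAff_apply (a : (Matrix (Fin n) (Fin n) ℝ)ˣ) (v : V) :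
    glAff b a v = Matrix.toLin b b a v := rfl

lemma mat_glAff (a : (Matrix (Fin n) (Fin n) ℝ)ˣ) : mat b (glAff b a) = hm (a : Matrix _ _ ℝ) := by
  apply mat_ext_row
  intro y
  have := mat_hv b (glAff b a) (b.equivFun.symm y)
  rw [LinearEquiv.apply_symm_apply] at this
  rw [this, hm_mulVec_hv, glAff_apply]
  congr 1
  have h2 := LinearMap.toMatrix_mulVec_repr b b (Matrix.toLin b b a) (b.equivFun.symm y)
  rw [LinearMap.toMatrix_toLin] at h2
  have h3 : ⇑(b.repr (b.equivFun.symm y)) = y := b.equivFun.apply_symm_apply y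
  rw [h3] at h2
  exact h2.symm

lemma aff_fix {g : V ≃ᵃ[ℝ] V} (h : g 0 = 0) :
    ∃ a : (Matrix (Fin n) (Fin n) ℝ)ˣ, g = glAff b a := by
  let l := g.linear
  refine ⟨⟨LinearMap.toMatrix b b l.toLinearMap, LinearMap.toMatrix b b l.symm.toLinearMap, ?_, ?_⟩, ?_⟩
  · rw [← LinearMap.toMatrix_comp b b b]; simp
  · rw [← LinearMap.toMatrix_comp b b b]; simp
  · ext v
    rw [glAff_apply, aff_eq, h, add_zero]
    show _ = Matrix.toLin b b (LinearMap.toMatrix b b l.toLinearMap) v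
    rw [Matrix.toLin_toMatrix]; rfl

/-- every affine-shaped invertible matrix comes from an affine map -/
lemma exists_aff {M M' : Matrix (Fin n ⊕ Unit) (Fin n ⊕ Unit) ℝ} (h : M * M' = 1)
    (hr : e0 n ᵥ* M = e0 n) : ∃ g : V ≃ᵃ[ℝ] V, mat b g = M := by
  have hr' : e0 n ᵥ* M' = e0 n := by
    calc e0 n ᵥ* M' = (e0 n ᵥ* M) ᵥ* M' := by rw [hr]
      _ = e0 n := by rw [vecMul_vecMul, h, vecMul_one]
  have hshape : ∀ M : Matrix (Fin n ⊕ Unit) (Fin n ⊕ Unit) ℝ, e0 n ᵥ* M = e0 n →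
      M = fromBlocks M.toBlocks₁₁ M.toBlocks₁₂ 0 1 := by
    intro M hM
    rw [e0, single_one_vecMul] at hM
    conv_lhs => rw [← fromBlocks_toBlocks M]
    congr 1
    · ext i j
      exact (congrFun hM (Sum.inl j)).trans (by simp)
    · ext i j
      exact (congrFun hM (Sum.inr j)).trans (by simp)
  have h11 : M.toBlocks₁₁ * M'.toBlocks₁₁ = 1 := by
    rw [hshape M hr, hshape M' hr', fromBlocks_multiply] at h
    have := congrArg toBlocks₁₁ h
    rw [toBlocks_fromBlocks₁₁, Matrix.mul_zero, add_zero] at this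
    rw [this, ← fromBlocks_one, toBlocks_fromBlocks₁₁]
  let a : (Matrix (Fin n) (Fin n) ℝ)ˣ := ⟨_, _, h11, mul_eq_one_comm.1 h11⟩
  let w : V := b.equivFun.symm (fun i => M (Sum.inl i) (Sum.inr ()))
  refine ⟨AffineEquiv.constVAdd ℝ V w * glAff b a, ?_⟩
  apply mat_ext_row
  intro y
  have := mat_hv b (AffineEquiv.constVAdd ℝ V w * glAff b a) (b.equivFun.symm y)
  rw [LinearEquiv.apply_symm_apply] at this
  rw [this]
  have h2 : (AffineEquiv.constVAdd ℝ V w * glAff b a) (b.equivFun.symm y) =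
      w + glAff b a (b.equivFun.symm y) := rfl
  have h3 := mat_hv b (glAff b a) (b.equivFun.symm y)
  rw [LinearEquiv.apply_symm_apply, mat_glAff, hm_mulVec_hv] at h3
  have h4 : b.equivFun (glAff b a (b.equivFun.symm y)) = a.1 *ᵥ y := by
    funext i
    exact (congrFun h3 (Sum.inl i)).symm
  rw [h2, map_add, h4, LinearEquiv.apply_symm_apply]
  rw [hshape M hr, hv, hv, fromBlocks_mulVec]
  funext k
  rcases k with k | k
  · simp [a, mulVec, dotProduct, toBlocks₁₂, toBlocks₁₁, add_comm]
  · simp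

end Mat

end

section
open Matrix Polynomial

section PolyAux
variable {E : Type*} [AddCommGroup E] [Module ℝ E]

@[fun_prop]
lemma PolyMap.aeval' {R : Type*} [Ring R] [Algebra ℝ R] [FiniteDimensional ℝ R] {f : E → R}
    (hf : PolyMap f) (p : ℝ[X]) : PolyMap (fun x => aeval (f x) p) := by
  have : (fun x => aeval (f x) p) = fun x => ∑ i ∈ Finset.range (p.natDegree + 1),
      p.coeff i • f x ^ i := by
    funext x
    rw [aeval_eq_sum_range]
  rw [this]
  exact PolyMap.sum _ fun i => (hf.pow i).const_smul _

@[fun_prop]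
lemma PolyMap.mulVec' {ι κ : Type*} [Fintype ι] [Fintype κ] {f : E → Matrix ι κ ℝ} {g : E → κ → ℝ}
    (hf : PolyMap f) (hg : PolyMap g) : PolyMap (fun x => f x *ᵥ g x) :=
  PolyMap.bilin (Matrix.mulVecBilin ℝ ℝ) hf hg

@[fun_prop]
lemma PolyMap.vecMul' {ι κ : Type*} [Fintype ι] [Fintype κ] {f : E → Matrix ι κ ℝ} (v : ι → ℝ)
    (hf : PolyMap f) : PolyMap (fun x => v ᵥ* f x) := by
  have := PolyMap.linear ((Matrix.vecMulBilin ℝ ℝ) v) hf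
  exact this

lemma PolyMap.comb' {n : ℕ} {R : Type*} [Ring R] [Algebra ℝ R] {N : Fin n → E → R} {t : E → Fin n → ℝ}
    (hN : ∀ i, PolyMap (N i)) (ht : PolyMap t) : PolyMap (fun x => comb (fun i => N i x) (t x)) := by
  unfold comb
  exact PolyMap.sum _ fun i => PolyMap.smul
    (PolyMap.comp (PolyMap.apply (F := fun _ => ℝ) i) ht) (hN i)

end PolyAux

section Normal
variable {n : ℕ}

/-- normalised nilpotent data -/
structure NData (N : Fin n → Matrix (Fin n ⊕ Unit) (Fin n ⊕ Unit) ℝ) : Prop where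
  comm : ∀ i j, Commute (N i) (N j)
  nil : ∀ i, IsNilpotent (N i)
  row : ∀ i, e0 n ᵥ* N i = 0
  std : ∀ i, N i *ᵥ e0 n = Pi.single (Sum.inl i) 1

/-- chart -/
noncomputable def sC (N : Fin n → Matrix (Fin n ⊕ Unit) (Fin n ⊕ Unit) ℝ) (y : Fin n → ℝ) : Fin n → ℝ :=
  fun i => (aeval (comb N y) (logP (n + 1)) *ᵥ e0 n) (Sum.inl i)

/-- inverse chart -/
noncomputable def thC (N : Fin n → Matrix (Fin n ⊕ Unit) (Fin n ⊕ Unit) ℝ) (t : Fin n → ℝ) : Fin n → ℝ :=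
  fun i => (nexp (comb N t) *ᵥ e0 n) (Sum.inl i)

lemma e0_last {M : Matrix (Fin n ⊕ Unit) (Fin n ⊕ Unit) ℝ} {c : ℝ} (h : e0 n ᵥ* M = c • e0 n) (u : Unit) :
    (M *ᵥ e0 n) (Sum.inr u) = c := by
  rw [e0, single_one_vecMul] at h
  have := congrFun h (Sum.inr ())
  simp at this
  simpa [e0] using this

lemma vecMul_logP {f : Matrix (Fin n ⊕ Unit) (Fin n ⊕ Unit) ℝ} (h : e0 n ᵥ* f = 0) (c : ℕ) :
    e0 n ᵥ* (aeval f (logP c)) = 0 := by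
  obtain ⟨q, hq⟩ := X_dvd_logP c
  rw [hq, map_mul, aeval_X, ← vecMul_vecMul, h, zero_vecMul]

lemma vecMul_nexp {f : Matrix (Fin n ⊕ Unit) (Fin n ⊕ Unit) ℝ} (h : e0 n ᵥ* f = 0) (hf : IsNilpotent f) :
    e0 n ᵥ* nexp f = e0 n := by
  obtain ⟨u, hu, -⟩ := nexp_sub_one hf
  rw [hu, vecMul_add, ← vecMul_vecMul, h, zero_vecMul, add_zero, vecMul_one]

lemma pow_n1 {f : Matrix (Fin n ⊕ Unit) (Fin n ⊕ Unit) ℝ} (hf : IsNilpotent f) : f ^ (n + 1) = 0 := by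
  have := nilp_pow_card hf
  simpa using this

namespace NData
variable {N : Fin n → Matrix (Fin n ⊕ Unit) (Fin n ⊕ Unit) ℝ} (hN : NData N)

lemma comb_row (hN : NData N) (t : Fin n → ℝ) : e0 n ᵥ* comb N t = 0 := by
  have : e0 n ᵥ* comb N t = ∑ i, t i • (e0 n ᵥ* N i) := by
    rw [comb, vecMul_sum]
    exact Finset.sum_congr rfl fun i _ => vecMul_smul _ _ _
  rw [this]
  simp [hN.row]

lemma comb_e0 (hN : NData N) (t : Fin n → ℝ) : comb N t *ᵥ e0 n = Sum.elim t 0 := by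
  have : comb N t *ᵥ e0 n = ∑ i, t i • (N i *ᵥ e0 n) := by
    rw [comb, sum_mulVec]
    exact Finset.sum_congr rfl fun i _ => smul_mulVec _ _ _
  rw [this]
  funext k
  rcases k with k | k <;> simp [hN.std, Finset.sum_apply, Pi.single_apply]

lemma ker (hN : NData N) {c : Matrix (Fin n ⊕ Unit) (Fin n ⊕ Unit) ℝ} (hc : ∀ i, Commute c (N i))
    (h0 : c *ᵥ e0 n = 0) : c = 0 := by
  have h1 : ∀ i, c *ᵥ (Pi.single (Sum.inl i) 1) = 0 := by
    intro i
    rw [← hN.std i, mulVec_mulVec, hc i, ← mulVec_mulVec, h0, mulVec_zero]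
  ext j k
  rcases k with k | k
  · have := congrFun (h1 k) j
    simpa using this
  · have := congrFun h0 j
    simpa [e0] using this

lemma cnil (hN : NData N) (t : Fin n → ℝ) : IsNilpotent (comb N t) := comb_nil hN.comm hN.nil t

lemma ccomm (hN : NData N) (t : Fin n → ℝ) (i : Fin n) : Commute (comb N t) (N i) :=
  (comb_comm_left (fun j => hN.comm i j) t).symm

lemma commute_nexp {R : Type*} [Ring R] [Algebra ℝ R] {a f : R} (hf : IsNilpotent f)
    (h : Commute a f) : Commute a (nexp f) := by
  obtain ⟨k, hk⟩ := hf
  rw [nexp_eq_sum hk]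
  exact Commute.sum_right _ _ _ fun i _ => (h.pow_right i).smul_right _

lemma nexp_e0 (hN : NData N) (t : Fin n → ℝ) : nexp (comb N t) *ᵥ e0 n = hv (thC N t) := by
  funext k
  rcases k with k | k
  · rfl
  · exact e0_last (c := 1) (by rw [vecMul_nexp (hN.comb_row t) (hN.cnil t), one_smul]) k

lemma nexp_eq (hN : NData N) (t : Fin n → ℝ) : nexp (comb N t) = 1 + comb N (thC N t) := by
  rw [← sub_eq_zero]
  apply hN.ker
  · intro i
    exact ((commute_nexp (hN.cnil t) (hN.ccomm t i).symm).symm).sub_left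
      ((Commute.one_left _).add_left (hN.ccomm _ i))
  · rw [sub_mulVec, add_mulVec, one_mulVec, hN.nexp_e0, hN.comb_e0]
    funext k
    rcases k with k | k <;> simp [hv, e0]

lemma log_eq (hN : NData N) (y : Fin n → ℝ) : aeval (comb N y) (logP (n + 1)) = comb N (sC N y) := by
  rw [← sub_eq_zero]
  apply hN.ker
  · intro i
    exact ((aeval_commute (hN.ccomm y i).symm _).symm).sub_left (hN.ccomm _ i)
  · rw [sub_mulVec, hN.comb_e0]
    funext k
    rcases k with k | k
    · simp [sC]
    · have := e0_last (c := 0) (by rw [vecMul_logP (hN.comb_row y) (n + 1), zero_smul]) k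
      simp [this]

lemma nexp_sC (hN : NData N) (y : Fin n → ℝ) : nexp (comb N (sC N y)) = 1 + comb N y := by
  rw [← hN.log_eq, nexp_logP (pow_n1 (hN.cnil y))]

lemma comb_inj (hN : NData N) {s t : Fin n → ℝ} (h : comb N s = comb N t) : s = t := by
  have := congrArg (fun M => M *ᵥ e0 n) h
  simp only [hN.comb_e0] at this
  funext i
  exact congrFun this (Sum.inl i)

lemma th_s (hN : NData N) (y : Fin n → ℝ) : thC N (sC N y) = y := by
  apply hN.comb_inj
  have := hN.nexp_eq (sC N y)
  rw [hN.nexp_sC] at this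
  exact (add_left_cancel this).symm

lemma s_th (hN : NData N) (t : Fin n → ℝ) : sC N (thC N t) = t := by
  have h1 : nexp (comb N (sC N (thC N t))) = nexp (comb N t) := by
    rw [hN.nexp_sC, hN.nexp_eq]
  have h2 : nexp (comb N (sC N (thC N t) - t)) = 1 := by
    rw [sub_eq_add_neg, nexp_comb_add hN.comm hN.nil, h1, ← nexp_comb_add hN.comm hN.nil,
      add_neg_cancel, comb_zero, nexp_zero]
  set d := sC N (thC N t) - t with hd
  obtain ⟨u, hu, hc⟩ := nexp_sub_one (hN.cnil d)
  rw [h2] at hu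
  have h3 : comb N d * (1 + comb N d * u) = 0 := by simpa using hu.symm
  have h4 : IsUnit (1 + comb N d * u) := (hc.isNilpotent_mul_right (hN.cnil d)).isUnit_one_add
  have h5 : comb N d = 0 := h4.mul_left_eq_zero.1 h3
  have h6 : d = 0 := hN.comb_inj (by rw [h5, comb_zero])
  exact sub_eq_zero.1 h6

lemma polyMap_nexp (hN : NData N) : PolyMap (fun t => nexp (comb N t)) := by
  have : (fun t => nexp (comb N t)) = fun t => ∑ i ∈ Finset.range (n + 1),
      ((i.factorial : ℝ)⁻¹) • comb N t ^ i := by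
    funext t
    rw [nexp_eq_sum (pow_n1 (hN.cnil t))]
  rw [this]
  exact PolyMap.sum _ fun i => ((PolyMap.comb' (fun i => polyMap_const (N i)) polyMap_id).pow i).const_smul _

lemma polyMap_sC : PolyMap (sC N) := by
  apply PolyMap.pi
  intro i
  have : PolyMap (fun y => aeval (comb N y) (logP (n + 1)) *ᵥ e0 n) :=
    PolyMap.mulVec' (PolyMap.aeval' (PolyMap.comb' (fun i => polyMap_const (N i)) polyMap_id) _)
      (polyMap_const _)
  exact PolyMap.comp (PolyMap.apply (F := fun _ => ℝ) (Sum.inl i)) this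

lemma polyMap_thC (hN : NData N) : PolyMap (thC N) := by
  apply PolyMap.pi
  intro i
  have : PolyMap (fun y => nexp (comb N y) *ᵥ e0 n) :=
    PolyMap.mulVec' hN.polyMap_nexp (polyMap_const _)
  exact PolyMap.comp (PolyMap.apply (F := fun _ => ℝ) (Sum.inl i)) this

end NData
end Normal

section chart
variable {n : ℕ} {V : Type*} [NormedAddCommGroup V] [NormedSpace ℝ V]

lemma crystallographic_of_chart (ρ : Multiplicative (Fin n → ℤ) →* (V ≃ᵃ[ℝ] V))
    (c : V ≃ₜ (Fin n → ℝ))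
    (h : ∀ γ v, c (ρ γ v) = (fun i => ((Multiplicative.toAdd γ i : ℤ) : ℝ)) + c v) :
    Function.Injective ρ ∧ IsCrystallographic ρ.range := by
  have hfin : ∀ K : Set V, IsCompact K →
      {γ : Multiplicative (Fin n → ℤ) | ((ρ γ '' K) ∩ K).Nonempty}.Finite := by
    intro K hK
    have hb : Bornology.IsBounded (c '' K) := (hK.image c.continuous).isBounded
    obtain ⟨R, hR⟩ := hb.exists_norm_le
    have : (Set.univ.pi (fun _ : Fin n => Set.Icc (-⌈2 * R⌉) ⌈2 * R⌉)).Finite :=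
      Set.Finite.pi fun i => Set.finite_Icc _ _
    refine (this.preimage (f := Multiplicative.toAdd)
      Multiplicative.toAdd.injective.injOn).subset fun γ hγ => ?_
    obtain ⟨_, ⟨v, hv, rfl⟩, hw⟩ := hγ
    have h1 := hR _ ⟨v, hv, rfl⟩
    have h2 := hR _ ⟨_, hw, rfl⟩
    rw [h] at h2
    intro i _
    have h3 := (norm_le_pi_norm _ i).trans h1
    have h4 := (norm_le_pi_norm _ i).trans h2
    simp only [Pi.add_apply, Real.norm_eq_abs, abs_le] at h3 h4
    have h5 : ((Multiplicative.toAdd γ i : ℤ) : ℝ) ≤ 2 * R := by linarith [h3.1, h4.2]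
    have h6 : -(2 * R) ≤ ((Multiplicative.toAdd γ i : ℤ) : ℝ) := by linarith [h3.2, h4.1]
    constructor
    · have := Int.le_ceil (2 * R)
      have : (-(⌈2 * R⌉ : ℤ) : ℝ) ≤ ((Multiplicative.toAdd γ i : ℤ) : ℝ) := by linarith
      exact_mod_cast this
    · have := Int.le_ceil (2 * R)
      have : ((Multiplicative.toAdd γ i : ℤ) : ℝ) ≤ (⌈2 * R⌉ : ℝ) := by linarith
      exact_mod_cast this
  refine ⟨?_, ?_, ?_⟩
  · intro γ γ' e
    have h1 := h γ (c.symm 0)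
    have h2 := h γ' (c.symm 0)
    rw [e, h2] at h1
    apply Multiplicative.toAdd.injective
    funext i
    have := congrFun (add_right_cancel h1) i
    exact_mod_cast this.symm
  · intro K hK
    refine ((hfin K hK).image ρ).subset ?_
    rintro g ⟨⟨γ, rfl⟩, hg⟩
    exact ⟨γ, hg, rfl⟩
  · have hc : IsCompact (c.symm '' (Set.Icc 0 1)) := isCompact_Icc.image c.symm.continuous
    have h2 := hc.image (f := Quotient.mk (affOrbitSetoid ρ.range)) continuous_quot_mk
    refine ⟨?_⟩
    convert h2
    symm
    rw [Set.eq_univ_iff_forall]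
    intro x
    induction x using Quotient.inductionOn with
    | h v =>
      let γ : Multiplicative (Fin n → ℤ) := Multiplicative.ofAdd (fun i => -⌊c v i⌋)
      refine ⟨ρ γ v, ⟨c (ρ γ v), ?_, c.symm_apply_apply _⟩, ?_⟩
      · rw [h]
        constructor <;> intro i
        · have := Int.floor_le (c v i)
          simpa [γ] using this
        · have := Int.lt_floor_add_one (c v i)
          simp [γ]
          linarith
      · apply Quotient.sound
        refine (affOrbitSetoid ρ.range).symm ?_
        exact ⟨ρ γ, ⟨γ, rfl⟩, rfl⟩

end chart

end

section
open Matrix Polynomial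

section zar
variable {n : ℕ} {V : Type*} [NormedAddCommGroup V] [NormedSpace ℝ V] [FiniteDimensional ℝ V]
  (b : Module.Basis (Fin n) ℝ V)

lemma exists_q {A : Set (V ≃ᵃ[ℝ] V)} (hA : IsZariskiClosedAff A) :
    ∃ q : Matrix (Fin n ⊕ Unit) (Fin n ⊕ Unit) ℝ → ℝ, PolyMap q ∧ ∀ g, g ∈ A ↔ q (mat b g) = 0 := by
  obtain ⟨ι, p, hp⟩ := hA
  obtain ⟨s, hs⟩ := IsNoetherian.noetherian (Ideal.span (Set.range p))
  let ent : Matrix (Fin n ⊕ Unit) (Fin n ⊕ Unit) ℝ →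
      (Fin (Module.finrank ℝ (V × ℝ)) × Fin (Module.finrank ℝ (V × ℝ)) → ℝ) := fun M jk =>
    LinearMap.toMatrix (Module.finBasis ℝ (V × ℝ)) (Module.finBasis ℝ (V × ℝ))
      ((LinearMap.toMatrixAlgEquiv (BB b)).symm M) jk.1 jk.2
  have hent : PolyMap ent := by
    apply PolyMap.pi
    intro jk
    have : PolyMap (fun M => LinearMap.toMatrix (Module.finBasis ℝ (V × ℝ)) (Module.finBasis ℝ (V × ℝ))
      ((LinearMap.toMatrixAlgEquiv (BB b)).symm M)) :=
      LinearMap.polyMap ((LinearMap.toMatrix (Module.finBasis ℝ (V × ℝ))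
        (Module.finBasis ℝ (V × ℝ))).toLinearMap.comp
        (LinearMap.toMatrixAlgEquiv (BB b)).symm.toLinearMap)
    exact PolyMap.linear (Matrix.entryLinearMap ℝ ℝ jk.1 jk.2) this
  have hmat : ∀ g : V ≃ᵃ[ℝ] V, ent (mat b g) = fun jk => affEntry g jk.1 jk.2 := by
    intro g
    funext jk
    show LinearMap.toMatrix _ _ ((LinearMap.toMatrixAlgEquiv (BB b)).symm
      (LinearMap.toMatrixAlgEquiv (BB b) (affToLin g))) _ _ = _
    rw [AlgEquiv.symm_apply_apply]
    rfl
  refine ⟨fun M => ∑ f ∈ s, (MvPolynomial.eval (ent M) f) ^ 2, ?_, ?_⟩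
  · exact PolyMap.sum _ fun f => PolyMap.pow (PolyMap.comp (mvPolynomial_polyMap f) hent) 2
  · intro g
    rw [hp g, Finset.sum_eq_zero_iff_of_nonneg (fun f _ => sq_nonneg _), ← hmat g]
    have key : ∀ T : Set (MvPolynomial _ ℝ), (∀ f ∈ T, MvPolynomial.eval (ent (mat b g)) f = 0) ↔
        Ideal.span T ≤ RingHom.ker (MvPolynomial.eval (ent (mat b g))) := by
      intro T
      rw [Ideal.span_le]
      exact Iff.rfl
    have h1 := key (Set.range p)
    have h2 := key (s : Set _)
    rw [Set.forall_mem_range] at h1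
    rw [h1]
    have hs' : Ideal.span (s : Set (MvPolynomial _ ℝ)) = Ideal.span (Set.range p) := hs
    rw [← hs', ← h2]
    simp

end zar

section top
variable {n : ℕ} {V : Type*} [NormedAddCommGroup V] [NormedSpace ℝ V] [FiniteDimensional ℝ V]
  (b : Module.Basis (Fin n) ℝ V)

lemma continuous_hv : Continuous (hv : (Fin n → ℝ) → _) := by
  apply continuous_pi
  rintro (k | k)
  · exact continuous_apply k
  · exact continuous_const

lemma continuous_aff_apply (v : V) : Continuous (fun g : V ≃ᵃ[ℝ] V => g v) :=
  (continuous_apply v).comp continuous_induced_dom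

lemma continuous_mat : Continuous (mat b) := by
  have hb : Continuous b.equivFun := LinearMap.continuous_of_finiteDimensional b.equivFun.toLinearMap
  have h1 : ∀ v, Continuous (fun g : V ≃ᵃ[ℝ] V => mat b g *ᵥ hv (b.equivFun v)) := by
    intro v
    simp only [mat_hv]
    exact continuous_hv.comp (hb.comp (continuous_aff_apply v))
  have h0 : Continuous (fun g : V ≃ᵃ[ℝ] V => mat b g *ᵥ e0 n) := by
    have := h1 0
    rwa [map_zero, ← e0_eq] at this
  apply continuous_matrix
  intro j k
  rcases k with k | k
  · have h2 : (Pi.single (Sum.inl k) 1 : Fin n ⊕ Unit → ℝ) = hv (b.equivFun (b k)) - e0 n := by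
      funext l
      rcases l with l | l <;> simp [hv, e0, Pi.single_apply, Finsupp.single_apply, eq_comm]
    have h3 : (fun g : V ≃ᵃ[ℝ] V => mat b g j (Sum.inl k)) = fun g =>
        (mat b g *ᵥ hv (b.equivFun (b k)) - mat b g *ᵥ e0 n) j := by
      funext g
      rw [← mulVec_sub, ← h2]
      simp
    rw [h3]
    exact (continuous_apply j).comp ((h1 (b k)).sub h0)
  · have h3 : (fun g : V ≃ᵃ[ℝ] V => mat b g j (Sum.inr k)) = fun g => (mat b g *ᵥ e0 n) j := by
      funext g
      simp [e0]
    rw [h3]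
    exact (continuous_apply j).comp h0

lemma continuous_aff_of_mat {X : Type*} [TopologicalSpace X] {f : X → (V ≃ᵃ[ℝ] V)}
    (h : Continuous (fun x => mat b (f x))) : Continuous f := by
  rw [continuous_induced_rng]
  apply continuous_pi
  intro v
  have hb : Continuous b.equivFun.symm :=
    LinearMap.continuous_of_finiteDimensional b.equivFun.symm.toLinearMap
  have : (fun x => f x v) = fun x => b.equivFun.symm (fun i =>
      (mat b (f x) *ᵥ hv (b.equivFun v)) (Sum.inl i)) := by
    funext x
    rw [mat_hv]
    show _ = b.equivFun.symm (b.equivFun (f x v))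
    rw [LinearEquiv.symm_apply_apply]
  show Continuous (fun x => f x v)
  rw [this]
  have h5 : Continuous (fun x => mat b (f x) *ᵥ hv (b.equivFun v)) :=
    h.matrix_mulVec continuous_const
  exact hb.comp (continuous_pi fun i => (continuous_apply (Sum.inl i)).comp h5)

lemma continuous_hom_of_mat {X Γ : Type*} [Group Γ] [TopologicalSpace X] {f : X → (Γ →* (V ≃ᵃ[ℝ] V))}
    (h : ∀ γ, Continuous (fun x => mat b (f x γ))) : Continuous f := by
  rw [continuous_induced_rng]
  exact continuous_pi fun γ => continuous_aff_of_mat b (h γ)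

lemma continuous_mat_hom {Γ : Type*} [Group Γ] (γ : Γ) :
    Continuous (fun ρ : Γ →* (V ≃ᵃ[ℝ] V) => mat b (ρ γ)) :=
  (continuous_mat b).comp ((continuous_apply γ).comp continuous_induced_dom)

lemma continuous_units_of_val {X : Type*} [TopologicalSpace X] {f : X → (Matrix (Fin n) (Fin n) ℝ)ˣ}
    (h : Continuous (fun x => (f x : Matrix (Fin n) (Fin n) ℝ))) : Continuous f := by
  rw [Units.continuous_iff]
  refine ⟨h, ?_⟩
  have : (fun x => (↑(f x)⁻¹ : Matrix (Fin n) (Fin n) ℝ)) = fun x =>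
      ((f x : Matrix (Fin n) (Fin n) ℝ).det)⁻¹ • (f x : Matrix (Fin n) (Fin n) ℝ).adjugate := by
    funext x
    rw [Matrix.coe_units_inv, Matrix.inv_def, Ring.inverse_eq_inv']
  rw [this]
  refine (h.matrix_det.inv₀ fun x => ?_).smul h.matrix_adjugate
  exact ((Matrix.isUnit_iff_isUnit_det _).1 (f x).isUnit).ne_zero

end top

end

section
open Matrix Polynomial

section rep
variable {n : ℕ}

/-- truncated logarithm -/
noncomputable def lgn (M : Matrix (Fin n ⊕ Unit) (Fin n ⊕ Unit) ℝ) :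
    Matrix (Fin n ⊕ Unit) (Fin n ⊕ Unit) ℝ := aeval (M - 1) (logP (n + 1))

@[fun_prop]
lemma polyMap_lgn {E : Type*} [AddCommGroup E] [Module ℝ E]
    {f : E → Matrix (Fin n ⊕ Unit) (Fin n ⊕ Unit) ℝ} (hf : PolyMap f) :
    PolyMap (fun x => lgn (f x)) := by
  unfold lgn
  exact PolyMap.aeval' (hf.sub (polyMap_const _)) _

/-- normalised unipotent data -/
structure Good (g : Fin n → Matrix (Fin n ⊕ Unit) (Fin n ⊕ Unit) ℝ) : Prop where
  row : ∀ i, e0 n ᵥ* g i = e0 n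
  comm : ∀ i j, g i * g j = g j * g i
  uni : ∀ i, (g i - 1) ^ (n + 1) = 0
  std : ∀ i, lgn (g i) *ᵥ e0 n = Pi.single (Sum.inl i) 1

lemma Good.nd {g : Fin n → Matrix (Fin n ⊕ Unit) (Fin n ⊕ Unit) ℝ} (h : Good g) :
    NData (fun i => lgn (g i)) where
  comm i j := by
    have h1 : Commute (g i - 1) (g j - 1) :=
      (Commute.sub_left (h.comm i j) (Commute.one_left _)).sub_right (Commute.one_right _)
    exact aeval_commute (aeval_commute h1.symm _).symm _
  nil i := ⟨n + 1, logP_nil (h.uni i)⟩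
  row i := vecMul_logP (by rw [vecMul_sub, h.row, vecMul_one, sub_self]) _
  std i := h.std i

lemma Good.nexp_lgn {g : Fin n → Matrix (Fin n ⊕ Unit) (Fin n ⊕ Unit) ℝ} (h : Good g) (i : Fin n) :
    nexp (lgn (g i)) = g i := by
  rw [lgn, nexp_logP (h.uni i)]; abel

lemma hm_units_mul (L : (Matrix (Fin n) (Fin n) ℝ)ˣ) :
    hm (L : Matrix (Fin n) (Fin n) ℝ) * hm (↑(L⁻¹) : Matrix (Fin n) (Fin n) ℝ) = 1 := by
  rw [← hm_mul, L.mul_inv, hm_one]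

lemma hm_units_mul' (L : (Matrix (Fin n) (Fin n) ℝ)ˣ) :
    hm (↑(L⁻¹) : Matrix (Fin n) (Fin n) ℝ) * hm (L : Matrix (Fin n) (Fin n) ℝ) = 1 := by
  rw [← hm_mul, L.inv_mul, hm_one]

/-- conjugation by `hm L` as an algebra automorphism -/
noncomputable def cj (L : (Matrix (Fin n) (Fin n) ℝ)ˣ) :
    Matrix (Fin n ⊕ Unit) (Fin n ⊕ Unit) ℝ →ₐ[ℝ] Matrix (Fin n ⊕ Unit) (Fin n ⊕ Unit) ℝ :=
  AlgHom.ofLinearMap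
    (((LinearMap.mulRight ℝ (hm (↑(L⁻¹) : Matrix (Fin n) (Fin n) ℝ))).comp
      (LinearMap.mulLeft ℝ (hm (L : Matrix (Fin n) (Fin n) ℝ)))))
    (by
      show hm (L : Matrix (Fin n) (Fin n) ℝ) * 1 * hm (↑(L⁻¹) : Matrix (Fin n) (Fin n) ℝ) = 1
      rw [mul_one, hm_units_mul])
    (by
      intro x y
      show hm (L : Matrix (Fin n) (Fin n) ℝ) * (x * y) * hm (↑(L⁻¹) : Matrix (Fin n) (Fin n) ℝ) =
        (hm (L : Matrix (Fin n) (Fin n) ℝ) * x * hm (↑(L⁻¹) : Matrix (Fin n) (Fin n) ℝ)) *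
        (hm (L : Matrix (Fin n) (Fin n) ℝ) * y * hm (↑(L⁻¹) : Matrix (Fin n) (Fin n) ℝ))
      have := hm_units_mul' L
      calc _ = hm (L : Matrix (Fin n) (Fin n) ℝ) * x * 1 * y *
            hm (↑(L⁻¹) : Matrix (Fin n) (Fin n) ℝ) := by noncomm_ring
        _ = _ := by rw [← this]; noncomm_ring)

lemma cj_apply (L : (Matrix (Fin n) (Fin n) ℝ)ˣ) (x : Matrix (Fin n ⊕ Unit) (Fin n ⊕ Unit) ℝ) :
    cj L x = hm (L : Matrix (Fin n) (Fin n) ℝ) * x * hm (↑(L⁻¹) : Matrix (Fin n) (Fin n) ℝ) := rfl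

lemma cj_mul (L M : (Matrix (Fin n) (Fin n) ℝ)ˣ) (x : Matrix (Fin n ⊕ Unit) (Fin n ⊕ Unit) ℝ) :
    cj (L * M) x = cj L (cj M x) := by
  simp only [cj_apply, _root_.mul_inv_rev, Units.val_mul, hm_mul, mul_assoc]

lemma cj_one (x : Matrix (Fin n ⊕ Unit) (Fin n ⊕ Unit) ℝ) : cj 1 x = x := by
  simp [cj_apply, hm_one]

lemma cj_inv_cj (L : (Matrix (Fin n) (Fin n) ℝ)ˣ) (x : Matrix (Fin n ⊕ Unit) (Fin n ⊕ Unit) ℝ) :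
    cj L⁻¹ (cj L x) = x := by
  rw [← cj_mul, inv_mul_cancel, cj_one]

lemma cj_cj_inv (L : (Matrix (Fin n) (Fin n) ℝ)ˣ) (x : Matrix (Fin n ⊕ Unit) (Fin n ⊕ Unit) ℝ) :
    cj L (cj L⁻¹ x) = x := by
  rw [← cj_mul, mul_inv_cancel, cj_one]

lemma cj_row (L : (Matrix (Fin n) (Fin n) ℝ)ˣ) {x : Matrix (Fin n ⊕ Unit) (Fin n ⊕ Unit) ℝ}
    (h : e0 n ᵥ* x = e0 n) : e0 n ᵥ* cj L x = e0 n := by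
  rw [cj_apply, ← vecMul_vecMul, ← vecMul_vecMul, e0_vecMul_hm, h, e0_vecMul_hm]

lemma lgn_cj (L : (Matrix (Fin n) (Fin n) ℝ)ˣ) (x : Matrix (Fin n ⊕ Unit) (Fin n ⊕ Unit) ℝ) :
    lgn (cj L x) = cj L (lgn x) := by
  rw [lgn, lgn, ← aeval_algHom_apply, map_sub, map_one]

lemma cj_e0 (L : (Matrix (Fin n) (Fin n) ℝ)ˣ) (x : Matrix (Fin n ⊕ Unit) (Fin n ⊕ Unit) ℝ) :
    cj L x *ᵥ e0 n = hm (L : Matrix (Fin n) (Fin n) ℝ) *ᵥ (x *ᵥ e0 n) := by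
  rw [cj_apply, ← mulVec_mulVec, ← mulVec_mulVec, hm_mulVec_e0]

/-- the matrix whose columns are the translation parts of the logarithms -/
noncomputable def Lmat (m : Fin n → Matrix (Fin n ⊕ Unit) (Fin n ⊕ Unit) ℝ) :
    Matrix (Fin n) (Fin n) ℝ :=
  Matrix.of fun j i => (lgn (m i) *ᵥ e0 n) (Sum.inl j)

lemma Good.Lmat_eq {g : Fin n → Matrix (Fin n ⊕ Unit) (Fin n ⊕ Unit) ℝ} (h : Good g)
    (L : (Matrix (Fin n) (Fin n) ℝ)ˣ) : Lmat (fun i => cj L (g i)) = L := by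
  ext j i
  have h1 : (Pi.single (Sum.inl i) 1 : Fin n ⊕ Unit → ℝ) = Sum.elim (Pi.single i 1) 0 := by
    funext k
    rcases k with k | k <;> simp [Pi.single_apply]
  show (lgn (cj L (g i)) *ᵥ e0 n) (Sum.inl j) = _
  rw [lgn_cj, cj_e0, h.std, h1, hm_mulVec_inl]
  simp

lemma exists_good {m : Fin n → Matrix (Fin n ⊕ Unit) (Fin n ⊕ Unit) ℝ}
    (row : ∀ i, e0 n ᵥ* m i = e0 n) (comm : ∀ i j, m i * m j = m j * m i)
    (uni : ∀ i, (m i - 1) ^ (n + 1) = 0)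
    (ind : ∀ t, comb (fun i => lgn (m i)) t *ᵥ e0 n = 0 → t = 0) :
    ∃ L : (Matrix (Fin n) (Fin n) ℝ)ˣ, (L : Matrix (Fin n) (Fin n) ℝ) = Lmat m ∧
      Good (fun i => cj L⁻¹ (m i)) := by
  have hcol : ∀ i, lgn (m i) *ᵥ e0 n = Sum.elim (fun j => Lmat m j i) 0 := by
    intro i
    funext k
    rcases k with k | k
    · rfl
    · refine e0_last (c := 0) ?_ k
      rw [zero_smul]
      exact vecMul_logP (by rw [vecMul_sub, row, vecMul_one, sub_self]) _
  have hker : ∀ t, Lmat m *ᵥ t = 0 → t = 0 := by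
    intro t ht
    apply ind
    have : comb (fun i => lgn (m i)) t *ᵥ e0 n = ∑ i, t i • (lgn (m i) *ᵥ e0 n) := by
      rw [comb, sum_mulVec]
      exact Finset.sum_congr rfl fun i _ => smul_mulVec _ _ _
    rw [this]
    funext k
    rcases k with k | k
    · have := congrFun ht k
      simp only [mulVec, dotProduct] at this
      simp only [hcol, Finset.sum_apply, Pi.smul_apply, Sum.elim_inl, smul_eq_mul, Pi.zero_apply]
      refine Eq.trans ?_ this
      exact Finset.sum_congr rfl fun i _ => mul_comm _ _
    · simp [hcol, Finset.sum_apply]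
  have hunit : IsUnit (Lmat m) := by
    rw [← Matrix.mulVec_injective_iff_isUnit]
    intro s t hst
    have := hker (s - t) (by rw [mulVec_sub]; exact sub_eq_zero.2 hst)
    exact sub_eq_zero.1 this
  obtain ⟨L, hL⟩ := hunit
  refine ⟨L, hL, ?_, ?_, ?_, ?_⟩
  · exact fun i => cj_row _ (row i)
  · intro i j
    rw [← map_mul, ← map_mul, comm]
  · intro i
    have : cj L⁻¹ (m i) - 1 = cj L⁻¹ (m i - 1) := by rw [map_sub, map_one]
    rw [this, ← map_pow, uni, map_zero]
  · intro i
    have h2 : (fun j => Lmat m j i) = L.1 *ᵥ Pi.single i 1 := by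
      rw [hL]; funext j; simp
    rw [lgn_cj, cj_e0, hcol, hm_mulVec_inl, h2, mulVec_mulVec, L.inv_mul, one_mulVec]
    funext k
    rcases k with k | k <;> simp [Pi.single_apply]

variable {V : Type*} [NormedAddCommGroup V] [NormedSpace ℝ V]
  (b : Module.Basis (Fin n) ℝ V)

/-- affine map with prescribed matrix -/
lemma exists_aff_nexp {g : Fin n → Matrix (Fin n ⊕ Unit) (Fin n ⊕ Unit) ℝ} (h : Good g)
    (L : (Matrix (Fin n) (Fin n) ℝ)ˣ) (t : Fin n → ℝ) :
    ∃ a : V ≃ᵃ[ℝ] V, mat b a = cj L (nexp (comb (fun i => lgn (g i)) t)) := by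
  refine exists_aff b (M' := cj L (nexp (- comb (fun i => lgn (g i)) t))) ?_ ?_
  · rw [← map_mul, nexp_mul_neg (h.nd.cnil t), map_one]
  · exact cj_row _ (vecMul_nexp (h.nd.comb_row t) (h.nd.cnil t))

/-- the homomorphism associated with normalised data -/
lemma exists_rep_hom {g : Fin n → Matrix (Fin n ⊕ Unit) (Fin n ⊕ Unit) ℝ} (h : Good g)
    (L : (Matrix (Fin n) (Fin n) ℝ)ˣ) :
    ∃ ρ : Multiplicative (Fin n → ℤ) →* (V ≃ᵃ[ℝ] V), ∀ γ, mat b (ρ γ) =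
      cj L (nexp (comb (fun i => lgn (g i)) (fun i => ((Multiplicative.toAdd γ i : ℤ) : ℝ)))) := by
  choose f hf using fun t => exists_aff_nexp b h L t
  let φ := expHom _ h.nd.comm h.nd.nil
  refine ⟨⟨⟨fun γ => f (fun i => ((Multiplicative.toAdd γ i : ℤ) : ℝ)), ?_⟩, ?_⟩, fun γ => hf _⟩
  · apply mat_inj b
    have := map_one φ
    rw [expHom_apply] at this
    rw [hf, this, map_one (cj L), map_one (mat b)]
  · intro x y
    apply mat_inj b
    show mat b (f _) = mat b (f _ * f _)
    have := map_mul φ x y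
    simp only [φ, expHom_apply] at this
    rw [map_mul (mat b), hf, hf, hf, ← map_mul (cj L), ← this]

lemma rep_gen {g : Fin n → Matrix (Fin n ⊕ Unit) (Fin n ⊕ Unit) ℝ} (h : Good g)
    (i : Fin n) : nexp (comb (fun i => lgn (g i)) (fun j =>
      ((Multiplicative.toAdd (Multiplicative.ofAdd (Pi.single i 1 : Fin n → ℤ)) j : ℤ) : ℝ))) = g i := by
  have : (fun j => ((Multiplicative.toAdd (Multiplicative.ofAdd (Pi.single i 1 : Fin n → ℤ)) j : ℤ) : ℝ))
      = Pi.single i 1 := by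
    funext j
    by_cases hj : j = i
    · subst hj; simp
    · simp [hj]
  rw [this, comb_single, h.nexp_lgn]

lemma rep_eq {g : Fin n → Matrix (Fin n ⊕ Unit) (Fin n ⊕ Unit) ℝ} (h : Good g)
    {L : (Matrix (Fin n) (Fin n) ℝ)ˣ} {ρ : Multiplicative (Fin n → ℤ) →* (V ≃ᵃ[ℝ] V)}
    (hρ : ∀ i, mat b (ρ (Multiplicative.ofAdd (Pi.single i 1))) = cj L (g i))
    (γ : Multiplicative (Fin n → ℤ)) : mat b (ρ γ) =
      cj L (nexp (comb (fun i => lgn (g i)) (fun i => ((Multiplicative.toAdd γ i : ℤ) : ℝ)))) := by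
  obtain ⟨ρ', h'⟩ := exists_rep_hom b h L
  have : ρ = ρ' := zn_hom_ext fun i => mat_inj b (by rw [hρ, h', rep_gen h])
  rw [this, h']

lemma hv_inj {x y : Fin n → ℝ} (h : hv x = hv y) : x = y := by
  funext i
  exact congrFun h (Sum.inl i)

variable [FiniteDimensional ℝ V]

/-- the chart -/
noncomputable def chart {N : Fin n → Matrix (Fin n ⊕ Unit) (Fin n ⊕ Unit) ℝ} (hN : NData N)
    (L : (Matrix (Fin n) (Fin n) ℝ)ˣ) : V ≃ₜ (Fin n → ℝ) where
  toFun v := sC N ((↑(L⁻¹) : Matrix (Fin n) (Fin n) ℝ) *ᵥ b.equivFun v)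
  invFun t := b.equivFun.symm ((L : Matrix (Fin n) (Fin n) ℝ) *ᵥ thC N t)
  left_inv v := by
    simp only
    rw [hN.th_s, mulVec_mulVec, L.mul_inv, one_mulVec, LinearEquiv.symm_apply_apply]
  right_inv t := by
    simp only
    rw [LinearEquiv.apply_symm_apply, mulVec_mulVec, L.inv_mul, one_mulVec, hN.s_th]
  continuous_toFun := by
    have hb : Continuous b.equivFun := LinearMap.continuous_of_finiteDimensional b.equivFun.toLinearMap
    have hs : Continuous (sC N) := NData.polyMap_sC.continuous'
    exact hs.comp (continuous_const.matrix_mulVec hb)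
  continuous_invFun := by
    have hb : Continuous b.equivFun.symm :=
      LinearMap.continuous_of_finiteDimensional b.equivFun.symm.toLinearMap
    have hs : Continuous (thC N) := hN.polyMap_thC.continuous'
    exact hb.comp (continuous_const.matrix_mulVec hs)

lemma chart_apply {N : Fin n → Matrix (Fin n ⊕ Unit) (Fin n ⊕ Unit) ℝ} (hN : NData N)
    (L : (Matrix (Fin n) (Fin n) ℝ)ˣ) (v : V) : chart b hN L v =
      sC N ((↑(L⁻¹) : Matrix (Fin n) (Fin n) ℝ) *ᵥ b.equivFun v) := rfl

lemma chart_equivariant {N : Fin n → Matrix (Fin n ⊕ Unit) (Fin n ⊕ Unit) ℝ} (hN : NData N)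
    {L : (Matrix (Fin n) (Fin n) ℝ)ˣ} {a : V ≃ᵃ[ℝ] V} {t : Fin n → ℝ}
    (ha : mat b a = cj L (nexp (comb N t))) (v : V) :
    chart b hN L (a v) = t + chart b hN L v := by
  rw [chart_apply, chart_apply]
  set y := (↑(L⁻¹) : Matrix (Fin n) (Fin n) ℝ) *ᵥ b.equivFun v with hy
  have h1 := mat_hv b a v
  rw [ha, cj_apply, ← mulVec_mulVec, hm_mulVec_hv, ← hy] at h1
  have h2 : hv y = nexp (comb N (sC N y)) *ᵥ e0 n := by rw [hN.nexp_e0, hN.th_s]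
  rw [h2, ← mulVec_mulVec, mulVec_mulVec _ (nexp (comb N t)), ← nexp_comb_add hN.comm hN.nil, hN.nexp_e0, hm_mulVec_hv] at h1
  have h3 := hv_inj h1
  rw [← h3, mulVec_mulVec, L.inv_mul, one_mulVec, hN.s_th]

lemma rep_cryst {g : Fin n → Matrix (Fin n ⊕ Unit) (Fin n ⊕ Unit) ℝ} (h : Good g)
    {L : (Matrix (Fin n) (Fin n) ℝ)ˣ} {ρ : Multiplicative (Fin n → ℤ) →* (V ≃ᵃ[ℝ] V)}
    (hρ : ∀ i, mat b (ρ (Multiplicative.ofAdd (Pi.single i 1))) = cj L (g i)) :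
    Function.Injective ρ ∧ IsCrystallographic ρ.range :=
  crystallographic_of_chart ρ (chart b h.nd L)
    fun γ v => chart_equivariant b h.nd (rep_eq b h hρ γ) v

/-- data of a crystallographic homomorphism -/
lemma homC_data (hn : Module.finrank ℝ V = n)
    (ρ : Multiplicative (Fin n → ℤ) →* (V ≃ᵃ[ℝ] V))
    (hinj : Function.Injective ρ) (hpd : ProperlyDiscontinuousAff ρ.range) :
    ∃ L : (Matrix (Fin n) (Fin n) ℝ)ˣ, (L : Matrix (Fin n) (Fin n) ℝ) =
      Lmat (fun i => mat b (ρ (Multiplicative.ofAdd (Pi.single i 1)))) ∧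
      Good (fun i => cj L⁻¹ (mat b (ρ (Multiplicative.ofAdd (Pi.single i 1))))) := by
  obtain ⟨h1, h2⟩ := homC_unipotent hn ρ hinj hpd
  have hl : ∀ i, lgn (mat b (ρ (Multiplicative.ofAdd (Pi.single i 1)))) =
      LinearMap.toMatrixAlgEquiv (BB b)
        (aeval (affToLin (ρ (Multiplicative.ofAdd (Pi.single i 1))) - 1) (logP (n + 1))) := by
    intro i
    have := aeval_algHom_apply (LinearMap.toMatrixAlgEquiv (BB b)).toAlgHom
      (affToLin (ρ (Multiplicative.ofAdd (Pi.single i 1))) - 1) (logP (n + 1))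
    rw [lgn, mat_apply]
    refine Eq.trans ?_ this
    congr 1
    exact congrArg (fun f => aeval f) (by
      show _ = LinearMap.toMatrixAlgEquiv (BB b) _
      rw [map_sub, map_one])
  refine exists_good ?_ ?_ ?_ ?_
  · exact fun i => mat_row b _
  · intro i j
    rw [← map_mul (mat b), ← map_mul (mat b), ← map_mul ρ, ← map_mul ρ, mul_comm]
  · intro i
    rw [mat_apply]
    have : LinearMap.toMatrixAlgEquiv (BB b) (affToLin (ρ (Multiplicative.ofAdd (Pi.single i 1)))) - 1
      = LinearMap.toMatrixAlgEquiv (BB b) (affToLin (ρ (Multiplicative.ofAdd (Pi.single i 1))) - 1) := by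
      rw [map_sub, map_one]
    rw [this, ← map_pow, h1, map_zero]
  · intro t ht
    apply h2
    have h3 : comb (fun i => lgn (mat b (ρ (Multiplicative.ofAdd (Pi.single i 1))))) t =
        LinearMap.toMatrixAlgEquiv (BB b) (comb (fun i => aeval (affToLin
          (ρ (Multiplicative.ofAdd (Pi.single i 1))) - 1) (logP (n + 1))) t) := by
      simp only [comb, map_sum, map_smul, hl]
    rw [h3] at ht
    have h4 : e0 n = (BB b).equivFun (0, 1) := by
      rw [BB_repr, map_zero, e0_eq]; rfl
    rw [h4] at ht
    have h5 := LinearMap.toMatrix_mulVec_repr (BB b) (BB b) (comb (fun i => aeval (affToLin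
          (ρ (Multiplicative.ofAdd (Pi.single i 1))) - 1) (logP (n + 1))) t) (0, 1)
    have h6 := h5.symm.trans ht
    apply (BB b).equivFun.injective
    rw [map_zero]
    exact h6

end rep

end

section
open Matrix

section fin
variable {n : ℕ}

/-- the predicate describing the model space -/
def Pq (q : Matrix (Fin n ⊕ Unit) (Fin n ⊕ Unit) ℝ → ℝ)
    (g : Fin n → Matrix (Fin n ⊕ Unit) (Fin n ⊕ Unit) ℝ) (L L' : Matrix (Fin n) (Fin n) ℝ) : Prop :=
  Good g ∧ ∀ i, q (hm L * g i * hm L') = 0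

lemma good_iff (g : Fin n → Matrix (Fin n ⊕ Unit) (Fin n ⊕ Unit) ℝ) : Good g ↔
    (∀ i, e0 n ᵥ* g i = e0 n) ∧ (∀ i j, g i * g j = g j * g i) ∧
    (∀ i, (g i - 1) ^ (n + 1) = 0) ∧ ∀ i, lgn (g i) *ᵥ e0 n = Pi.single (Sum.inl i) 1 :=
  ⟨fun h => ⟨h.row, h.comm, h.uni, h.std⟩, fun h => ⟨h.1, h.2.1, h.2.2.1, h.2.2.2⟩⟩

lemma polyMap_coord {E : Type*} [AddCommGroup E] [Module ℝ E]
    {f : E → Fin n → Matrix (Fin n ⊕ Unit) (Fin n ⊕ Unit) ℝ} (hf : PolyMap f) (i : Fin n) :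
    PolyMap (fun x => f x i) :=
  PolyMap.comp (PolyMap.apply (F := fun _ => Matrix (Fin n ⊕ Unit) (Fin n ⊕ Unit) ℝ) i) hf

lemma SA_Pq {q : Matrix (Fin n ⊕ Unit) (Fin n ⊕ Unit) ℝ → ℝ} (hq : PolyMap q) :
    SA (fun z : (Fin n → Matrix (Fin n ⊕ Unit) (Fin n ⊕ Unit) ℝ) ×
      Matrix (Fin n) (Fin n) ℝ × Matrix (Fin n) (Fin n) ℝ => Pq q z.1 z.2.1 z.2.2) := by
  have hc := fun i => polyMap_coord (n := n) (E := (Fin n → Matrix (Fin n ⊕ Unit) (Fin n ⊕ Unit) ℝ) ×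
      Matrix (Fin n) (Fin n) ℝ × Matrix (Fin n) (Fin n) ℝ) (PolyMap.fst polyMap_id) i
  simp only [Pq, good_iff]
  refine SA.and (SA.and ?_ (SA.and ?_ (SA.and ?_ ?_))) ?_
  · exact SA.all_fin fun i => SA.eq (PolyMap.vecMul' _ (hc i)) (polyMap_const _)
  · exact SA.all_fin fun i => SA.all_fin fun j => SA.eq ((hc i).mul (hc j)) ((hc j).mul (hc i))
  · exact SA.all_fin fun i => SA.eq (((hc i).sub (polyMap_const _)).pow _) (polyMap_const _)
  · exact SA.all_fin fun i => SA.eq (PolyMap.mulVec' (polyMap_lgn (hc i)) (polyMap_const _))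
      (polyMap_const _)
  · exact SA.all_fin fun i => SA.eq_zero (PolyMap.comp hq
      (((polyMap_hm' (PolyMap.fst (PolyMap.snd polyMap_id))).mul (hc i)).mul
        (polyMap_hm' (PolyMap.snd (PolyMap.snd polyMap_id)))))

lemma closed_Pq {q : Matrix (Fin n ⊕ Unit) (Fin n ⊕ Unit) ℝ → ℝ} (hq : PolyMap q) :
    IsClosed {z : (Fin n → Matrix (Fin n ⊕ Unit) (Fin n ⊕ Unit) ℝ) ×
      Matrix (Fin n) (Fin n) ℝ × Matrix (Fin n) (Fin n) ℝ | Pq q z.1 z.2.1 z.2.2} := by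
  have hc := fun i => polyMap_coord (n := n) (E := (Fin n → Matrix (Fin n ⊕ Unit) (Fin n ⊕ Unit) ℝ) ×
      Matrix (Fin n) (Fin n) ℝ × Matrix (Fin n) (Fin n) ℝ) (PolyMap.fst polyMap_id) i
  simp only [Pq, good_iff, Set.setOf_and, Set.setOf_forall]
  refine IsClosed.inter (IsClosed.inter ?_ (IsClosed.inter ?_ (IsClosed.inter ?_ ?_))) ?_
  · exact isClosed_iInter fun i => isClosed_eq (PolyMap.vecMul' _ (hc i)).continuous' continuous_const
  · exact isClosed_iInter fun i => isClosed_iInter fun j =>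
      isClosed_eq ((hc i).mul (hc j)).continuous' ((hc j).mul (hc i)).continuous'
  · exact isClosed_iInter fun i =>
      isClosed_eq (((hc i).sub (polyMap_const _)).pow _).continuous' continuous_const
  · exact isClosed_iInter fun i =>
      isClosed_eq (PolyMap.mulVec' (polyMap_lgn (hc i)) (polyMap_const _)).continuous' continuous_const
  · exact isClosed_iInter fun i => isClosed_eq (PolyMap.comp hq
      (((polyMap_hm' (PolyMap.fst (PolyMap.snd polyMap_id))).mul (hc i)).mul
        (polyMap_hm' (PolyMap.snd (PolyMap.snd polyMap_id))))).continuous' continuous_const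

lemma closed_Pq' {q : Matrix (Fin n ⊕ Unit) (Fin n ⊕ Unit) ℝ → ℝ} (hq : PolyMap q) :
    IsClosed {z : (Fin n → Matrix (Fin n ⊕ Unit) (Fin n ⊕ Unit) ℝ) ×
      (Matrix (Fin n) (Fin n) ℝ)ˣ | Pq q z.1 z.2 (↑(z.2⁻¹))} := by
  have hcont : Continuous (fun z : (Fin n → Matrix (Fin n ⊕ Unit) (Fin n ⊕ Unit) ℝ) ×
      (Matrix (Fin n) (Fin n) ℝ)ˣ => (z.1, (z.2 : Matrix (Fin n) (Fin n) ℝ),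
        (↑(z.2⁻¹) : Matrix (Fin n) (Fin n) ℝ))) :=
    continuous_fst.prodMk ((Units.continuous_val.comp continuous_snd).prodMk
      (Units.continuous_coe_inv.comp continuous_snd))
  exact (closed_Pq hq).preimage hcont

lemma zn_mem {G : Type*} [Group G] {A : Subgroup G} {ρ : Multiplicative (Fin n → ℤ) →* G}
    (h : ∀ i, ρ (Multiplicative.ofAdd (Pi.single i 1)) ∈ A) (m : Multiplicative (Fin n → ℤ)) :
    ρ m ∈ A := by
  have hm : m = ∏ i, (Multiplicative.ofAdd (Pi.single i (1:ℤ) : Fin n → ℤ)) ^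
      (Multiplicative.toAdd m i) := by
    apply Multiplicative.toAdd.injective
    rw [toAdd_prod]
    simp only [toAdd_zpow, toAdd_ofAdd]
    funext j
    simp [Finset.sum_apply, Pi.single_apply]
  have : m ∈ A.comap ρ := by
    rw [hm]
    exact Subgroup.prod_mem _ fun i _ =>
      Subgroup.zpow_mem (A.comap ρ) (Subgroup.mem_comap.2 (h i)) _
  exact this

lemma poly_int_zero {f : (Fin n → ℝ) → ℝ} (hf : PolyMap f)
    (h0 : ∀ m : Fin n → ℤ, f (fun i => (m i : ℝ)) = 0) (t : Fin n → ℝ) : f t = 0 := by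
  obtain ⟨p, hp⟩ := polyFun_mvPolynomial (polyMap_real.1 hf)
  have : p = 0 := by
    apply MvPolynomial.funext_set (fun _ => Set.range (fun k : ℤ => (k : ℝ)))
    · intro i
      exact Set.infinite_range_of_injective Int.cast_injective
    · intro x hx
      choose m hm using fun i => hx i (Set.mem_univ i)
      have : x = fun i => (m i : ℝ) := funext fun i => (hm i).symm
      rw [map_zero, ← hp, this, h0]
  rw [hp, this, map_zero]

variable {V : Type*} [NormedAddCommGroup V] [NormedSpace ℝ V] [FiniteDimensional ℝ V]
  (b : Module.Basis (Fin n) ℝ V)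

lemma mat_conj (c : (Matrix (Fin n) (Fin n) ℝ)ˣ) (g : V ≃ᵃ[ℝ] V) :
    mat b (glAff b c * g * (glAff b c)⁻¹) = cj c (mat b g) := by
  rw [← map_inv, map_mul, map_mul, mat_glAff, mat_glAff, cj_apply]

lemma exists_aff_gen {g : Fin n → Matrix (Fin n ⊕ Unit) (Fin n ⊕ Unit) ℝ} (h : Good g)
    (L : (Matrix (Fin n) (Fin n) ℝ)ˣ) (i : Fin n) : ∃ a : V ≃ᵃ[ℝ] V, mat b a = cj L (g i) := by
  obtain ⟨a, ha⟩ := exists_aff_nexp b h L (Pi.single i 1)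
  exact ⟨a, by rw [ha, comb_single, h.nexp_lgn]⟩

variable {A : Subgroup (V ≃ᵃ[ℝ] V)} {q : Matrix (Fin n ⊕ Unit) (Fin n ⊕ Unit) ℝ → ℝ}

lemma Pq_inv (hq : ∀ g, g ∈ A ↔ q (mat b g) = 0)
    (g : Fin n → Matrix (Fin n ⊕ Unit) (Fin n ⊕ Unit) ℝ) (L a : (Matrix (Fin n) (Fin n) ℝ)ˣ)
    (ha : a ∈ A.comap (glAff b)) (h : Pq q g L (↑(L⁻¹))) :
    Pq q g (↑(a * L)) (↑((a * L)⁻¹)) := by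
  refine ⟨h.1, fun i => ?_⟩
  obtain ⟨k, hk⟩ := exists_aff_gen b h.1 L i
  have hkA : k ∈ A := by
    rw [hq, hk]
    exact h.2 i
  have h2 : glAff b a * k * (glAff b a)⁻¹ ∈ A := A.mul_mem (A.mul_mem ha hkA) (A.inv_mem ha)
  rw [hq, mat_conj, hk, ← cj_mul] at h2
  exact h2

/-- the centraliser in `A` is transitive -/
lemma exists_centr (hqp : PolyMap q) (hq : ∀ g, g ∈ A ↔ q (mat b g) = 0)
    {g : Fin n → Matrix (Fin n ⊕ Unit) (Fin n ⊕ Unit) ℝ} (h : Good g)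
    {L : (Matrix (Fin n) (Fin n) ℝ)ˣ} {ρ : Multiplicative (Fin n → ℤ) →* (V ≃ᵃ[ℝ] V)}
    (hρ : ∀ i, mat b (ρ (Multiplicative.ofAdd (Pi.single i 1))) = cj L (g i))
    (hA : ∀ γ, ρ γ ∈ A) (x : V) : ∃ k ∈ A, k 0 = x ∧ ∀ γ, k * ρ γ = ρ γ * k := by
  have hN := h.nd
  obtain ⟨k, hk⟩ := exists_aff_nexp b h L (chart b hN L x - chart b hN L 0)
  refine ⟨k, ?_, ?_, ?_⟩
  · rw [hq, hk]
    refine poly_int_zero (f := fun t => q (cj L (nexp (comb (fun i => lgn (g i)) t)))) ?_ ?_ _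
    · exact PolyMap.comp hqp (PolyMap.linear (cj L).toLinearMap hN.polyMap_nexp)
    · intro m
      have := hA (Multiplicative.ofAdd m)
      rw [hq, rep_eq b h hρ] at this
      exact this
  · apply (chart b hN L).injective
    rw [chart_equivariant b hN hk, sub_add_cancel]
  · intro γ
    apply mat_inj b
    rw [map_mul, map_mul, hk, rep_eq b h hρ, ← map_mul, ← map_mul,
      ← nexp_comb_add hN.comm hN.nil, ← nexp_comb_add hN.comm hN.nil, add_comm]

lemma conj_iff (hqp : PolyMap q) (hq : ∀ g, g ∈ A ↔ q (mat b g) = 0)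
    {g g' : Fin n → Matrix (Fin n ⊕ Unit) (Fin n ⊕ Unit) ℝ} (h : Good g) (h' : Good g')
    {L L' : (Matrix (Fin n) (Fin n) ℝ)ˣ} {ρ ρ' : Multiplicative (Fin n → ℤ) →* (V ≃ᵃ[ℝ] V)}
    (hρ : ∀ i, mat b (ρ (Multiplicative.ofAdd (Pi.single i 1))) = cj L (g i))
    (hρ' : ∀ i, mat b (ρ' (Multiplicative.ofAdd (Pi.single i 1))) = cj L' (g' i))
    (hA : ∀ γ, ρ γ ∈ A) :
    (∃ a ∈ A, ∀ γ, ρ' γ = a * ρ γ * a⁻¹) ↔ g = g' ∧ L' * L⁻¹ ∈ A.comap (glAff b) := by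
  constructor
  · rintro ⟨a, ha, hc⟩
    obtain ⟨k, hkA, hk0, hkc⟩ := exists_centr b hqp hq h hρ hA (a⁻¹ 0)
    have h0 : (a * k) 0 = 0 := by
      show a (k 0) = 0
      rw [hk0]
      exact a.apply_symm_apply 0
    obtain ⟨c, hc'⟩ := aff_fix b h0
    have hconj : ∀ γ, ρ' γ = (a * k) * ρ γ * (a * k)⁻¹ := by
      intro γ
      rw [hc γ, mul_assoc a k, hkc γ]
      group
    have h1 : ∀ i, cj L' (g' i) = cj (c * L) (g i) := by
      intro i
      rw [← hρ', hconj, hc', mat_conj, hρ, cj_mul]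
    have h2 : L' = c * L := by
      apply Units.ext
      rw [← h'.Lmat_eq L', ← h.Lmat_eq (c * L)]
      congr 1
      funext i
      exact h1 i
    refine ⟨?_, ?_⟩
    · funext i
      have := h1 i
      rw [← h2] at this
      have h3 := congrArg (cj L'⁻¹) this
      rw [cj_inv_cj, cj_inv_cj] at h3
      exact h3.symm
    · rw [h2, mul_assoc, mul_inv_cancel, mul_one]
      show glAff b c ∈ A
      rw [← hc']
      exact A.mul_mem ha hkA
  · rintro ⟨rfl, ha⟩
    refine ⟨glAff b (L' * L⁻¹), ha, ?_⟩
    have : ρ' = (MulAut.conj (glAff b (L' * L⁻¹))).toMonoidHom.comp ρ := by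
      apply zn_hom_ext
      intro i
      apply mat_inj b
      show _ = mat b (glAff b (L' * L⁻¹) * ρ _ * (glAff b (L' * L⁻¹))⁻¹)
      rw [mat_conj, hρ, hρ', ← cj_mul, mul_assoc, inv_mul_cancel, mul_one]
    intro γ
    rw [this]
    rfl

lemma exists_homeo_model (hn : Module.finrank ℝ V = n) (hq : ∀ g, g ∈ A ↔ q (mat b g) = 0) :
    ∃ e : ↥(homC A (Multiplicative (Fin n → ℤ))) ≃ₜ
      ↥{z : (Fin n → Matrix (Fin n ⊕ Unit) (Fin n ⊕ Unit) ℝ) ×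
        (Matrix (Fin n) (Fin n) ℝ)ˣ | Pq q z.1 z.2 (↑(z.2⁻¹))},
      ∀ ρ i, mat b (ρ.1 (Multiplicative.ofAdd (Pi.single i 1))) = cj (e ρ).1.2 ((e ρ).1.1 i) := by
  choose L hL hgood using fun ρ : ↥(homC A (Multiplicative (Fin n → ℤ))) =>
    homC_data b hn ρ.1 ρ.2.1 ρ.2.2.2.1
  choose R hR using fun z : ↥{z : (Fin n → Matrix (Fin n ⊕ Unit) (Fin n ⊕ Unit) ℝ) ×
        (Matrix (Fin n) (Fin n) ℝ)ˣ | Pq q z.1 z.2 (↑(z.2⁻¹))} => exists_rep_hom b z.2.1 z.1.2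
  have hRgen : ∀ z i, mat b (R z (Multiplicative.ofAdd (Pi.single i 1))) = cj z.1.2 (z.1.1 i) := by
    intro z i
    rw [hR, rep_gen z.2.1]
  have hRA : ∀ z, R z ∈ homC A (Multiplicative (Fin n → ℤ)) := by
    intro z
    obtain ⟨h1, h2⟩ := rep_cryst b z.2.1 (hRgen z)
    refine ⟨h1, zn_mem fun i => ?_, h2⟩
    rw [hq, hRgen]
    exact z.2.2 i
  have hF : ∀ ρ : ↥(homC A (Multiplicative (Fin n → ℤ))),
      Pq q (fun i => cj (L ρ)⁻¹ (mat b (ρ.1 (Multiplicative.ofAdd (Pi.single i 1)))))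
        (L ρ) (↑((L ρ)⁻¹)) := by
    intro ρ
    refine ⟨hgood ρ, fun i => ?_⟩
    have := ρ.2.2.1 (Multiplicative.ofAdd (Pi.single i 1))
    rw [hq] at this
    have h2 := cj_cj_inv (L ρ) (mat b (ρ.1 (Multiplicative.ofAdd (Pi.single i 1))))
    rw [cj_apply] at h2
    rw [h2]
    exact this
  have hcmat : ∀ i, Continuous (fun ρ : ↥(homC A (Multiplicative (Fin n → ℤ))) =>
      mat b (ρ.1 (Multiplicative.ofAdd (Pi.single i 1)))) := fun i =>
    (continuous_mat_hom b _).comp continuous_subtype_val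
  have hlgn : Continuous (lgn (n := n)) := (polyMap_lgn polyMap_id).continuous'
  have hhm : Continuous (hm (n := n)) := polyMap_hm.continuous'
  have hLc : Continuous L := by
    apply continuous_units_of_val
    simp only [hL]
    apply continuous_matrix
    intro j i
    have : Continuous (fun ρ : ↥(homC A (Multiplicative (Fin n → ℤ))) =>
        lgn (mat b (ρ.1 (Multiplicative.ofAdd (Pi.single i 1)))) *ᵥ e0 n) :=
      (hlgn.comp (hcmat i)).matrix_mulVec continuous_const
    exact (continuous_apply (Sum.inl j)).comp this
  let e : ↥(homC A (Multiplicative (Fin n → ℤ))) ≃ₜ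
      ↥{z : (Fin n → Matrix (Fin n ⊕ Unit) (Fin n ⊕ Unit) ℝ) ×
        (Matrix (Fin n) (Fin n) ℝ)ˣ | Pq q z.1 z.2 (↑(z.2⁻¹))} :=
    { toFun := fun ρ => ⟨(fun i => cj (L ρ)⁻¹ (mat b (ρ.1 (Multiplicative.ofAdd (Pi.single i 1)))),
        L ρ), hF ρ⟩
      invFun := fun z => ⟨R z, hRA z⟩
      left_inv := by
        intro ρ
        apply Subtype.ext
        apply zn_hom_ext
        intro i
        apply mat_inj b
        rw [hRgen]
        exact cj_cj_inv _ _
      right_inv := by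
        intro z
        have hLz : L ⟨R z, hRA z⟩ = z.1.2 := by
          apply Units.ext
          rw [hL]
          simp only [hRgen]
          exact z.2.1.Lmat_eq _
        apply Subtype.ext
        refine Prod.ext ?_ hLz
        funext i
        show cj (L ⟨R z, hRA z⟩)⁻¹ (mat b (R z _)) = _
        rw [hLz, hRgen, cj_inv_cj]
      continuous_toFun := by
        refine Continuous.subtype_mk (Continuous.prodMk (continuous_pi fun i => ?_) hLc) _
        simp only [cj_apply]
        refine ((hhm.comp ?_).matrix_mul (hcmat i)).matrix_mul (hhm.comp ?_)
        · exact Units.continuous_coe_inv.comp hLc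
        · simp only [inv_inv]
          exact Units.continuous_val.comp hLc
      continuous_invFun := by
        refine Continuous.subtype_mk (continuous_hom_of_mat b fun γ => ?_) _
        simp only [hR, cj_apply]
        have hz2 : Continuous (fun z : ↥{z : (Fin n → Matrix (Fin n ⊕ Unit) (Fin n ⊕ Unit) ℝ) ×
          (Matrix (Fin n) (Fin n) ℝ)ˣ | Pq q z.1 z.2 (↑(z.2⁻¹))} => z.1.2) :=
          continuous_snd.comp continuous_subtype_val
        refine ((hhm.comp (Units.continuous_val.comp hz2)).matrix_mul ?_).matrix_mul
          (hhm.comp (Units.continuous_coe_inv.comp hz2))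
        let t : Fin n → ℝ := fun i => ((Multiplicative.toAdd γ i : ℤ) : ℝ)
        have hpoly : PolyMap (fun g : Fin n → Matrix (Fin n ⊕ Unit) (Fin n ⊕ Unit) ℝ =>
            ∑ i ∈ Finset.range (n + 1), ((i.factorial : ℝ)⁻¹) •
              comb (fun i => lgn (g i)) t ^ i) :=
          PolyMap.sum _ fun i => ((PolyMap.comb' (fun i => polyMap_lgn
            (polyMap_coord polyMap_id i)) (polyMap_const t)).pow i).const_smul _
        have h5 := hpoly.continuous'.comp (continuous_fst.comp (continuous_subtype_val
          (p := fun z => z ∈ {z : (Fin n → Matrix (Fin n ⊕ Unit) (Fin n ⊕ Unit) ℝ) ×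
            (Matrix (Fin n) (Fin n) ℝ)ˣ | Pq q z.1 z.2 (↑(z.2⁻¹))})))
        refine h5.congr fun z => ?_
        exact (nexp_eq_sum (pow_n1 (z.2.1.nd.cnil t))).symm }
  exact ⟨e, fun ρ i => (cj_cj_inv _ _).symm⟩

theorem final_aux (hn : Module.finrank ℝ V = n) (hA : IsZariskiClosedAff (A : Set (V ≃ᵃ[ℝ] V))) :
    ∃ (N : ℕ) (S : Set (Fin N → ℝ)), IsSemialgebraicSet S ∧
      Nonempty (Quotient (conjSetoid A (Multiplicative (Fin n → ℤ))) ≃ₜ ↥S) := by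
  let b : Module.Basis (Fin n) ℝ V := Module.finBasisOfFinrankEq ℝ V hn
  obtain ⟨q, hqp, hq⟩ := exists_q b hA
  have hq : ∀ g, g ∈ A ↔ q (mat b g) = 0 := hq
  obtain ⟨N, S, hS, Ψ, hΨ, hΨeq⟩ := quotient_model (q := fun a => q (hm a))
    (PolyMap.comp hqp polyMap_hm) (H := A.comap (glAff b))
    (fun a => by rw [Subgroup.mem_comap, hq, mat_glAff]) (P := Pq q) (SA_Pq hqp) (closed_Pq' hqp)
    (fun g L a ha h => Pq_inv b hq g L a ha h)
  obtain ⟨e, he⟩ := exists_homeo_model b hn hq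
  refine ⟨N, S, hS, ⟨?_⟩⟩
  have hquot : Topology.IsQuotientMap (Ψ ∘ e) := hΨ.comp e.isQuotientMap
  have hker : conjSetoid A (Multiplicative (Fin n → ℤ)) = Setoid.ker (Ψ ∘ e) := by
    ext ρ ρ'
    rw [Setoid.ker_def, Function.comp_apply, Function.comp_apply, hΨeq]
    exact conj_iff b hqp hq (e ρ).2.1 (e ρ').2.1 (he ρ) (he ρ') ρ.2.2.1
  let F : C(↥(homC A (Multiplicative (Fin n → ℤ))), ↥S) := ⟨Ψ ∘ e, hquot.continuous⟩
  have hF : Topology.IsQuotientMap F := hquot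
  rw [hker]
  exact Topology.IsQuotientMap.homeomorph (f := F) hF

theorem final_main (hn : Module.finrank ℝ V = n) (hA : IsZariskiClosedAff (A : Set (V ≃ᵃ[ℝ] V))) :
    (∃ (N : ℕ) (S : Set (Fin N → ℝ)), IsSemialgebraicSet S ∧
      Nonempty (Quotient (conjSetoid A (Multiplicative (Fin n → ℤ))) ≃ₜ ↥S)) ∧
    T2Space (Quotient (conjSetoid A (Multiplicative (Fin n → ℤ)))) := by
  have h := final_aux hn hA
  refine ⟨h, ?_⟩
  obtain ⟨N, S, -, ⟨e⟩⟩ := h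
  exact e.symm.t2Space

end fin

end

/-- For `V` of dimension `n` and a Zariski-closed subgroup `A ≤ Aff(V)` acting
transitively on `V`, the deformation space `D_c(ℤ^n, A)` is homeomorphic to a
semi-algebraic set; in particular it is a Hausdorff space. -/
theorem defSpace_of_zn_semialgebraic_and_hausdorff
    {V : Type*} [NormedAddCommGroup V] [NormedSpace ℝ V] [FiniteDimensional ℝ V]
    (n : ℕ) (hn : Module.finrank ℝ V = n)
    (A : Subgroup (V ≃ᵃ[ℝ] V)) (hA : IsZariskiClosedAff (A : Set (V ≃ᵃ[ℝ] V)))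
    (htrans : ∀ x y : V, ∃ a ∈ A, a x = y) :
    (∃ (N : ℕ) (S : Set (Fin N → ℝ)), IsSemialgebraicSet S ∧
      Nonempty ((Quotient (conjSetoid A (Multiplicative (Fin n → ℤ)))) ≃ₜ ↥S)) ∧
    T2Space (Quotient (conjSetoid A (Multiplicative (Fin n → ℤ)))) := by
  exact final_main hn hA

end
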